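/- Let ν > n/2 − 1 and let m > n/2 − 1 be an integer. For a holomorphic G on T_Λ with M(G) := sup_{z} Δ(Im z)^m |□^m G(z)| < ∞, define γ_G(F) = ∫_{T_Λ} F(z) \overline{□^m G(z)} Δ(Im z)^m dV_ν(z) for F ∈ A¹_ν. Then: (a) there is C such that γ_G is well defined (the integral converges absolutely) and |γ_G(F)| ≤ C · M(G) · ‖F‖_{L¹_ν} for all F ∈ A¹_ν; (b) for every continuous linear functional γ on A¹_ν (with the L¹_ν norm) there exists such a G with γ = γ_G and M(G) ≤ C ‖γ‖; (c) for two such functions G₁, G₂ one has γ_{G₁} = γ_{G₂} if and only if □^m G₁ = □^m G₂. -/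

import Mathlib

open MeasureTheory Complex Set
open scoped ENNReal

noncomputable section

/-- The Lorentz form `Δ(y) = y₁² − y₂² − ⋯ − yₙ²` on `ℝⁿ`
(written as `2 y₀² − ∑ yᵢ²` with 0-based indexing). -/
def lor {n : ℕ} [NeZero n] (y : Fin n → ℝ) : ℝ := 2 * y 0 ^ 2 - ∑ i, y i ^ 2

/-- The holomorphic extension of the Lorentz form to `ℂⁿ`. -/
def lorC {n : ℕ} [NeZero n] (z : Fin n → ℂ) : ℂ := 2 * z 0 ^ 2 - ∑ i, z i ^ 2

/-- Componentwise imaginary part. -/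
def imP {n : ℕ} (z : Fin n → ℂ) : Fin n → ℝ := fun i => (z i).im

/-- The forward light cone `Λ`. -/
def cone (n : ℕ) [NeZero n] : Set (Fin n → ℝ) := {y | 0 < lor y ∧ 0 < y 0}

/-- The tube domain `T_Λ` over the forward light cone. -/
def tube (n : ℕ) [NeZero n] : Set (Fin n → ℂ) := {z | imP z ∈ cone n}

/-- The weighted measure `dV_ν = Δ(Im z)^{ν − n/2} dz` on `T_Λ`. -/
def dV (n : ℕ) [NeZero n] (ν : ℝ) : Measure (Fin n → ℂ) :=
  ((volume : Measure (Fin n → ℂ)).restrict (tube n)).withDensity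
    (fun z => ENNReal.ofReal (lor (imP z) ^ (ν - (n : ℝ) / 2)))

/-- `∫ |F|^p dV_ν` (as an extended nonnegative real). -/
def lpInt (n : ℕ) [NeZero n] (p ν : ℝ) (F : (Fin n → ℂ) → ℂ) : ℝ≥0∞ :=
  ∫⁻ z, ENNReal.ofReal (‖F z‖ ^ p) ∂(dV n ν)

/-- The `L^p_ν` norm `(∫ |F|^p dV_ν)^{1/p}`. -/
def lpNorm (n : ℕ) [NeZero n] (p ν : ℝ) (F : (Fin n → ℂ) → ℂ) : ℝ≥0∞ :=
  (lpInt n p ν F) ^ (1 / p)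

/-- The Bergman space `A^p_ν`: holomorphic on `T_Λ` and in `L^p_ν`. -/
def memA (n : ℕ) [NeZero n] (p ν : ℝ) (F : (Fin n → ℂ) → ℂ) : Prop :=
  DifferentiableOn ℂ F (tube n) ∧ lpInt n p ν F < ⊤

/-- Partial derivative `∂/∂zᵢ`. -/
def pd {n : ℕ} (i : Fin n) (F : (Fin n → ℂ) → ℂ) : (Fin n → ℂ) → ℂ :=
  fun z => fderiv ℂ F z (Pi.single i 1)

/-- The wave (Box) operator `□ = −(∂₁² − ∂₂² − ⋯ − ∂ₙ²)`, so that
`□ e^{i z·ξ} = Δ(ξ) e^{i z·ξ}`. -/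
def BoxOp {n : ℕ} [NeZero n] (F : (Fin n → ℂ) → ℂ) : (Fin n → ℂ) → ℂ :=
  fun z => -(2 * pd 0 (pd 0 F) z - ∑ i, pd i (pd i F) z)

/-- The (unnormalized) Bergman kernel `B_β(z,w) = Δ((z − w̄)/i)^{−(β+n)}`. -/
def berg (n : ℕ) [NeZero n] (β : ℝ) (z w : Fin n → ℂ) : ℂ :=
  lorC (fun i => (z i - (starRingEnd ℂ) (w i)) / Complex.I) ^ (-(β + (n : ℝ)) : ℂ)

/-- The Hardy inequality holds for `(p, ν)`:
`∫ |F|^p dV_ν ≤ C ∫ |Δ(Im z) □F(z)|^p dV_ν(z)` for all `F ∈ A^p_ν`. -/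
def hardy (n : ℕ) [NeZero n] (p ν : ℝ) : Prop :=
  ∃ C > (0 : ℝ), ∀ F, memA n p ν F →
    lpInt n p ν F ≤ ENNReal.ofReal C *
      lpInt n p ν (fun z => (lor (imP z) : ℂ) * BoxOp F z)

/-- `g` is the orthogonal projection of `f ∈ L²_ν` onto the closed subspace `A²_ν`:
`g ∈ A²_ν` and `f − g ⊥ A²_ν`. -/
def isProj (n : ℕ) [NeZero n] (ν : ℝ) (f g : (Fin n → ℂ) → ℂ) : Prop :=
  memA n 2 ν g ∧ ∀ h, memA n 2 ν h →
    ∫ z, f z * (starRingEnd ℂ) (h z) ∂(dV n ν) =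
      ∫ z, g z * (starRingEnd ℂ) (h z) ∂(dV n ν)

/-- The Bergman projection `P_ν` admits a bounded extension to `L^p_ν`:
`‖P_ν f‖_{L^p_ν} ≤ C ‖f‖_{L^p_ν}` for all `f ∈ L²_ν ∩ L^p_ν`. -/
def projBounded (n : ℕ) [NeZero n] (p ν : ℝ) : Prop :=
  ∃ C > (0 : ℝ), ∀ f g : (Fin n → ℂ) → ℂ,
    AEStronglyMeasurable f (dV n ν) → lpInt n 2 ν f < ⊤ → lpInt n p ν f < ⊤ →
    isProj n ν f g → lpNorm n p ν g ≤ ENNReal.ofReal C * lpNorm n p ν f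

/-- A bounded (continuous) linear functional on `A^p_ν`. -/
def isBddFunc (n : ℕ) [NeZero n] (p ν : ℝ) (γ : ((Fin n → ℂ) → ℂ) → ℂ) : Prop :=
  (∀ F G, memA n p ν F → memA n p ν G → γ (F + G) = γ F + γ G) ∧
  (∀ (c : ℂ) (F), memA n p ν F → γ (fun z => c * F z) = c * γ F) ∧
  ∃ C : ℝ, ∀ F, memA n p ν F → ‖γ F‖ ≤ C * (lpNorm n p ν F).toReal

/-! ### Holomorphic functions of several variables -/

open Metric Filter Topology in
theorem norm_fderiv_le_of_ball {E : Type*} [NormedAddCommGroup E] [NormedSpace ℂ E]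
    {F : E → ℂ} {z : E} {r M : ℝ} (hr : 0 < r) (hF : DifferentiableOn ℂ F (ball z r))
    (hM : ∀ w ∈ ball z r, ‖F w‖ ≤ M) : ‖fderiv ℂ F z‖ ≤ 2 / r * M := by
  have hM0 : 0 ≤ M := (norm_nonneg _).trans (hM z (mem_ball_self hr))
  have hFz : DifferentiableAt ℂ F z := hF.differentiableAt (ball_mem_nhds z hr)
  refine ContinuousLinearMap.opNorm_le_of_shell (ε := 2) (by norm_num) (by positivity)
    (c := (2 : ℂ)) (by norm_num) ?_
  intro v hv1 hv2
  have hv1 : 1 ≤ ‖v‖ := by simpa using hv1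
  have key : ∀ l : ℂ, ‖l‖ ≤ r / 2 → z + l • v ∈ ball z r := by
    intro l hl
    rw [mem_ball, dist_eq_norm, add_sub_cancel_left, norm_smul]
    calc ‖l‖ * ‖v‖ ≤ r / 2 * ‖v‖ := by gcongr
      _ < r / 2 * 2 := by gcongr
      _ = r := by ring
  have hd : DifferentiableOn ℂ (fun l : ℂ => F (z + l • v)) (closedBall 0 (r / 2)) := by
    refine hF.comp (Differentiable.differentiableOn (by fun_prop)) ?_
    intro l hl
    exact key l (by simpa using hl)
  have hd' : DiffContOnCl ℂ (fun l : ℂ => F (z + l • v)) (ball 0 (r / 2)) :=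
    ⟨hd.mono ball_subset_closedBall, by
      rw [closure_ball _ (by positivity)]; exact hd.continuousOn⟩
  have h1 := norm_deriv_le_of_forall_mem_sphere_norm_le (C := M) (half_pos hr) hd'
    (fun l hl => hM _ (key l (by simp at hl; exact hl.le)))
  have h2 : deriv (fun l : ℂ => F (z + l • v)) 0 = fderiv ℂ F z v := by
    have : HasDerivAt (fun l : ℂ => F (z + l • v)) (fderiv ℂ F z v) 0 := by
      have hline : HasDerivAt (fun l : ℂ => z + l • v) v 0 := by
        simpa using ((hasDerivAt_id (0 : ℂ)).smul_const v).const_add z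
      have hFz' : HasFDerivAt F (fderiv ℂ F z) (z + (0 : ℂ) • v) := by
        simpa using hFz.hasFDerivAt
      exact hFz'.comp_hasDerivAt (0 : ℂ) hline
    exact this.deriv
  rw [h2] at h1
  calc ‖fderiv ℂ F z v‖ ≤ M / (r / 2) := h1
    _ = 2 / r * M * 1 := by field_simp
    _ ≤ 2 / r * M * ‖v‖ := by gcongr

open Metric Filter Topology in
theorem hasFDerivAt_integral_of_ball {n : ℕ} {α : Type*} [MeasurableSpace α] {μ : Measure α}
    {K : (Fin n → ℂ) → α → ℂ} {b : α → ℝ} {z : Fin n → ℂ} {r : ℝ} (hr : 0 < r)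
    (hK : ∀ᵐ a ∂μ, DifferentiableOn ℂ (fun w => K w a) (ball z r))
    (hm : ∀ w ∈ ball z r, AEStronglyMeasurable (K w) μ)
    (hb : ∀ᵐ a ∂μ, ∀ w ∈ ball z r, ‖K w a‖ ≤ b a) (hbi : Integrable b μ) :
    AEStronglyMeasurable (fun a => fderiv ℂ (fun w => K w a) z) μ ∧
    HasFDerivAt (fun w => ∫ a, K w a ∂μ) (∫ a, fderiv ℂ (fun w => K w a) z ∂μ) z := by
  have hmeas : AEStronglyMeasurable (fun a => fderiv ℂ (fun w => K w a) z) μ := by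
    have h1 : ∀ i : Fin n, AEStronglyMeasurable
        (fun a => fderiv ℂ (fun w => K w a) z (Pi.single i 1)) μ := by
      intro i
      have hpos : ∀ k : ℕ, (0 : ℝ) < r / 2 / (k + 1) := fun k => by positivity
      have hmem : ∀ k : ℕ, z + ((r / 2 / (k + 1) : ℝ) : ℂ) • (Pi.single i 1 : Fin n → ℂ)
          ∈ ball z r := by
        intro k
        rw [mem_ball, dist_eq_norm, add_sub_cancel_left, norm_smul, Pi.norm_single,
          norm_one, mul_one, Complex.norm_real, Real.norm_of_nonneg (hpos k).le]
        calc r / 2 / (k + 1) ≤ r / 2 / 1 := by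
              gcongr; exact le_add_of_nonneg_left k.cast_nonneg
          _ < r := by linarith
      refine aestronglyMeasurable_of_tendsto_ae atTop
        (f := fun (k : ℕ) a => ((r / 2 / (k + 1) : ℝ) : ℂ)⁻¹ •
          (K (z + ((r / 2 / (k + 1) : ℝ) : ℂ) • (Pi.single i 1 : Fin n → ℂ)) a - K z a))
        (fun k => ((hm _ (hmem k)).sub (hm z (mem_ball_self hr))).const_smul
          (((r / 2 / (k + 1) : ℝ) : ℂ)⁻¹)) ?_
      filter_upwards [hK] with a ha
      have hd : HasFDerivAt (fun w => K w a) (fderiv ℂ (fun w => K w a) z) z :=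
        (ha.differentiableAt (ball_mem_nhds z hr)).hasFDerivAt
      have hline : HasDerivAt (fun l : ℂ => z + l • (Pi.single i 1 : Fin n → ℂ))
          (Pi.single i 1) 0 := by
        simpa using ((hasDerivAt_id (0 : ℂ)).smul_const (Pi.single i 1 : Fin n → ℂ)).const_add z
      have hd' : HasFDerivAt (fun w => K w a) (fderiv ℂ (fun w => K w a) z)
          (z + (0 : ℂ) • (Pi.single i 1 : Fin n → ℂ)) := by simpa using hd
      have h2 := (hd'.comp_hasDerivAt (0 : ℂ) hline).tendsto_slope_zero
      have ht : Tendsto (fun k : ℕ => ((r / 2 / (k + 1) : ℝ) : ℂ)) atTop (𝓝[≠] 0) := by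
        refine tendsto_nhdsWithin_iff.2 ⟨?_, Eventually.of_forall fun k => ?_⟩
        · have : Tendsto (fun k : ℕ => r / 2 / ((k : ℝ) + 1)) atTop (𝓝 0) := by
            simpa [div_eq_mul_inv] using
              (tendsto_one_div_add_atTop_nhds_zero_nat (𝕜 := ℝ)).const_mul (r / 2)
          simpa [Function.comp_def] using (Complex.continuous_ofReal.tendsto 0).comp this
        · exact Complex.ofReal_ne_zero.2 (hpos k).ne'
      simpa [Function.comp_def] using h2.comp ht
    have h2 : (fun a => fderiv ℂ (fun w => K w a) z) = fun a => ∑ i : Fin n,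
        (fderiv ℂ (fun w => K w a) z (Pi.single i 1)) •
          (ContinuousLinearMap.proj i : (Fin n → ℂ) →L[ℂ] ℂ) := by
      funext a
      ext v
      have hv : v = ∑ i : Fin n, v i • (Pi.single i 1 : Fin n → ℂ) := by
        conv_lhs => rw [← Finset.univ_sum_single v]
        exact Finset.sum_congr rfl fun i _ => by rw [← Pi.single_smul]; simp
      conv_lhs => rw [hv]
      simp [mul_comm]
    rw [h2]
    exact Finset.aestronglyMeasurable_fun_sum _ fun i _ => (h1 i).smul_const _
  refine ⟨hmeas, ?_⟩
  refine hasFDerivAt_integral_of_dominated_of_fderiv_le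
    (F' := fun w a => fderiv ℂ (fun w => K w a) w)
    (bound := fun a => 2 / (r / 2) * b a) (ball_mem_nhds z (half_pos hr))
    ?_ ?_ hmeas ?_ (hbi.const_mul _) ?_
  · filter_upwards [ball_mem_nhds z hr] with w hw using hm w hw
  · exact hbi.mono' (hm z (mem_ball_self hr)) (hb.mono fun a ha => ha z (mem_ball_self hr))
  · filter_upwards [hK, hb] with a ha hb w hw
    have hsub : ball w (r / 2) ⊆ ball z r := by
      refine ball_subset_ball' ?_
      have := mem_ball.1 hw
      linarith
    exact norm_fderiv_le_of_ball (half_pos hr) (ha.mono hsub) fun x hx => hb x (hsub hx)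
  · filter_upwards [hK] with a ha w hw
    exact (ha.differentiableAt (isOpen_ball.mem_nhds
      (ball_subset_ball (by linarith) hw))).hasFDerivAt

theorem differentiableOn_pd {n : ℕ} {U : Set (Fin n → ℂ)} (hU : IsOpen U)
    {F : (Fin n → ℂ) → ℂ} (hF : DifferentiableOn ℂ F U) (i : Fin n) :
    DifferentiableOn ℂ (pd i F) U := by
  open Metric Filter Topology in
  intro z hz
  refine DifferentiableAt.differentiableWithinAt ?_
  have hFc : ContinuousAt F z := (hF.differentiableAt (hU.mem_nhds hz)).continuousAt
  have hbd : ∀ᶠ w in 𝓝 z, ‖F w‖ < ‖F z‖ + 1 :=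
    hFc.norm.eventually (gt_mem_nhds (by linarith))
  obtain ⟨R, hR, hball⟩ := Metric.mem_nhds_iff.1 (inter_mem (hU.mem_nhds hz) hbd)
  set ρ := R / 2 with hρ
  have hρ0 : 0 < ρ := by positivity
  have hmem : ∀ w ∈ ball z ρ, ∀ l : ℂ, ‖l‖ ≤ ρ →
      w + l • (Pi.single i 1 : Fin n → ℂ) ∈ ball z R := by
    intro w hw l hl
    rw [mem_ball, dist_eq_norm] at hw ⊢
    calc ‖w + l • (Pi.single i 1 : Fin n → ℂ) - z‖
        = ‖(w - z) + l • (Pi.single i 1 : Fin n → ℂ)‖ := by congr 1; abel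
      _ ≤ ‖w - z‖ + ‖l • (Pi.single i 1 : Fin n → ℂ)‖ := norm_add_le _ _
      _ = ‖w - z‖ + ‖l‖ := by rw [norm_smul, Pi.norm_single, norm_one, mul_one]
      _ < ρ + ρ := by linarith
      _ = R := by rw [hρ]; ring
  have hFball : DifferentiableOn ℂ F (ball z R) := hF.mono fun w hw => (hball hw).1
  set K : (Fin n → ℂ) → ℝ → ℂ := fun w θ =>
    deriv (circleMap 0 ρ) θ * ((1 / (circleMap 0 ρ θ) ^ 2) *
      F (w + circleMap 0 ρ θ • (Pi.single i 1 : Fin n → ℂ))) with hKdef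
  have hrep : ∀ w ∈ ball z ρ, pd i F w = (2 * Real.pi * I)⁻¹ *
      ∫ θ in Ioc 0 (2 * Real.pi), K w θ := by
    intro w hw
    have hd : DifferentiableOn ℂ (fun l : ℂ => F (w + l • (Pi.single i 1 : Fin n → ℂ)))
        (closedBall 0 ρ) := by
      refine hFball.comp (Differentiable.differentiableOn (by fun_prop)) ?_
      intro l hl
      exact hmem w hw l (by simpa using hl)
    have h1 := hd.deriv_eq_smul_circleIntegral hρ0
    have h2 : deriv (fun l : ℂ => F (w + l • (Pi.single i 1 : Fin n → ℂ))) 0 = pd i F w := by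
      have hline : HasDerivAt (fun l : ℂ => w + l • (Pi.single i 1 : Fin n → ℂ))
          (Pi.single i 1) 0 := by
        simpa using ((hasDerivAt_id (0 : ℂ)).smul_const (Pi.single i 1 : Fin n → ℂ)).const_add w
      have hw' : w ∈ ball z R := ball_subset_ball (by linarith) hw
      have hd' : HasFDerivAt F (fderiv ℂ F w) (w + (0 : ℂ) • (Pi.single i 1 : Fin n → ℂ)) := by
        simpa using (hFball.differentiableAt (isOpen_ball.mem_nhds hw')).hasFDerivAt
      exact (hd'.comp_hasDerivAt (0 : ℂ) hline).deriv
    rw [h2, circleIntegral, intervalIntegral.integral_of_le (by positivity)] at h1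
    have h3 : (2 * (Real.pi : ℂ) * I) ≠ 0 := by simp [Real.pi_ne_zero]
    rw [eq_inv_mul_iff_mul_eq₀ h3]
    simpa [hKdef, smul_eq_mul] using h1.symm
  have hcirc : ∀ θ : ℝ, circleMap 0 ρ θ ≠ 0 := fun θ => by
    exact circleMap_ne_center hρ0.ne'
  have hKd : DifferentiableAt ℂ (fun w => ∫ θ in Ioc 0 (2 * Real.pi), K w θ) z := by
    refine (hasFDerivAt_integral_of_ball (b := fun _ => ρ * (1 / ρ ^ 2 * (‖F z‖ + 1)))
      hρ0 (Eventually.of_forall fun θ => ?_) (fun w hw => ?_)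
      (Eventually.of_forall fun θ => ?_) (integrable_const _)).2.differentiableAt
    · simp only [hKdef]
      refine (DifferentiableOn.const_mul ?_ _).const_mul _
      refine hFball.comp (Differentiable.differentiableOn (by fun_prop)) ?_
      intro w hw
      exact hmem w hw _ (by simp [abs_of_pos hρ0])
    · refine Continuous.aestronglyMeasurable ?_
      simp only [hKdef, deriv_circleMap]
      have hFcomp : Continuous fun θ : ℝ =>
          F (w + circleMap 0 ρ θ • (Pi.single i 1 : Fin n → ℂ)) := by
        refine hFball.continuousOn.comp_continuous ?_ fun θ =>
          hmem w hw _ (by simp [abs_of_pos hρ0])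
        have := continuous_circleMap 0 ρ
        fun_prop
      have := continuous_circleMap 0 ρ
      refine (by fun_prop : Continuous fun θ => circleMap 0 ρ θ * I).mul (Continuous.mul ?_ hFcomp)
      exact continuous_const.div (this.pow 2) fun θ => pow_ne_zero 2 (hcirc θ)
    · intro w hw
      simp only [hKdef, deriv_circleMap, norm_mul, norm_div, norm_pow, norm_one, Complex.norm_I,
        norm_circleMap_zero, abs_of_pos hρ0, mul_one]
      gcongr
      exact (hball (hmem w hw _ (by simp [abs_of_pos hρ0]))).2.le
  refine (hKd.const_mul ((2 * Real.pi * I)⁻¹)).congr_of_eventuallyEq ?_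
  filter_upwards [ball_mem_nhds z hρ0] with w hw using hrep w hw

theorem differentiableOn_boxOp {n : ℕ} [NeZero n] {U : Set (Fin n → ℂ)} (hU : IsOpen U)
    {F : (Fin n → ℂ) → ℂ} (hF : DifferentiableOn ℂ F U) : DifferentiableOn ℂ (BoxOp F) U := by
  unfold BoxOp
  have h := fun i => differentiableOn_pd hU (differentiableOn_pd hU hF i) i
  exact ((((h 0).const_mul 2).sub (DifferentiableOn.fun_sum fun i _ => h i))).neg

theorem differentiableOn_boxOp_iterate {n : ℕ} [NeZero n] {U : Set (Fin n → ℂ)} (hU : IsOpen U)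
    {F : (Fin n → ℂ) → ℂ} (hF : DifferentiableOn ℂ F U) (m : ℕ) :
    DifferentiableOn ℂ (BoxOp^[m] F) U := by
  induction m generalizing F with
  | zero => exact hF
  | succ m ih => exact ih (differentiableOn_boxOp hU hF)

theorem pd_congr {n : ℕ} {U : Set (Fin n → ℂ)} (hU : IsOpen U) {F G : (Fin n → ℂ) → ℂ}
    (h : EqOn F G U) (i : Fin n) : EqOn (pd i F) (pd i G) U := by
  intro z hz
  have : F =ᶠ[nhds z] G := Filter.eventuallyEq_of_mem (hU.mem_nhds hz) h
  simp only [pd, this.fderiv_eq]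

theorem boxOp_congr {n : ℕ} [NeZero n] {U : Set (Fin n → ℂ)} (hU : IsOpen U)
    {F G : (Fin n → ℂ) → ℂ} (h : EqOn F G U) : EqOn (BoxOp F) (BoxOp G) U := by
  intro z hz
  have := fun i => pd_congr hU (pd_congr hU h i) i hz
  simp only [BoxOp, this]

open Metric Filter Topology in
/-- Partial derivatives commute with integrals depending holomorphically on a parameter. -/
theorem pd_integral {n : ℕ} {α : Type*} [MeasurableSpace α] {μ : Measure α}
    {K : (Fin n → ℂ) → α → ℂ} {b : α → ℝ} {z : Fin n → ℂ} {r : ℝ} (hr : 0 < r)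
    (hK : ∀ᵐ a ∂μ, DifferentiableOn ℂ (fun w => K w a) (ball z r))
    (hm : ∀ w ∈ ball z r, AEStronglyMeasurable (K w) μ)
    (hb : ∀ᵐ a ∂μ, ∀ w ∈ ball z r, ‖K w a‖ ≤ b a) (hbi : Integrable b μ) (i : Fin n) :
    (∀ w ∈ ball z (r / 2), pd i (fun w => ∫ a, K w a ∂μ) w =
        ∫ a, pd i (fun w => K w a) w ∂μ) ∧
    (∀ᵐ a ∂μ, DifferentiableOn ℂ (pd i fun w => K w a) (ball z (r / 2))) ∧
    (∀ w ∈ ball z (r / 2), AEStronglyMeasurable (fun a => pd i (fun w => K w a) w) μ) ∧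
    (∀ᵐ a ∂μ, ∀ w ∈ ball z (r / 2), ‖pd i (fun w => K w a) w‖ ≤ 4 / r * b a) := by
  have hsub : ∀ w ∈ ball z (r / 2), ball w (r / 2) ⊆ ball z r := by
    intro w hw
    refine ball_subset_ball' ?_
    have := mem_ball.1 hw
    linarith
  have hmain := fun w hw => hasFDerivAt_integral_of_ball (z := w) (half_pos hr)
    (hK.mono fun a ha => ha.mono (hsub w hw)) (fun x hx => hm x (hsub w hw hx))
    (hb.mono fun a ha x hx => ha x (hsub w hw hx)) hbi
  have hbound : ∀ᵐ a ∂μ, ∀ w ∈ ball z (r / 2), ‖fderiv ℂ (fun w => K w a) w‖ ≤ 4 / r * b a := by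
    filter_upwards [hK, hb] with a ha hb w hw
    have := norm_fderiv_le_of_ball (half_pos hr) (ha.mono (hsub w hw))
      fun x hx => hb x (hsub w hw hx)
    calc _ ≤ _ := this
      _ = 4 / r * b a := by field_simp; ring
  refine ⟨fun w hw => ?_, hK.mono fun a ha => ?_, fun w hw => ?_, ?_⟩
  · rw [pd, (hmain w hw).2.fderiv, ContinuousLinearMap.integral_apply]
    · rfl
    · refine (hbi.const_mul (4 / r)).mono' (hmain w hw).1 ?_
      filter_upwards [hbound] with a ha using ha w hw
  · exact (differentiableOn_pd isOpen_ball ha i).mono (ball_subset_ball (by linarith))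
  · exact (hmain w hw).1.apply_continuousLinearMap _
  · filter_upwards [hbound] with a ha w hw
    refine (ContinuousLinearMap.le_opNorm _ _).trans ?_
    rw [Pi.norm_single, norm_one, mul_one]
    exact ha w hw

open Metric Filter Topology in
/-- The Box operator commutes with integrals depending holomorphically on a parameter. -/
theorem boxOp_integral {n : ℕ} [NeZero n] {α : Type*} [MeasurableSpace α] {μ : Measure α}
    {K : (Fin n → ℂ) → α → ℂ} {b : α → ℝ} {z : Fin n → ℂ} {r : ℝ} (hr : 0 < r)
    (hK : ∀ᵐ a ∂μ, DifferentiableOn ℂ (fun w => K w a) (ball z r))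
    (hm : ∀ w ∈ ball z r, AEStronglyMeasurable (K w) μ)
    (hb : ∀ᵐ a ∂μ, ∀ w ∈ ball z r, ‖K w a‖ ≤ b a) (hbi : Integrable b μ) :
    BoxOp (fun w => ∫ a, K w a ∂μ) z = ∫ a, BoxOp (fun w => K w a) z ∂μ := by
  have h := fun i => pd_integral hr hK hm hb hbi i
  have h' := fun i => pd_integral (half_pos hr) (h i).2.1 (h i).2.2.1 (h i).2.2.2
    (hbi.const_mul _) i
  have hz : z ∈ ball z (r / 2 / 2) := mem_ball_self (by positivity)
  have hpd : ∀ i, pd i (pd i fun w => ∫ a, K w a ∂μ) z =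
      ∫ a, pd i (pd i fun w => K w a) z ∂μ := by
    intro i
    rw [← (h' i).1 z hz]
    exact pd_congr isOpen_ball (h i).1 i (mem_ball_self (by positivity))
  have hpair : ∀ i, Integrable (fun a => pd i (pd i fun w => K w a) z) μ := fun i =>
    ((hbi.const_mul (4 / r)).const_mul (4 / (r / 2))).mono' ((h' i).2.2.1 z hz)
      ((h' i).2.2.2.mono fun a ha => ha z hz)
  simp only [BoxOp, hpd]
  rw [integral_neg, integral_sub ((hpair 0).const_mul 2)
    (integrable_finsetSum _ fun i _ => hpair i),
    integral_const_mul, integral_finsetSum _ fun i _ => hpair i]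

/-! ### The Lorentz form and the light cone -/

/-- The bilinear form polarising the Lorentz form. -/
def lorB {n : ℕ} [NeZero n] {R : Type*} [CommRing R] (x y : Fin n → R) : R :=
  2 * (x 0 * y 0) - ∑ i, x i * y i

/-- The unit vector in the time direction. -/
def tvec (n : ℕ) [NeZero n] (R : Type*) [CommRing R] : Fin n → R := Pi.single 0 1

/-- Componentwise real part. -/
def reP {n : ℕ} (z : Fin n → ℂ) : Fin n → ℝ := fun i => (z i).re

theorem continuous_imP {n : ℕ} : Continuous (imP : (Fin n → ℂ) → (Fin n → ℝ)) := by
  unfold imP; fun_prop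

section form

variable {n : ℕ} [NeZero n] {R : Type*} [CommRing R]

theorem lorB_comm (x y : Fin n → R) : lorB x y = lorB y x := by
  simp only [lorB, mul_comm]

theorem lorB_add_left (x x' y : Fin n → R) : lorB (x + x') y = lorB x y + lorB x' y := by
  simp only [lorB, Pi.add_apply, add_mul, Finset.sum_add_distrib]; ring

theorem lorB_smul_left (c : R) (x y : Fin n → R) : lorB (c • x) y = c * lorB x y := by
  simp only [lorB, Pi.smul_apply, smul_eq_mul, mul_sub, Finset.mul_sum, mul_assoc]
  ring

theorem lorB_neg_left (x y : Fin n → R) : lorB (-x) y = -lorB x y := by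
  rw [← neg_one_smul R x, lorB_smul_left]; ring

theorem lorB_sub_left (x x' y : Fin n → R) : lorB (x - x') y = lorB x y - lorB x' y := by
  rw [sub_eq_add_neg, lorB_add_left, lorB_neg_left]; ring

theorem lorB_add_right (x y y' : Fin n → R) : lorB x (y + y') = lorB x y + lorB x y' := by
  rw [lorB_comm, lorB_add_left, lorB_comm y, lorB_comm y']

theorem lorB_smul_right (c : R) (x y : Fin n → R) : lorB x (c • y) = c * lorB x y := by
  rw [lorB_comm, lorB_smul_left, lorB_comm y]

theorem lorB_sub_right (x y y' : Fin n → R) : lorB x (y - y') = lorB x y - lorB x y' := by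
  rw [lorB_comm, lorB_sub_left, lorB_comm y, lorB_comm y']

@[simp] theorem tvec_zero : tvec n R 0 = 1 := by simp [tvec]

@[simp] theorem lorB_tvec_left (x : Fin n → R) : lorB (tvec n R) x = x 0 := by
  simp [lorB, tvec, Pi.single_apply]; ring

@[simp] theorem lorB_tvec_right (x : Fin n → R) : lorB x (tvec n R) = x 0 := by
  rw [lorB_comm, lorB_tvec_left]

theorem lor_eq_lorB (y : Fin n → ℝ) : lor y = lorB y y := by
  simp only [lor, lorB, pow_two]

theorem lorC_eq_lorB (y : Fin n → ℂ) : lorC y = lorB y y := by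
  simp only [lorC, lorB, pow_two]

@[simp] theorem lor_tvec : lor (tvec n ℝ) = 1 := by simp [lor_eq_lorB]

theorem lor_add (x y : Fin n → ℝ) : lor (x + y) = lor x + 2 * lorB x y + lor y := by
  simp only [lor_eq_lorB, lorB_add_left, lorB_add_right, lorB_comm y x]; ring

theorem lor_sub (x y : Fin n → ℝ) : lor (x - y) = lor x - 2 * lorB x y + lor y := by
  simp only [lor_eq_lorB, lorB_sub_left, lorB_sub_right, lorB_comm y x]; ring

theorem lor_smul (c : ℝ) (x : Fin n → ℝ) : lor (c • x) = c ^ 2 * lor x := by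
  simp only [lor_eq_lorB, lorB_smul_left, lorB_smul_right]; ring

theorem lor_neg (x : Fin n → ℝ) : lor (-x) = lor x := by simp [lor]

theorem lorC_add (x y : Fin n → ℂ) : lorC (x + y) = lorC x + 2 * lorB x y + lorC y := by
  simp only [lorC_eq_lorB, lorB_add_left, lorB_add_right, lorB_comm y x]; ring

theorem lorC_sub (x y : Fin n → ℂ) : lorC (x - y) = lorC x - 2 * lorB x y + lorC y := by
  simp only [lorC_eq_lorB, lorB_sub_left, lorB_sub_right, lorB_comm y x]; ring

theorem lorC_smul (c : ℂ) (x : Fin n → ℂ) : lorC (c • x) = c ^ 2 * lorC x := by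
  simp only [lorC_eq_lorB, lorB_smul_left, lorB_smul_right]; ring

theorem lorB_eq_erase (x y : Fin n → R) :
    lorB x y = x 0 * y 0 - ∑ i ∈ Finset.univ.erase 0, x i * y i := by
  rw [lorB, ← Finset.add_sum_erase _ _ (Finset.mem_univ (0 : Fin n))]; ring

theorem lor_eq_erase (y : Fin n → ℝ) :
    lor y = y 0 ^ 2 - ∑ i ∈ Finset.univ.erase 0, y i ^ 2 := by
  simp only [lor_eq_lorB, lorB_eq_erase, pow_two]

theorem lorC_eq_erase (y : Fin n → ℂ) :
    lorC y = y 0 ^ 2 - ∑ i ∈ Finset.univ.erase 0, y i ^ 2 := by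
  simp only [lorC_eq_lorB, lorB_eq_erase, pow_two]

end form

section cone

variable {n : ℕ} [NeZero n]

theorem sum_erase_sq_nonneg (y : Fin n → ℝ) : 0 ≤ ∑ i ∈ Finset.univ.erase (0 : Fin n), y i ^ 2 :=
  Finset.sum_nonneg fun _ _ => sq_nonneg _

theorem lor_nonpos_of_zero {x : Fin n → ℝ} (hx : x 0 = 0) : lor x ≤ 0 := by
  rw [lor_eq_erase, hx]; have := sum_erase_sq_nonneg x; linarith

/-- The reversed Cauchy–Schwarz inequality. -/
theorem lor_mul_le_lorB_sq (x : Fin n → ℝ) {y : Fin n → ℝ} (hy : y ∈ cone n) :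
    lor x * lor y ≤ lorB x y ^ 2 := by
  have hy0 : y 0 ≠ 0 := hy.2.ne'
  have h : lor (x - (x 0 / y 0) • y) ≤ 0 := lor_nonpos_of_zero (by
    simp [hy0])
  rw [lor_sub, lor_smul, lorB_smul_right] at h
  have h1 : 0 < lor y := hy.1
  have h2 := mul_nonpos_of_nonneg_of_nonpos h1.le h
  nlinarith [sq_nonneg (x 0 / y 0 * lor y - lorB x y)]

theorem sum_erase_mul_sq_le (x y : Fin n → ℝ) :
    (∑ i ∈ Finset.univ.erase (0 : Fin n), x i * y i) ^ 2 ≤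
      (∑ i ∈ Finset.univ.erase (0 : Fin n), x i ^ 2) *
        ∑ i ∈ Finset.univ.erase (0 : Fin n), y i ^ 2 :=
  Finset.sum_mul_sq_le_sq_mul_sq _ _ _

theorem lorB_pos {x y : Fin n → ℝ} (hx : x ∈ cone n) (hy : y ∈ cone n) : 0 < lorB x y := by
  rw [lorB_eq_erase, sub_pos]
  have h1 := hx.1
  have h2 := hy.1
  rw [lor_eq_erase, sub_pos] at h1 h2
  refine lt_of_pow_lt_pow_left₀ 2 (mul_pos hx.2 hy.2).le ?_
  calc _ ≤ _ := sum_erase_mul_sq_le x y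
    _ < x 0 ^ 2 * y 0 ^ 2 :=
      mul_lt_mul_of_nonneg_of_pos h1 h2.le (sum_erase_sq_nonneg x) (pow_pos hy.2 2)
    _ = _ := by ring

theorem add_mem_cone {x y : Fin n → ℝ} (hx : x ∈ cone n) (hy : y ∈ cone n) : x + y ∈ cone n := by
  refine ⟨?_, add_pos hx.2 hy.2⟩
  rw [lor_add]
  have := lorB_pos hx hy
  have h1 : 0 < lor x := hx.1
  have h2 : 0 < lor y := hy.1
  linarith

theorem smul_mem_cone {c : ℝ} (hc : 0 < c) {x : Fin n → ℝ} (hx : x ∈ cone n) :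
    c • x ∈ cone n := by
  refine ⟨?_, mul_pos hc hx.2⟩
  rw [lor_smul]
  exact mul_pos (pow_pos hc 2) hx.1

theorem tvec_mem_cone : tvec n ℝ ∈ cone n := by
  refine ⟨by simp, by simp⟩

theorem lor_le_lor_add {x y : Fin n → ℝ} (hx : x ∈ cone n) (hy : y ∈ cone n) :
    lor x ≤ lor (x + y) := by
  rw [lor_add]
  have := lorB_pos hx hy
  have h2 : 0 < lor y := hy.1
  linarith

theorem continuous_lor : Continuous (lor : (Fin n → ℝ) → ℝ) := by
  unfold lor; fun_prop

theorem continuous_lorC : Continuous (lorC : (Fin n → ℂ) → ℂ) := by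
  unfold lorC; fun_prop

theorem differentiable_lorC : Differentiable ℂ (lorC : (Fin n → ℂ) → ℂ) := by
  unfold lorC; fun_prop

theorem isOpen_cone : IsOpen (cone n) :=
  (isOpen_lt continuous_const continuous_lor).inter
    (isOpen_lt continuous_const (continuous_apply 0))

theorem isOpen_tube : IsOpen (tube n) := isOpen_cone.preimage continuous_imP

theorem exists_sub_smul_tvec_mem_cone {y : Fin n → ℝ} (hy : y ∈ cone n) :
    ∃ ε : ℝ, 0 < ε ∧ y - ε • tvec n ℝ ∈ cone n := by
  have hc : Continuous fun ε : ℝ => y - ε • tvec n ℝ := by fun_prop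
  have h : ∀ᶠ ε in nhds (0 : ℝ), y - ε • tvec n ℝ ∈ cone n :=
    hc.continuousAt.eventually (isOpen_cone.mem_nhds (by simpa using hy))
  obtain ⟨δ, hδ, hball⟩ := Metric.eventually_nhds_iff.1 h
  exact ⟨δ / 2, by positivity, hball (by simp [abs_of_pos hδ]; exact hδ)⟩

theorem abs_apply_lt_of_mem_cone {y : Fin n → ℝ} (hy : y ∈ cone n) (i : Fin n) : |y i| ≤ y 0 := by
  by_cases hi : i = 0
  · rw [hi, abs_of_pos hy.2]
  · have h := hy.1
    rw [lor_eq_erase] at h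
    have h1 : y i ^ 2 ≤ ∑ i ∈ Finset.univ.erase (0 : Fin n), y i ^ 2 :=
      Finset.single_le_sum (f := fun i => y i ^ 2) (fun _ _ => sq_nonneg _) (by simp [hi])
    exact abs_le_of_sq_le_sq (by linarith) hy.2.le

/-! ### The complexified form -/

theorem lorC_re (p : Fin n → ℂ) : (lorC p).re = lor (reP p) - lor (imP p) := by
  simp only [lorC, lor, reP, imP, Complex.sub_re, Complex.mul_re, Complex.re_sum, pow_two,
    Complex.re_ofNat, Complex.im_ofNat, Finset.sum_sub_distrib]
  ring

theorem lorC_im (p : Fin n → ℂ) : (lorC p).im = 2 * lorB (reP p) (imP p) := by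
  simp only [lorC, lorB, reP, imP, Complex.sub_im, Complex.mul_im, Complex.im_sum, pow_two,
    Complex.re_ofNat, Complex.im_ofNat, mul_sub, Finset.mul_sum]
  have : ∀ i, (p i).re * (p i).im + (p i).im * (p i).re = 2 * ((p i).re * (p i).im) :=
    fun i => by ring
  simp only [this]; ring

theorem norm_lorC_sq (p : Fin n → ℂ) : ‖lorC p‖ ^ 2 =
    lor (reP p) ^ 2 + lor (imP p) ^ 2 +
      2 * (2 * lorB (reP p) (imP p) ^ 2 - lor (reP p) * lor (imP p)) := by
  rw [← Complex.normSq_eq_norm_sq, Complex.normSq_apply, lorC_re, lorC_im]; ring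

theorem lor_reP_le_norm_lorC {p : Fin n → ℂ} (hp : reP p ∈ cone n) :
    lor (reP p) ≤ ‖lorC p‖ := by
  refine (le_abs_self _).trans (abs_le_of_sq_le_sq ?_ (norm_nonneg _))
  rw [norm_lorC_sq]
  have := lor_mul_le_lorB_sq (imP p) hp
  rw [lorB_comm] at this
  nlinarith [sq_nonneg (lor (imP p)), sq_nonneg (lorB (reP p) (imP p))]

theorem lorC_mem_slitPlane {p : Fin n → ℂ} (hp : reP p ∈ cone n) : lorC p ∈ slitPlane := by
  rw [Complex.mem_slitPlane_iff, lorC_re, lorC_im]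
  by_cases h : lorB (reP p) (imP p) = 0
  · left
    have h1 := lor_mul_le_lorB_sq (imP p) hp
    rw [lorB_comm, h] at h1
    have h2 : 0 < lor (reP p) := hp.1
    have : lor (imP p) ≤ 0 := by
      by_contra hc
      push Not at hc
      have := mul_pos hc h2
      linarith
    linarith
  · right; simpa using h

theorem lorC_ne_zero {p : Fin n → ℂ} (hp : reP p ∈ cone n) : lorC p ≠ 0 :=
  slitPlane_ne_zero (lorC_mem_slitPlane hp)

theorem sq_add_le_of_sub_tvec_mem_cone {a b : Fin n → ℝ} (ha : a - tvec n ℝ ∈ cone n) :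
    b 0 ^ 2 + ∑ i ∈ Finset.univ.erase (0 : Fin n), b i ^ 2 ≤
      2 * lorB a b ^ 2 - lor a * lor b := by
  set v := a - tvec n ℝ with hv
  have hav : a = tvec n ℝ + v := by rw [hv]; abel
  have h1 : 0 ≤ 2 * lorB v b ^ 2 - lor v * lor b := by
    have := lor_mul_le_lorB_sq b ha
    rw [lorB_comm] at this
    nlinarith [sq_nonneg (lorB v b)]
  set S := ∑ i ∈ Finset.univ.erase (0 : Fin n), b i ^ 2 with hS
  set T := ∑ i ∈ Finset.univ.erase (0 : Fin n), v i * b i with hT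
  have hS0 : 0 ≤ S := sum_erase_sq_nonneg b
  have hTS : T ^ 2 ≤ v 0 ^ 2 * S := by
    refine (sum_erase_mul_sq_le v b).trans ?_
    have := ha.1
    rw [lor_eq_erase] at this
    gcongr
    linarith
  have h2 : 0 ≤ v 0 * (b 0 ^ 2 + S) - 2 * b 0 * T := by
    have : |2 * b 0 * T| ≤ v 0 * (b 0 ^ 2 + S) := by
      refine abs_le_of_sq_le_sq ?_ (by have := ha.2; positivity)
      nlinarith [sq_nonneg (b 0), mul_le_mul_of_nonneg_left hTS (sq_nonneg (b 0)),
        mul_nonneg (sq_nonneg (v 0)) (sq_nonneg (b 0 ^ 2 - S))]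
    linarith [le_abs_self (2 * b 0 * T)]
  rw [hav, lorB_add_left, lor_add, lorB_tvec_left, lorB_tvec_left, lor_tvec]
  have hb : lor b = b 0 ^ 2 - S := lor_eq_erase b
  have hvb : lorB v b = v 0 * b 0 - T := lorB_eq_erase v b
  rw [hb] at h1 ⊢
  rw [hvb] at h1 ⊢
  nlinarith

theorem norm_le_norm_lorC {p : Fin n → ℂ} (hp : reP p - tvec n ℝ ∈ cone n) :
    ‖p‖ ≤ 2 * ‖lorC p‖ := by
  have hcone : reP p ∈ cone n := by
    have := add_mem_cone hp (tvec_mem_cone (n := n))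
    simpa using this
  have h0 : reP p 0 ≤ lor (reP p) := by
    have h1 : reP p = tvec n ℝ + (reP p - tvec n ℝ) := by abel
    have h2 : lor (reP p) = 1 + 2 * (reP p - tvec n ℝ) 0 + lor (reP p - tvec n ℝ) := by
      conv_lhs => rw [h1]
      rw [lor_add, lorB_tvec_left, lor_tvec]
    have h3 : 0 < lor (reP p - tvec n ℝ) := hp.1
    have h4 : 0 < (reP p - tvec n ℝ) 0 := hp.2
    simp only [Pi.sub_apply, tvec_zero] at h2 h4
    linarith
  refine (pi_norm_le_iff_of_nonneg (by positivity)).2 fun i => ?_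
  have hre : |(p i).re| ≤ ‖lorC p‖ :=
    (abs_apply_lt_of_mem_cone hcone i).trans (h0.trans (lor_reP_le_norm_lorC hcone))
  have him : |(p i).im| ≤ ‖lorC p‖ := by
    refine abs_le_of_sq_le_sq ?_ (norm_nonneg _)
    rw [norm_lorC_sq]
    have h1 := sq_add_le_of_sub_tvec_mem_cone (b := imP p) hp
    have h2 : (p i).im ^ 2 ≤ imP p 0 ^ 2 + ∑ i ∈ Finset.univ.erase (0 : Fin n), imP p i ^ 2 := by
      rw [Finset.add_sum_erase _ (fun i => imP p i ^ 2) (Finset.mem_univ _)]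
      exact Finset.single_le_sum (f := fun i => imP p i ^ 2) (fun _ _ => sq_nonneg _)
        (Finset.mem_univ i)
    nlinarith [sq_nonneg (lor (reP p)), sq_nonneg (lor (imP p)), sq_nonneg ((p i).im)]
  calc ‖p i‖ ≤ |(p i).re| + |(p i).im| := Complex.norm_le_abs_re_add_abs_im _
    _ ≤ 2 * ‖lorC p‖ := by linarith

theorem norm_lorB_le (x y : Fin n → ℂ) : ‖lorB x y‖ ≤ (n + 2) * (‖x‖ * ‖y‖) := by
  have h : ∀ i, ‖x i * y i‖ ≤ ‖x‖ * ‖y‖ := fun i => by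
    rw [norm_mul]; gcongr <;> exact norm_le_pi_norm _ i
  calc ‖lorB x y‖ ≤ ‖2 * (x 0 * y 0)‖ + ‖∑ i, x i * y i‖ := norm_sub_le _ _
    _ ≤ 2 * (‖x‖ * ‖y‖) + ∑ _i : Fin n, ‖x‖ * ‖y‖ := by
        gcongr
        · rw [norm_mul]; simpa using h 0
        · exact norm_sum_le_of_le _ fun i _ => h i
    _ = (n + 2) * (‖x‖ * ‖y‖) := by simp; ring

theorem norm_le_norm_lorC_of_smul {p : Fin n → ℂ} {ε : ℝ} (hε : 0 < ε)
    (hp : reP p - ε • tvec n ℝ ∈ cone n) : ε * ‖p‖ ≤ 2 * ‖lorC p‖ := by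
  have h1 : reP (((ε⁻¹ : ℝ) : ℂ) • p) - tvec n ℝ ∈ cone n := by
    have := smul_mem_cone (inv_pos.2 hε) hp
    rw [smul_sub, smul_smul, inv_mul_cancel₀ hε.ne', one_smul] at this
    convert this using 2
    funext i
    simp [reP]
  have h2 := norm_le_norm_lorC h1
  rw [norm_smul, lorC_smul, norm_mul, norm_pow, Complex.norm_real,
    Real.norm_of_nonneg (inv_pos.2 hε).le] at h2
  have h3 := mul_le_mul_of_nonneg_left h2 (pow_pos hε 2).le
  have e1 : ε ^ 2 * (ε⁻¹ * ‖p‖) = ε * ‖p‖ := by field_simp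
  have e2 : ε ^ 2 * (2 * (ε⁻¹ ^ 2 * ‖lorC p‖)) = 2 * ‖lorC p‖ := by field_simp
  rwa [e1, e2] at h3

/-- A Harnack type inequality for the modulus of the complexified Lorentz form. -/
theorem norm_lorC_add_le {p b : Fin n → ℂ} {ε : ℝ} (hε : 0 < ε)
    (hp : reP p - ε • tvec n ℝ ∈ cone n) :
    ‖lorC (p + b)‖ ≤ (1 + 4 * (n + 2) * (‖b‖ / ε) + (n + 2) * (‖b‖ / ε) ^ 2) * ‖lorC p‖ := by
  have h1 := norm_le_norm_lorC_of_smul hε hp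
  have hεp : ε ^ 2 ≤ ‖lorC p‖ := by
    have h2 : reP p = ε • tvec n ℝ + (reP p - ε • tvec n ℝ) := by abel
    have h3 := smul_mem_cone hε (tvec_mem_cone (n := n))
    have h4 : reP p ∈ cone n := by rw [h2]; exact add_mem_cone h3 hp
    have h5 := lor_le_lor_add h3 hp
    rw [← h2, lor_smul, lor_tvec, mul_one] at h5
    exact h5.trans (lor_reP_le_norm_lorC h4)
  have h2 : ‖p‖ ≤ 2 * ‖lorC p‖ / ε := by
    rw [le_div_iff₀ hε]; linarith
  rw [lorC_add]
  calc ‖lorC p + 2 * lorB p b + lorC b‖ ≤ ‖lorC p‖ + ‖2 * lorB p b‖ + ‖lorC b‖ := norm_add₃_le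
    _ ≤ ‖lorC p‖ + 2 * ((n + 2) * (2 * ‖lorC p‖ / ε * ‖b‖)) + (n + 2) * (‖b‖ * ‖b‖) := by
        rw [norm_mul, lorC_eq_lorB b]
        gcongr
        · simp
        · exact (norm_lorB_le p b).trans (by gcongr)
        · exact norm_lorB_le b b
    _ = ‖lorC p‖ + 4 * (n + 2) * (‖b‖ / ε) * ‖lorC p‖ + (n + 2) * (‖b‖ / ε) ^ 2 * ε ^ 2 := by
        field_simp; ring
    _ ≤ ‖lorC p‖ + 4 * (n + 2) * (‖b‖ / ε) * ‖lorC p‖ + (n + 2) * (‖b‖ / ε) ^ 2 * ‖lorC p‖ := by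
        gcongr
    _ = _ := by ring

end cone

/-! ### The weighted measures -/

section measure

variable {n : ℕ} [NeZero n]

theorem measurable_imP {n : ℕ} : Measurable (imP : (Fin n → ℂ) → (Fin n → ℝ)) :=
  continuous_imP.measurable

theorem measurable_lor_rpow (a : ℝ) : Measurable fun z : Fin n → ℂ => lor (imP z) ^ a :=
  (continuous_lor.measurable.comp measurable_imP).pow_const a

theorem measurable_ofReal_lor_rpow (a : ℝ) :
    Measurable fun z : Fin n → ℂ => ENNReal.ofReal (lor (imP z) ^ a) :=
  (measurable_lor_rpow a).ennreal_ofReal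

theorem lor_imP_pos {z : Fin n → ℂ} (hz : z ∈ tube n) : 0 < lor (imP z) := hz.1

theorem ae_dV_mem_tube (ν : ℝ) : ∀ᵐ z ∂(dV n ν), z ∈ tube n :=
  (withDensity_absolutelyContinuous _ _).ae_le (ae_restrict_mem isOpen_tube.measurableSet)

theorem lintegral_dV (ν : ℝ) (f : (Fin n → ℂ) → ℝ≥0∞) :
    ∫⁻ z, f z ∂(dV n ν) =
      ∫⁻ z in tube n, ENNReal.ofReal (lor (imP z) ^ (ν - (n : ℝ) / 2)) * f z := by
  rw [dV, lintegral_withDensity_eq_lintegral_mul_non_measurable _ (measurable_ofReal_lor_rpow _)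
    (Filter.Eventually.of_forall fun _ => ENNReal.ofReal_lt_top)]
  rfl

theorem integrable_dV_iff (ν : ℝ) (f : (Fin n → ℂ) → ℂ) :
    Integrable f (dV n ν) ↔
      IntegrableOn (fun z => ((lor (imP z) ^ (ν - (n : ℝ) / 2) : ℝ) : ℂ) * f z) (tube n) := by
  rw [dV, integrable_withDensity_iff_integrable_smul' (measurable_ofReal_lor_rpow _)
    (Filter.Eventually.of_forall fun _ => ENNReal.ofReal_lt_top), IntegrableOn]
  refine integrable_congr ?_
  filter_upwards [ae_restrict_mem isOpen_tube.measurableSet] with z hz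
  rw [ENNReal.toReal_ofReal (Real.rpow_nonneg (lor_imP_pos hz).le _), Complex.real_smul]

theorem integral_dV (ν : ℝ) (f : (Fin n → ℂ) → ℂ) :
    ∫ z, f z ∂(dV n ν) =
      ∫ z in tube n, ((lor (imP z) ^ (ν - (n : ℝ) / 2) : ℝ) : ℂ) * f z := by
  rw [dV, integral_withDensity_eq_integral_toReal_smul (measurable_ofReal_lor_rpow _)
    (Filter.Eventually.of_forall fun _ => ENNReal.ofReal_lt_top)]
  refine setIntegral_congr_fun isOpen_tube.measurableSet fun z hz => ?_
  rw [ENNReal.toReal_ofReal (Real.rpow_nonneg (lor_imP_pos hz).le _), Complex.real_smul]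

theorem integrable_dV_add_iff (ν a : ℝ) (f : (Fin n → ℂ) → ℂ) :
    Integrable f (dV n (ν + a)) ↔
      Integrable (fun z => ((lor (imP z) ^ a : ℝ) : ℂ) * f z) (dV n ν) := by
  rw [integrable_dV_iff, integrable_dV_iff]
  refine integrableOn_congr_fun (fun z hz => ?_) isOpen_tube.measurableSet
  rw [← mul_assoc, ← Complex.ofReal_mul, ← Real.rpow_add (lor_imP_pos hz)]
  ring_nf

theorem integral_dV_add (ν a : ℝ) (f : (Fin n → ℂ) → ℂ) :
    ∫ z, f z ∂(dV n (ν + a)) = ∫ z, ((lor (imP z) ^ a : ℝ) : ℂ) * f z ∂(dV n ν) := by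
  rw [integral_dV, integral_dV]
  refine setIntegral_congr_fun isOpen_tube.measurableSet fun z hz => ?_
  rw [← mul_assoc, ← Complex.ofReal_mul, ← Real.rpow_add (lor_imP_pos hz)]
  ring_nf

instance sigmaFinite_dV (ν : ℝ) : SigmaFinite (dV n ν) := by
  unfold dV
  exact SigmaFinite.withDensity_of_ne_top
    (Filter.Eventually.of_forall fun _ => ENNReal.ofReal_ne_top)

theorem ContinuousOn.aestronglyMeasurable_dV {f : (Fin n → ℂ) → ℂ} (hf : ContinuousOn f (tube n))
    (ν : ℝ) : AEStronglyMeasurable f (dV n ν) :=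
  (hf.aestronglyMeasurable isOpen_tube.measurableSet).mono_ac
    (withDensity_absolutelyContinuous _ _)

end measure

/-! ### The kernels -/

section kernel

variable {n : ℕ} [NeZero n]

/-- The polarised Lorentz form `Δ((z − w̄)/i)`. -/
def del (z w : Fin n → ℂ) : ℂ := lorC fun i => (z i - (starRingEnd ℂ) (w i)) / I

/-- The Bergman type kernel `Δ((z − w̄)/i)^{−s}`. -/
def bker (s : ℝ) (z w : Fin n → ℂ) : ℂ := del z w ^ (-s : ℂ)

theorem reP_kernel_arg {n : ℕ} (z w : Fin n → ℂ) :
    reP (fun i => (z i - (starRingEnd ℂ) (w i)) / I) = imP z + imP w := by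
  funext i; simp [reP, imP, Complex.div_I]

theorem reP_kernel_arg_mem {z w : Fin n → ℂ} (hz : z ∈ tube n) (hw : w ∈ tube n) :
    reP (fun i => (z i - (starRingEnd ℂ) (w i)) / I) ∈ cone n := by
  rw [reP_kernel_arg]; exact add_mem_cone hz hw

theorem del_mem_slitPlane {z w : Fin n → ℂ} (hz : z ∈ tube n) (hw : w ∈ tube n) :
    del z w ∈ slitPlane := lorC_mem_slitPlane (reP_kernel_arg_mem hz hw)

theorem del_ne_zero {z w : Fin n → ℂ} (hz : z ∈ tube n) (hw : w ∈ tube n) : del z w ≠ 0 :=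
  slitPlane_ne_zero (del_mem_slitPlane hz hw)

theorem norm_del_pos {z w : Fin n → ℂ} (hz : z ∈ tube n) (hw : w ∈ tube n) : 0 < ‖del z w‖ :=
  norm_pos_iff.2 (del_ne_zero hz hw)

theorem lor_add_le_norm_del {z w : Fin n → ℂ} (hz : z ∈ tube n) (hw : w ∈ tube n) :
    lor (imP z + imP w) ≤ ‖del z w‖ := by
  rw [← reP_kernel_arg]; exact lor_reP_le_norm_lorC (reP_kernel_arg_mem hz hw)

theorem lor_left_le_norm_del {z w : Fin n → ℂ} (hz : z ∈ tube n) (hw : w ∈ tube n) :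
    lor (imP z) ≤ ‖del z w‖ :=
  (lor_le_lor_add hz hw).trans (lor_add_le_norm_del hz hw)

theorem lor_right_le_norm_del {z w : Fin n → ℂ} (hz : z ∈ tube n) (hw : w ∈ tube n) :
    lor (imP w) ≤ ‖del z w‖ := by
  refine (lor_le_lor_add hw hz).trans ?_
  rw [add_comm]; exact lor_add_le_norm_del hz hw

theorem conj_lorC (p : Fin n → ℂ) :
    (starRingEnd ℂ) (lorC p) = lorC fun i => (starRingEnd ℂ) (p i) := by
  simp only [lorC, map_sub, map_mul, map_pow, map_sum, map_ofNat]

theorem conj_del (z w : Fin n → ℂ) : (starRingEnd ℂ) (del z w) = del w z := by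
  rw [del, conj_lorC, del]
  congr 1; funext i
  simp only [map_div₀, map_sub, Complex.conj_conj, Complex.conj_I, div_neg, ← neg_div, neg_sub]

theorem norm_bker (s : ℝ) (z w : Fin n → ℂ) : ‖bker s z w‖ = ‖del z w‖ ^ (-s) := by
  rw [bker, ← Complex.ofReal_neg, Complex.norm_cpow_real]

theorem conj_bker (s : ℝ) {z w : Fin n → ℂ} (hz : z ∈ tube n) (hw : w ∈ tube n) :
    (starRingEnd ℂ) (bker s z w) = bker s w z := by
  rw [bker, bker, ← conj_del z w,
    Complex.conj_cpow _ _ (slitPlane_arg_ne_pi (del_mem_slitPlane hz hw)), map_neg,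
    Complex.conj_ofReal]

theorem differentiable_del (w : Fin n → ℂ) : Differentiable ℂ fun z => del z w := by
  unfold del
  exact differentiable_lorC.comp (by fun_prop)

theorem differentiableOn_bker (s : ℝ) {w : Fin n → ℂ} (hw : w ∈ tube n) :
    DifferentiableOn ℂ (fun z => bker s z w) (tube n) := by
  intro z hz
  exact ((differentiable_del w z).cpow_const (del_mem_slitPlane hz hw)).differentiableWithinAt

theorem continuous_del : Continuous fun p : (Fin n → ℂ) × (Fin n → ℂ) => del p.1 p.2 := by
  unfold del
  refine continuous_lorC.comp (continuous_pi fun i => ?_)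
  have := Complex.continuous_conj
  fun_prop

theorem measurable_bker (s : ℝ) :
    Measurable fun p : (Fin n → ℂ) × (Fin n → ℂ) => bker s p.1 p.2 :=
  (continuous_del.measurable).pow_const _

theorem measurable_bker_left (s : ℝ) (w : Fin n → ℂ) : Measurable fun z => bker s z w :=
  (continuous_del.comp (Continuous.prodMk_left w)).measurable.pow_const _

theorem measurable_bker_right (s : ℝ) (z : Fin n → ℂ) : Measurable fun w => bker s z w :=
  (continuous_del.comp (Continuous.prodMk_right z)).measurable.pow_const _

/-- The moduli of the kernels with base points `z` and `z'` are comparable. -/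
theorem norm_del_le {z z' w : Fin n → ℂ} {ε : ℝ} (hε : 0 < ε)
    (hz' : imP z' - ε • tvec n ℝ ∈ cone n) (hw : w ∈ tube n) :
    ‖del z w‖ ≤ (1 + 4 * (n + 2) * (‖z - z'‖ / ε) + (n + 2) * (‖z - z'‖ / ε) ^ 2) *
      ‖del z' w‖ := by
  have h := norm_lorC_add_le (p := fun i => (z' i - (starRingEnd ℂ) (w i)) / I)
    (b := fun i => (z i - z' i) / I) hε (by
      rw [reP_kernel_arg]
      have := add_mem_cone hz' hw
      convert this using 1
      abel)
  have h1 : ‖(fun i => (z i - z' i) / I : Fin n → ℂ)‖ = ‖z - z'‖ := by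
    have : (fun i => (z i - z' i) / I : Fin n → ℂ) = (I⁻¹ : ℂ) • (z - z') := by
      funext i; simp [div_eq_inv_mul]
    rw [this, norm_smul]; simp
  rw [h1] at h
  convert h using 3
  · rw [del]
    congr 1; funext i
    simp only [Pi.add_apply]; ring
  · rfl

end kernel

/-! ### Symmetries of the tube -/

/-- The isometry of the Lorentz form `x ↦ 2 B(x,q)/B(q,q) q − x`. -/
def srefl {n : ℕ} [NeZero n] {R : Type*} [Field R] (q x : Fin n → R) : Fin n → R :=
  (2 * lorB x q / lorB q q) • q - x

section symm

variable {n : ℕ} [NeZero n]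

theorem lorB_srefl {R : Type*} [Field R] {q : Fin n → R} (hq : lorB q q ≠ 0) (x x' : Fin n → R) :
    lorB (srefl q x) (srefl q x') = lorB x x' := by
  simp only [srefl, lorB_sub_left, lorB_sub_right, lorB_smul_left, lorB_smul_right,
    lorB_comm q x']
  field_simp
  ring

theorem srefl_srefl {R : Type*} [Field R] {q : Fin n → R} (hq : lorB q q ≠ 0) (x : Fin n → R) :
    srefl q (srefl q x) = x := by
  have h : lorB (srefl q x) q = lorB x q := by
    simp only [srefl, lorB_sub_left, lorB_smul_left]
    field_simp
    ring
  rw [srefl, h, srefl]; abel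

theorem lorC_srefl {q : Fin n → ℂ} (hq : lorB q q ≠ 0) (x : Fin n → ℂ) :
    lorC (srefl q x) = lorC x := by
  rw [lorC_eq_lorB, lorB_srefl hq, ← lorC_eq_lorB]

theorem lor_srefl {q : Fin n → ℝ} (hq : lorB q q ≠ 0) (x : Fin n → ℝ) :
    lor (srefl q x) = lor x := by
  rw [lor_eq_lorB, lorB_srefl hq, ← lor_eq_lorB]

/-- `srefl q` as a real linear map. -/
def sreflL (q : Fin n → ℂ) : (Fin n → ℂ) →ₗ[ℝ] (Fin n → ℂ) where
  toFun := srefl q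
  map_add' x y := by
    simp only [srefl, lorB_add_left, mul_add, add_div, add_smul]; abel
  map_smul' c x := by
    have : (c • x : Fin n → ℂ) = (c : ℂ) • x := by funext i; simp
    have h2 : ∀ y : Fin n → ℂ, (c • y : Fin n → ℂ) = (c : ℂ) • y := fun y => by funext i; simp
    simp only [srefl, h2, lorB_smul_left, smul_sub, smul_smul, RingHom.id_apply]
    congr 2; ring

theorem measurePreserving_of_involutive {E : Type*} [NormedAddCommGroup E] [NormedSpace ℝ E]
    [MeasurableSpace E] [BorelSpace E] [FiniteDimensional ℝ E] (μ : Measure E)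
    [μ.IsAddHaarMeasure] (f : E →ₗ[ℝ] E) (hf : ∀ x, f (f x) = x) :
    MeasurePreserving f μ μ := by
  have h1 : LinearMap.det f * LinearMap.det f = 1 := by
    rw [← LinearMap.det_comp]
    have : f ∘ₗ f = LinearMap.id := LinearMap.ext hf
    rw [this, LinearMap.det_id]
  have h2 : |(LinearMap.det f)⁻¹| = 1 := by
    rcases mul_self_eq_one_iff.1 h1 with h | h <;> simp [h]
  refine ⟨(LinearMap.continuous_of_finiteDimensional f).measurable, ?_⟩
  rw [Measure.map_linearMap_addHaar_eq_smul_addHaar μ (by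
    intro h; rw [h] at h1; simp at h1), h2]
  simp

theorem measurePreserving_srefl {q : Fin n → ℂ} (hq : lorB q q ≠ 0) :
    MeasurePreserving (srefl q) (volume : Measure (Fin n → ℂ)) volume :=
  measurePreserving_of_involutive volume (sreflL q) (srefl_srefl hq)

theorem continuous_srefl (q : Fin n → ℂ) : Continuous (srefl q) :=
  LinearMap.continuous_of_finiteDimensional (sreflL q)

/-- The vector defining the reflection which exchanges `e` and `y / √Δ(y)`. -/
def midvec (y : Fin n → ℝ) : Fin n → ℝ := tvec n ℝ + (√(lor y))⁻¹ • y

theorem midvec_mem {y : Fin n → ℝ} (hy : y ∈ cone n) : midvec y ∈ cone n :=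
  add_mem_cone tvec_mem_cone (smul_mem_cone (inv_pos.2 (Real.sqrt_pos.2 hy.1)) hy)

theorem lorB_midvec_ne {y : Fin n → ℝ} (hy : y ∈ cone n) : lorB (midvec y) (midvec y) ≠ 0 := by
  rw [← lor_eq_lorB]; exact (midvec_mem hy).1.ne'

theorem srefl_midvec_tvec {y : Fin n → ℝ} (hy : y ∈ cone n) :
    √(lor y) • srefl (midvec y) (tvec n ℝ) = y := by
  have hpos : 0 < √(lor y) := Real.sqrt_pos.2 hy.1
  have hsq : √(lor y) ^ 2 = lor y := Real.sq_sqrt hy.1.le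
  have h1 : lorB (midvec y) (midvec y) = 2 * lorB (tvec n ℝ) (midvec y) := by
    rw [← lor_eq_lorB, midvec, lor_add, lor_smul, lor_tvec, lorB_add_right, ← lor_eq_lorB, lor_tvec]
    field_simp
    rw [hsq]; field_simp; ring
  have h2 : 2 * lorB (tvec n ℝ) (midvec y) ≠ 0 := by
    rw [← h1]; exact lorB_midvec_ne hy
  rw [srefl, h1, div_self h2, one_smul, midvec, add_sub_cancel_left, smul_smul,
    mul_inv_cancel₀ hpos.ne', one_smul]

theorem srefl_mem_cone {y x : Fin n → ℝ} (hy : y ∈ cone n) (hx : x ∈ cone n) :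
    srefl (midvec y) x ∈ cone n := by
  have hq := lorB_midvec_ne hy
  have h1 : 0 < lor (srefl (midvec y) x) := by rw [lor_srefl hq]; exact hx.1
  refine ⟨h1, ?_⟩
  by_contra hcon
  have h0 : srefl (midvec y) x 0 ≠ 0 := fun h => by
    have := lor_nonpos_of_zero h; linarith
  have hneg : -srefl (midvec y) x ∈ cone n :=
    ⟨by rwa [lor_neg], by
      have : srefl (midvec y) x 0 < 0 := lt_of_le_of_ne (not_lt.1 hcon) h0
      simpa using this⟩
  have h2 := lorB_pos hneg hy
  have h3 : lorB (srefl (midvec y) x) (√(lor y) • srefl (midvec y) (tvec n ℝ)) =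
      √(lor y) * x 0 := by
    rw [lorB_smul_right, lorB_srefl hq, lorB_tvec_right]
  rw [srefl_midvec_tvec hy] at h3
  rw [lorB_neg_left, h3] at h2
  have := mul_pos (Real.sqrt_pos.2 hy.1) hx.2
  linarith

/-- Coercion of a real vector to a complex vector. -/
def toC {n : ℕ} (x : Fin n → ℝ) : Fin n → ℂ := fun i => (x i : ℂ)

theorem lorB_toC (x y : Fin n → ℝ) : lorB (toC x) (toC y) = ((lorB x y : ℝ) : ℂ) := by
  simp [lorB, toC]

theorem eq_toC_add {n : ℕ} (z : Fin n → ℂ) : z = toC (reP z) + I • toC (imP z) := by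
  funext i
  simp only [toC, reP, imP, Pi.add_apply, Pi.smul_apply, smul_eq_mul]
  rw [mul_comm]; exact (Complex.re_add_im _).symm

theorem srefl_toC (q x : Fin n → ℝ) : srefl (toC q) (toC x) = toC (srefl q x) := by
  funext i
  simp only [srefl, lorB_toC, Pi.sub_apply, Pi.smul_apply, smul_eq_mul, toC]
  push_cast; ring

theorem srefl_add_smul (q x y : Fin n → ℂ) (c : ℂ) :
    srefl q (x + c • y) = srefl q x + c • srefl q y := by
  funext i
  simp only [srefl, lorB_add_left, lorB_smul_left, Pi.add_apply, Pi.sub_apply, Pi.smul_apply,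
    smul_eq_mul]
  ring

theorem imP_toC_add_I_smul {n : ℕ} (x y : Fin n → ℝ) : imP (toC x + I • toC y) = y := by
  funext i; simp [imP, toC]

theorem imP_srefl (q : Fin n → ℝ) (z : Fin n → ℂ) :
    imP (srefl (toC q) z) = srefl q (imP z) := by
  conv_lhs => rw [eq_toC_add z, srefl_add_smul, srefl_toC, srefl_toC, imP_toC_add_I_smul]

/-- The affine automorphism of the tube mapping `i e` to `z₀`. -/
def tubeEquiv (z₀ : Fin n → ℂ) (hz₀ : z₀ ∈ tube n) : (Fin n → ℂ) ≃ₜ (Fin n → ℂ) where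
  toFun w := (√(lor (imP z₀)) : ℂ) • srefl (toC (midvec (imP z₀))) w + toC (reP z₀)
  invFun w := srefl (toC (midvec (imP z₀))) ((√(lor (imP z₀)) : ℂ)⁻¹ • (w - toC (reP z₀)))
  left_inv w := by
    have h : (√(lor (imP z₀)) : ℂ) ≠ 0 := by
      exact_mod_cast (Real.sqrt_pos.2 hz₀.1).ne'
    have hq : lorB (toC (midvec (imP z₀))) (toC (midvec (imP z₀))) ≠ 0 := by
      rw [lorB_toC]; exact_mod_cast lorB_midvec_ne hz₀
    simp only [add_sub_cancel_right, smul_smul, inv_mul_cancel₀ h, one_smul, srefl_srefl hq]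
  right_inv w := by
    have h : (√(lor (imP z₀)) : ℂ) ≠ 0 := by
      exact_mod_cast (Real.sqrt_pos.2 hz₀.1).ne'
    have hq : lorB (toC (midvec (imP z₀))) (toC (midvec (imP z₀))) ≠ 0 := by
      rw [lorB_toC]; exact_mod_cast lorB_midvec_ne hz₀
    simp only [srefl_srefl hq, smul_smul, mul_inv_cancel₀ h, one_smul, sub_add_cancel]
  continuous_toFun := ((continuous_srefl (toC (midvec (imP z₀)))).const_smul
    (√(lor (imP z₀)) : ℂ)).add continuous_const
  continuous_invFun := (continuous_srefl _).comp
    ((continuous_id.sub continuous_const).const_smul ((√(lor (imP z₀)) : ℂ)⁻¹))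

theorem tubeEquiv_apply {z₀ : Fin n → ℂ} (hz₀ : z₀ ∈ tube n) (w : Fin n → ℂ) :
    tubeEquiv z₀ hz₀ w =
      (√(lor (imP z₀)) : ℂ) • srefl (toC (midvec (imP z₀))) w + toC (reP z₀) := rfl

theorem imP_tubeEquiv {z₀ : Fin n → ℂ} (hz₀ : z₀ ∈ tube n) (w : Fin n → ℂ) :
    imP (tubeEquiv z₀ hz₀ w) = √(lor (imP z₀)) • srefl (midvec (imP z₀)) (imP w) := by
  rw [← imP_srefl]
  funext i
  simp [tubeEquiv_apply, imP, toC]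

theorem lor_imP_tubeEquiv {z₀ : Fin n → ℂ} (hz₀ : z₀ ∈ tube n) (w : Fin n → ℂ) :
    lor (imP (tubeEquiv z₀ hz₀ w)) = lor (imP z₀) * lor (imP w) := by
  rw [imP_tubeEquiv, lor_smul, Real.sq_sqrt hz₀.1.le, lor_srefl (lorB_midvec_ne hz₀)]

theorem tubeEquiv_mem_iff {z₀ : Fin n → ℂ} (hz₀ : z₀ ∈ tube n) (w : Fin n → ℂ) :
    tubeEquiv z₀ hz₀ w ∈ tube n ↔ w ∈ tube n := by
  have hpos : 0 < √(lor (imP z₀)) := Real.sqrt_pos.2 hz₀.1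
  have hq := lorB_midvec_ne hz₀
  constructor
  · intro h
    have h1 : √(lor (imP z₀)) • srefl (midvec (imP z₀)) (imP w) ∈ cone n := by
      rw [← imP_tubeEquiv]; exact h
    have h2 := smul_mem_cone (inv_pos.2 hpos) h1
    rw [smul_smul, inv_mul_cancel₀ hpos.ne', one_smul] at h2
    have h3 := srefl_mem_cone hz₀ h2
    rw [srefl_srefl hq] at h3
    exact h3
  · intro h
    show imP _ ∈ cone n
    rw [imP_tubeEquiv]
    exact smul_mem_cone hpos (srefl_mem_cone hz₀ h)

/-- The base point `i e` of the tube. -/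
def basept (n : ℕ) [NeZero n] : Fin n → ℂ := I • tvec n ℂ

theorem toC_tvec : toC (tvec n ℝ) = tvec n ℂ := by
  funext i
  by_cases h : i = 0
  · subst h; simp [toC]
  · simp [toC, tvec, h]

@[simp] theorem imP_basept : imP (basept n) = tvec n ℝ := by
  have := imP_toC_add_I_smul (0 : Fin n → ℝ) (tvec n ℝ)
  rw [toC_tvec] at this
  convert this using 2
  funext i; simp [basept, toC]

theorem basept_mem : basept n ∈ tube n := by
  show imP _ ∈ cone n
  rw [imP_basept]; exact tvec_mem_cone

theorem tubeEquiv_basept {z₀ : Fin n → ℂ} (hz₀ : z₀ ∈ tube n) :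
    tubeEquiv z₀ hz₀ (basept n) = z₀ := by
  have h : srefl (toC (midvec (imP z₀))) (basept n) =
      I • toC (srefl (midvec (imP z₀)) (tvec n ℝ)) := by
    have := srefl_add_smul (toC (midvec (imP z₀))) 0 (tvec n ℂ) I
    rw [zero_add, ← toC_tvec, srefl_toC] at this
    rw [basept, ← toC_tvec, this]
    simp [srefl, lorB]
  rw [tubeEquiv_apply, h]
  conv_rhs => rw [eq_toC_add z₀]
  rw [add_comm]
  congr 1
  conv_rhs => rw [← srefl_midvec_tvec hz₀]
  funext i
  simp [toC]; ring

theorem del_tubeEquiv {z₀ : Fin n → ℂ} (hz₀ : z₀ ∈ tube n) (z w : Fin n → ℂ) :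
    del (tubeEquiv z₀ hz₀ z) (tubeEquiv z₀ hz₀ w) = lor (imP z₀) * del z w := by
  have hq : lorB (toC (midvec (imP z₀))) (toC (midvec (imP z₀))) ≠ 0 := by
    rw [lorB_toC]; exact_mod_cast lorB_midvec_ne hz₀
  have hconj : ∀ i, (starRingEnd ℂ) (srefl (toC (midvec (imP z₀))) w i) =
      srefl (toC (midvec (imP z₀))) (fun j => (starRingEnd ℂ) (w j)) i := by
    intro i
    simp only [srefl, lorB, toC, Pi.sub_apply, Pi.smul_apply, smul_eq_mul, map_sub, map_mul,
      map_div₀, map_sum, map_ofNat, Complex.conj_ofReal]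
  have h : (fun i => (tubeEquiv z₀ hz₀ z i - (starRingEnd ℂ) (tubeEquiv z₀ hz₀ w i)) / I) =
      (√(lor (imP z₀)) : ℂ) • srefl (toC (midvec (imP z₀)))
        (fun i => (z i - (starRingEnd ℂ) (w i)) / I) := by
    have e : (fun i => (z i - (starRingEnd ℂ) (w i)) / I) =
        (0 : Fin n → ℂ) + (I⁻¹ : ℂ) • (z + (-1 : ℂ) • fun j => (starRingEnd ℂ) (w j)) := by
      funext i; simp; ring
    rw [e, srefl_add_smul, srefl_add_smul]
    funext i
    simp only [tubeEquiv_apply, Pi.add_apply, Pi.smul_apply, smul_eq_mul, map_add, map_mul, hconj,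
      Complex.conj_ofReal]
    have h0 : srefl (toC (midvec (imP z₀))) (0 : Fin n → ℂ) = 0 := by
      simp [srefl, lorB]
    rw [h0]
    simp only [Pi.zero_apply, toC, Complex.conj_ofReal]
    rw [div_eq_mul_inv]
    ring
  rw [del, h, lorC_smul, lorC_srefl hq, ← Complex.ofReal_pow, Real.sq_sqrt hz₀.1.le, del]

theorem map_tubeEquiv_volume {z₀ : Fin n → ℂ} (hz₀ : z₀ ∈ tube n) :
    (volume : Measure (Fin n → ℂ)).map (tubeEquiv z₀ hz₀) =
      ENNReal.ofReal (lor (imP z₀) ^ (-(n : ℝ))) • volume := by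
  have hq : lorB (toC (midvec (imP z₀))) (toC (midvec (imP z₀))) ≠ 0 := by
    rw [lorB_toC]; exact_mod_cast lorB_midvec_ne hz₀
  have hpos : 0 < √(lor (imP z₀)) := Real.sqrt_pos.2 hz₀.1
  have e : (tubeEquiv z₀ hz₀ : (Fin n → ℂ) → (Fin n → ℂ)) =
      (fun w => w + toC (reP z₀)) ∘ (fun w => √(lor (imP z₀)) • w) ∘
        srefl (toC (midvec (imP z₀))) := by
    funext w i
    simp only [tubeEquiv_apply, Function.comp, Pi.add_apply, Pi.smul_apply, Complex.real_smul,
      smul_eq_mul]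
  have m1 : Measurable fun w : Fin n → ℂ => w + toC (reP z₀) := by fun_prop
  have m2 : Measurable fun w : Fin n → ℂ => √(lor (imP z₀)) • w := by fun_prop
  have m3 := (continuous_srefl (toC (midvec (imP z₀)))).measurable
  rw [e, ← Measure.map_map m1 (m2.comp m3), ← Measure.map_map m2 m3,
    (measurePreserving_srefl hq).map_eq, Measure.map_addHaar_smul _ hpos.ne', Measure.map_smul,
    map_add_right_eq_self]
  congr 2
  have hr : Module.finrank ℝ (Fin n → ℂ) = 2 * n := by
    rw [Module.finrank_pi_fintype]; simp [mul_comm]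
  rw [hr, pow_mul, Real.sq_sqrt hz₀.1.le, Real.rpow_neg hz₀.1.le, Real.rpow_natCast,
    abs_of_pos (inv_pos.2 (pow_pos hz₀.1 n))]

theorem map_tubeEquiv_dV {z₀ : Fin n → ℂ} (hz₀ : z₀ ∈ tube n) (ν : ℝ) :
    (dV n ν).map (tubeEquiv z₀ hz₀) =
      ENNReal.ofReal (lor (imP z₀) ^ (-(ν + (n : ℝ) / 2))) • dV n ν := by
  have hpos : 0 < lor (imP z₀) := hz₀.1
  ext s hs
  have hφ : Measurable (tubeEquiv z₀ hz₀) := (tubeEquiv z₀ hz₀).continuous.measurable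
  rw [Measure.map_apply hφ hs, Measure.smul_apply, ← lintegral_indicator_one hs,
    ← lintegral_indicator_one (hφ hs), lintegral_dV, lintegral_dV,
    ← lintegral_indicator isOpen_tube.measurableSet,
    ← lintegral_indicator isOpen_tube.measurableSet]
  set g : (Fin n → ℂ) → ℝ≥0∞ := (tube n).indicator fun z =>
    ENNReal.ofReal (lor (imP z) ^ (ν - (n : ℝ) / 2)) * s.indicator 1 z with hg
  have hgm : Measurable g :=
    ((measurable_ofReal_lor_rpow _).mul (measurable_one.indicator hs)).indicator
      isOpen_tube.measurableSet
  have h1 : ∀ z, (tube n).indicator (fun z => ENNReal.ofReal (lor (imP z) ^ (ν - (n : ℝ) / 2)) *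
      (tubeEquiv z₀ hz₀ ⁻¹' s).indicator 1 z) z =
      ENNReal.ofReal (lor (imP z₀) ^ (-(ν - (n : ℝ) / 2))) * g (tubeEquiv z₀ hz₀ z) := by
    intro z
    by_cases hz : z ∈ tube n
    · rw [hg, indicator_of_mem hz, indicator_of_mem ((tubeEquiv_mem_iff hz₀ z).2 hz),
        lor_imP_tubeEquiv, Real.mul_rpow hpos.le (lor_imP_pos hz).le, ← mul_assoc,
        ← ENNReal.ofReal_mul (Real.rpow_nonneg hpos.le _), ← mul_assoc, ← Real.rpow_add hpos,
        neg_add_cancel, Real.rpow_zero, one_mul]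
      rfl
    · rw [hg, indicator_of_notMem hz, indicator_of_notMem (fun h => hz
        ((tubeEquiv_mem_iff hz₀ z).1 h)), mul_zero]
  rw [lintegral_congr h1, lintegral_const_mul (f := fun z => g (tubeEquiv z₀ hz₀ z)) _ (hgm.comp hφ),
    ← lintegral_map hgm hφ,
    map_tubeEquiv_volume, lintegral_smul_measure, smul_eq_mul, smul_eq_mul, ← mul_assoc,
    ← ENNReal.ofReal_mul (Real.rpow_nonneg hpos.le _), ← Real.rpow_add hpos]
  congr 3
  ring

end symm

/-! ### The bounded realisation of the tube -/

section ball

variable {n : ℕ} [NeZero n]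

/-- The squared Hermitian norm. -/
def nsq {n : ℕ} (z : Fin n → ℂ) : ℝ := ∑ i, normSq (z i)

theorem two_mul_lor_reP (p : Fin n → ℂ) :
    2 * lor (reP p) = (lorC p).re + 2 * normSq (p 0) - nsq p := by
  have : nsq p = ∑ i, reP p i ^ 2 + ∑ i, imP p i ^ 2 := by
    rw [← Finset.sum_add_distrib]
    refine Finset.sum_congr rfl fun i _ => ?_
    rw [Complex.normSq_apply, reP, imP]; ring
  rw [lorC_re, this, lor, lor, Complex.normSq_apply]
  simp only [reP, imP]; ring

theorem nsq_eq_erase (z : Fin n → ℂ) :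
    nsq z = normSq (z 0) + ∑ i ∈ Finset.univ.erase 0, normSq (z i) :=
  (Finset.add_sum_erase _ _ (Finset.mem_univ 0)).symm

theorem normSq_add_norm_le_nsq (z : Fin n → ℂ) :
    normSq (z 0) + ‖z 0 ^ 2 - lorC z‖ ≤ nsq z := by
  rw [lorC_eq_erase, sub_sub_cancel, nsq_eq_erase]
  gcongr
  refine (norm_sum_le _ _).trans (Finset.sum_le_sum fun i _ => ?_)
  rw [norm_pow, Complex.normSq_eq_norm_sq]

theorem norm_lorC_le_nsq (z : Fin n → ℂ) : ‖lorC z‖ ≤ nsq z := by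
  refine le_trans ?_ (normSq_add_norm_le_nsq z)
  have : ‖lorC z‖ ≤ ‖z 0 ^ 2‖ + ‖z 0 ^ 2 - lorC z‖ := by
    rw [norm_sub_rev]
    calc ‖lorC z‖ = ‖z 0 ^ 2 + (lorC z - z 0 ^ 2)‖ := by ring_nf
      _ ≤ _ := norm_add_le _ _
  rwa [norm_pow, ← Complex.normSq_eq_norm_sq] at this

/-- The defining function of the bounded realisation. -/
def hD (z : Fin n → ℂ) : ℝ := 1 - 2 * nsq z + normSq (lorC z)

/-- The bounded realisation of the tube. -/
def balD (n : ℕ) [NeZero n] : Set (Fin n → ℂ) := {z | 0 < hD z ∧ normSq (lorC z) < 1}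

theorem continuous_nsq {n : ℕ} : Continuous (nsq : (Fin n → ℂ) → ℝ) := by
  unfold nsq
  exact continuous_finsetSum _ fun i _ => Complex.continuous_normSq.comp (continuous_apply i)

theorem continuous_hD : Continuous (hD : (Fin n → ℂ) → ℝ) := by
  unfold hD
  exact (continuous_const.sub (continuous_nsq.const_mul 2)).add
    (Complex.continuous_normSq.comp continuous_lorC)

theorem isOpen_balD : IsOpen (balD n) :=
  (isOpen_lt continuous_const continuous_hD).inter
    (isOpen_lt (Complex.continuous_normSq.comp continuous_lorC) continuous_const)

theorem nsq_smul {n : ℕ} (c : ℂ) (z : Fin n → ℂ) : nsq (c • z) = normSq c * nsq z := by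
  simp [nsq, Finset.mul_sum]

theorem hD_smul_of_normSq_eq_one {c : ℂ} (hc : normSq c = 1) (z : Fin n → ℂ) :
    hD (c • z) = hD z := by
  simp [hD, nsq_smul, lorC_smul, hc]

theorem smul_mem_balD {c : ℂ} (hc : normSq c ≤ 1) {z : Fin n → ℂ} (hz : z ∈ balD n) :
    c • z ∈ balD n := by
  obtain ⟨h1, h2⟩ := hz
  have h0 := Complex.normSq_nonneg c
  have hd := Complex.normSq_nonneg (lorC z)
  have hN : normSq (lorC z) ≤ nsq z := by
    refine le_trans ?_ (norm_lorC_le_nsq z)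
    rw [Complex.normSq_eq_norm_sq] at h2 ⊢
    nlinarith [norm_nonneg (lorC z)]
  unfold hD at h1
  constructor
  · rw [hD, nsq_smul, lorC_smul, map_mul, map_pow]
    set t := normSq c
    set D := normSq (lorC z)
    have : 0 ≤ (1 - t) * (2 * nsq z - D * (1 + t)) :=
      mul_nonneg (by linarith) (by nlinarith)
    nlinarith
  · rw [lorC_smul, map_mul, map_pow]
    have := mul_le_mul_of_nonneg_right (pow_le_one₀ (n := 2) h0 hc) hd
    linarith

theorem zero_mem_balD : (0 : Fin n → ℂ) ∈ balD n := by
  have : lorC (0 : Fin n → ℂ) = 0 := by simp [lorC]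
  constructor
  · simp [hD, nsq, this]
  · simp [this]

/-- The Jordan algebra inverse. -/
def cinv (u : Fin n → ℂ) : Fin n → ℂ := (lorC u)⁻¹ • srefl (tvec n ℂ) u

theorem lorB_tvec_tvec_ne_zero : lorB (tvec n ℂ) (tvec n ℂ) ≠ 0 := by simp

theorem lorC_cinv {u : Fin n → ℂ} (hu : lorC u ≠ 0) : lorC (cinv u) = (lorC u)⁻¹ := by
  rw [cinv, lorC_smul, lorC_srefl lorB_tvec_tvec_ne_zero]
  field_simp

theorem srefl_smul (q x : Fin n → ℂ) (c : ℂ) : srefl q (c • x) = c • srefl q x := by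
  have := srefl_add_smul q 0 x c
  have h0 : srefl q (0 : Fin n → ℂ) = 0 := by simp [srefl, lorB]
  rwa [zero_add, h0, zero_add] at this

theorem cinv_cinv {u : Fin n → ℂ} (hu : lorC u ≠ 0) : cinv (cinv u) = u := by
  rw [cinv, lorC_cinv hu, cinv, srefl_smul, srefl_srefl lorB_tvec_tvec_ne_zero, smul_smul, inv_inv,
    mul_inv_cancel₀ hu, one_smul]

theorem srefl_tvec_zero (u : Fin n → ℂ) : srefl (tvec n ℂ) u 0 = u 0 := by
  simp [srefl]; ring

theorem nsq_srefl_tvec (u : Fin n → ℂ) : nsq (srefl (tvec n ℂ) u) = nsq u := by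
  rw [nsq_eq_erase, nsq_eq_erase, srefl_tvec_zero]
  congr 1
  refine Finset.sum_congr rfl fun i hi => ?_
  simp [srefl, tvec, (Finset.mem_erase.1 hi).1]

theorem cinv_zero (u : Fin n → ℂ) : cinv u 0 = u 0 / lorC u := by
  simp [cinv, srefl_tvec_zero, div_eq_inv_mul]

theorem nsq_cinv (u : Fin n → ℂ) : nsq (cinv u) = nsq u / normSq (lorC u) := by
  rw [cinv, nsq_smul, nsq_srefl_tvec, map_inv₀, div_eq_inv_mul]

theorem nsq_smul_sub_tvec (c : ℝ) (q : Fin n → ℂ) :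
    nsq ((c : ℂ) • q - tvec n ℂ) = c ^ 2 * nsq q - 2 * c * (q 0).re + 1 := by
  have h : ∀ z : Fin n → ℂ, nsq z = normSq (z 0) + ∑ i ∈ Finset.univ.erase 0, normSq (z i) :=
    nsq_eq_erase
  rw [h, h q, mul_add, Finset.mul_sum]
  have : ∑ i ∈ Finset.univ.erase 0, normSq (((c : ℂ) • q - tvec n ℂ) i) =
      ∑ i ∈ Finset.univ.erase (0 : Fin n), c ^ 2 * normSq (q i) := by
    refine Finset.sum_congr rfl fun i hi => ?_
    simp [tvec, (Finset.mem_erase.1 hi).1, pow_two]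
  rw [this]
  simp only [Pi.sub_apply, Pi.smul_apply, smul_eq_mul, tvec_zero, Complex.normSq_apply,
    Complex.sub_re, Complex.sub_im, Complex.mul_re, Complex.mul_im, Complex.ofReal_re,
    Complex.ofReal_im, Complex.one_re, Complex.one_im]
  ring

theorem lorC_tvec_sub (z : Fin n → ℂ) : lorC (tvec n ℂ - z) = 1 - 2 * z 0 + lorC z := by
  rw [lorC_sub, lorC_eq_lorB (tvec n ℂ), lorB_tvec_left, lorB_tvec_left, tvec_zero]

theorem normSq_mul_lor_reP {z : Fin n → ℂ} (hz : lorC (tvec n ℂ - z) ≠ 0) :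
    normSq (lorC (tvec n ℂ - z)) *
      lor (reP ((2 : ℂ) • cinv (tvec n ℂ - z) - tvec n ℂ)) = hD z := by
  set u := tvec n ℂ - z with hu
  have h1 := two_mul_lor_reP ((2 : ℂ) • cinv u - tvec n ℂ)
  have h2 := nsq_smul_sub_tvec 2 (cinv u)
  have h3 := nsq_smul_sub_tvec (-1) (-z)
  have e3 : ((-1 : ℝ) : ℂ) • (-z) - tvec n ℂ = -u := by rw [hu]; simp
  have e4 : ∀ x : Fin n → ℂ, nsq (-x) = nsq x := fun x => by simp [nsq]
  rw [e3, e4, e4] at h3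
  rw [Complex.ofReal_ofNat] at h2
  rw [h2, lorC_sub, lorC_smul, lorC_cinv hz, lorB_smul_left, lorB_tvec_right, nsq_cinv,
    lorC_eq_lorB (tvec n ℂ), lorB_tvec_left, tvec_zero] at h1
  simp only [Pi.sub_apply, Pi.smul_apply, smul_eq_mul, tvec_zero, cinv_zero] at h1
  have hu0 : u 0 = 1 - z 0 := by simp [hu]
  have hlu : lorC u = 1 - 2 * z 0 + lorC z := lorC_tvec_sub z
  have hd : 0 < normSq (lorC u) := Complex.normSq_pos.2 hz
  rw [hD]
  have e1 : normSq (lorC u) * ((lorC u).re / normSq (lorC u)) = (lorC u).re := by field_simp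
  have e2 : normSq (lorC u) * (u 0 / lorC u).re =
      (u 0).re * (lorC u).re + (u 0).im * (lorC u).im := by
    rw [Complex.div_re]; field_simp
  have e5 : normSq (lorC u) * normSq (2 * (u 0 / lorC u) - 1) = normSq (2 * u 0 - lorC u) := by
    rw [← map_mul]
    congr 1
    field_simp
  have e6 : normSq (lorC u) * (nsq u / normSq (lorC u)) = nsq u := by field_simp
  simp only [Complex.add_re, Complex.sub_re, Complex.mul_re, Complex.re_ofNat, Complex.im_ofNat,
    Complex.one_re, pow_two] at h1
  norm_num at h1
  have h7 : normSq (lorC u) * (2 * lor (reP ((2 : ℂ) • cinv u - tvec n ℂ))) =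
      4 * (normSq (lorC u) * ((lorC u).re / normSq (lorC u)))
       - 4 * (normSq (lorC u) * (u 0 / lorC u).re) + normSq (lorC u)
       + 2 * (normSq (lorC u) * normSq (2 * (u 0 / lorC u) - 1))
       - (4 * (normSq (lorC u) * (nsq u / normSq (lorC u)))
         - 4 * (normSq (lorC u) * (u 0 / lorC u).re) + normSq (lorC u)) := by
    rw [h1]; ring
  rw [e1, e2, e5, e6, h3] at h7
  have h8 : (-z) 0 = - z 0 := rfl
  simp only [h8, hu0, hlu, Complex.normSq_apply, Complex.add_re, Complex.add_im, Complex.sub_re,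
    Complex.sub_im, Complex.mul_re, Complex.mul_im, Complex.re_ofNat, Complex.im_ofNat,
    Complex.one_re, Complex.one_im, Complex.neg_re] at h7 ⊢
  linarith

theorem sq_lt_of_hD_pos {z : Fin n → ℂ} (hz : 0 < hD z) :
    (2 * ((z 0).re - ((z 0).re * (lorC z).re + (z 0).im * (lorC z).im))) ^ 2 <
      (1 - normSq (lorC z)) ^ 2 := by
  have h1 := normSq_add_norm_le_nsq z
  have h2 : ‖z 0 ^ 2 - lorC z‖ < (1 + normSq (lorC z)) / 2 - normSq (z 0) := by
    unfold hD at hz; linarith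
  have h3 := mul_self_lt_mul_self (norm_nonneg _) h2
  rw [← pow_two ‖_‖, ← Complex.normSq_eq_norm_sq] at h3
  simp only [Complex.normSq_apply, Complex.sub_re, Complex.sub_im, pow_two (z 0), Complex.mul_re,
    Complex.mul_im] at h3 ⊢
  nlinarith [sq_nonneg ((z 0).im + (z 0).im * (lorC z).re - (z 0).re * (lorC z).im)]

theorem re_smul_cinv_sub_tvec {z : Fin n → ℂ} (hz : lorC (tvec n ℂ - z) ≠ 0) :
    normSq (lorC (tvec n ℂ - z)) * reP ((2 : ℂ) • cinv (tvec n ℂ - z) - tvec n ℂ) 0 =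
      1 - normSq (lorC z) -
        2 * ((z 0).re - ((z 0).re * (lorC z).re + (z 0).im * (lorC z).im)) := by
  have hd : 0 < normSq (lorC (tvec n ℂ - z)) := Complex.normSq_pos.2 hz
  have e1 : ((2 : ℂ) • cinv (tvec n ℂ - z) - tvec n ℂ) 0 =
      (1 - lorC z) / lorC (tvec n ℂ - z) := by
    simp only [Pi.sub_apply, Pi.smul_apply, smul_eq_mul, tvec_zero, cinv_zero]
    field_simp
    rw [lorC_tvec_sub]; ring
  rw [reP, e1, Complex.div_re, mul_add, mul_div_cancel₀ _ hd.ne', mul_div_cancel₀ _ hd.ne',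
    lorC_tvec_sub]
  simp [Complex.normSq_apply]
  ring

theorem lorC_tvec_sub_ne_zero {z : Fin n → ℂ} (hz : z ∈ balD n) : lorC (tvec n ℂ - z) ≠ 0 := by
  intro h
  have h1 := sq_lt_of_hD_pos hz.1
  have h2 := abs_lt_of_sq_lt_sq h1 (by linarith [hz.2])
  have h3 : ((1 - lorC z) * (starRingEnd ℂ) (lorC (tvec n ℂ - z))).re = 1 - normSq (lorC z) -
        2 * ((z 0).re - ((z 0).re * (lorC z).re + (z 0).im * (lorC z).im)) := by
    rw [lorC_tvec_sub]
    simp [Complex.normSq_apply]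
    ring
  rw [h] at h3
  simp at h3
  have := (abs_lt.1 h2).2
  linarith

theorem reP_mem_cone_iff {z : Fin n → ℂ} (hz : lorC (tvec n ℂ - z) ≠ 0) :
    reP ((2 : ℂ) • cinv (tvec n ℂ - z) - tvec n ℂ) ∈ cone n ↔ z ∈ balD n := by
  have hd : 0 < normSq (lorC (tvec n ℂ - z)) := Complex.normSq_pos.2 hz
  have h1 := normSq_mul_lor_reP hz
  have h2 := re_smul_cinv_sub_tvec hz
  constructor
  · intro h
    have h3 : 0 < hD z := h1 ▸ mul_pos hd h.1
    have h4 := sq_lt_of_hD_pos h3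
    have h5 := h2 ▸ mul_pos hd h.2
    refine ⟨h3, ?_⟩
    by_contra hcon
    have h6 := abs_lt_of_sq_lt_sq' (a := 2 * ((z 0).re - ((z 0).re * (lorC z).re +
      (z 0).im * (lorC z).im))) (b := normSq (lorC z) - 1) (by linarith) (by linarith)
    linarith [h6.1]
  · intro h
    have h4 := sq_lt_of_hD_pos h.1
    have h6 := abs_lt_of_sq_lt_sq' h4 (by linarith [h.2])
    constructor
    · exact pos_of_mul_pos_right (h1 ▸ h.1) hd.le
    · refine pos_of_mul_pos_right (a := normSq (lorC (tvec n ℂ - z))) ?_ hd.le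
      rw [h2]; linarith [h6.2]

end ball

/-! ### The Cayley transform and the reproducing formula -/

section cayley

variable {n : ℕ} [NeZero n]

/-- The Cayley transform. -/
def cay (z : Fin n → ℂ) : Fin n → ℂ := I • ((2 : ℂ) • cinv (tvec n ℂ - z) - tvec n ℂ)

/-- The inverse Cayley transform. -/
def cayInv (w : Fin n → ℂ) : Fin n → ℂ :=
  tvec n ℂ - cinv ((2 : ℂ)⁻¹ • (I⁻¹ • w + tvec n ℂ))

theorem imP_I_smul {n : ℕ} (p : Fin n → ℂ) : imP (I • p) = reP p := by
  funext i; simp [imP, reP]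

theorem cay_mem {z : Fin n → ℂ} (hz : z ∈ balD n) : cay z ∈ tube n := by
  show imP _ ∈ cone n
  rw [cay, imP_I_smul]
  exact (reP_mem_cone_iff (lorC_tvec_sub_ne_zero hz)).2 hz

theorem lorC_cayInv_arg {w : Fin n → ℂ} (hw : w ∈ tube n) :
    lorC ((2 : ℂ)⁻¹ • (I⁻¹ • w + tvec n ℂ)) ≠ 0 := by
  have h : reP (I⁻¹ • w + tvec n ℂ) = imP w + tvec n ℝ := by
    rw [← toC_tvec]; funext i; simp [reP, imP, toC]
  rw [lorC_smul]
  refine mul_ne_zero (by norm_num) (lorC_ne_zero ?_)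
  rw [h]
  exact add_mem_cone hw tvec_mem_cone

theorem cay_cayInv {w : Fin n → ℂ} (hw : w ∈ tube n) : cay (cayInv w) = w := by
  rw [cay, cayInv, sub_sub_cancel, cinv_cinv (lorC_cayInv_arg hw), smul_smul,
    mul_inv_cancel₀ two_ne_zero, one_smul, add_sub_cancel_right, smul_smul,
    mul_inv_cancel₀ I_ne_zero, one_smul]

theorem cayInv_mem {w : Fin n → ℂ} (hw : w ∈ tube n) : cayInv w ∈ balD n := by
  have h1 := lorC_cayInv_arg hw
  have h2 : lorC (tvec n ℂ - cayInv w) ≠ 0 := by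
    rw [cayInv, sub_sub_cancel, lorC_cinv h1]; exact inv_ne_zero h1
  refine (reP_mem_cone_iff h2).1 ?_
  rw [← imP_I_smul]
  have := cay_cayInv hw
  rw [cay] at this
  rw [this]; exact hw

theorem cayInv_cay {z : Fin n → ℂ} (hz : z ∈ balD n) : cayInv (cay z) = z := by
  rw [cayInv, cay, smul_smul, inv_mul_cancel₀ I_ne_zero, one_smul, sub_add_cancel, smul_smul,
    inv_mul_cancel₀ two_ne_zero, one_smul, cinv_cinv (lorC_tvec_sub_ne_zero hz), sub_sub_cancel]

theorem image_cay : Set.image cay (balD n) = tube n := by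
  ext w
  constructor
  · rintro ⟨z, hz, rfl⟩; exact cay_mem hz
  · intro hw; exact ⟨cayInv w, cayInv_mem hw, cay_cayInv hw⟩

theorem injOn_cay : InjOn (cay : (Fin n → ℂ) → _) (balD n) :=
  fun z hz z' hz' h => by rw [← cayInv_cay hz, h, cayInv_cay hz']

theorem lor_imP_cay {z : Fin n → ℂ} (hz : z ∈ balD n) :
    lor (imP (cay z)) = hD z / normSq (lorC (tvec n ℂ - z)) := by
  have h := lorC_tvec_sub_ne_zero hz
  rw [cay, imP_I_smul, eq_div_iff (Complex.normSq_pos.2 h).ne', mul_comm, normSq_mul_lor_reP h]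

theorem conj_basept (i : Fin n) : (starRingEnd ℂ) (basept n i) = -basept n i := by
  by_cases h : i = 0
  · subst h; simp [basept]
  · simp [basept, tvec, h]

theorem del_cay_basept {z : Fin n → ℂ} (hz : z ∈ balD n) :
    del (cay z) (basept n) = 4 / lorC (tvec n ℂ - z) := by
  have h : (fun i => (cay z i - (starRingEnd ℂ) (basept n i)) / I) =
      (2 : ℂ) • cinv (tvec n ℂ - z) := by
    funext i
    rw [conj_basept]
    simp [cay, basept]
    field_simp
    ring_nf
    simp
  rw [del, h, lorC_smul, lorC_cinv (lorC_tvec_sub_ne_zero hz)]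
  ring

theorem cay_zero : cay (0 : Fin n → ℂ) = basept n := by
  have h : srefl (tvec n ℂ) (tvec n ℂ) = tvec n ℂ := by
    simp only [srefl, lorB_tvec_left, tvec_zero]
    norm_num
    rw [two_smul]; abel
  rw [cay, sub_zero, cinv, h, lorC_eq_lorB, lorB_tvec_left, tvec_zero, inv_one, one_smul, two_smul,
    add_sub_cancel_right, basept]

theorem del_basept_basept : del (basept n) (basept n) = 4 := by
  have := del_cay_basept (zero_mem_balD (n := n))
  rwa [cay_zero, sub_zero, lorC_eq_lorB, lorB_tvec_left, tvec_zero, div_one] at this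

/-- `srefl q` as a complex linear map. -/
def sreflC (q : Fin n → ℂ) : (Fin n → ℂ) →ₗ[ℂ] (Fin n → ℂ) where
  toFun := srefl q
  map_add' x y := by
    have := srefl_add_smul q x y 1
    rwa [one_smul, one_smul] at this
  map_smul' c x := srefl_smul q x c

/-- Multiplication by a complex scalar and composition with two reflections. -/
def scaledRefl (c : ℂ) (q : Fin n → ℂ) : (Fin n → ℂ) →L[ℂ] (Fin n → ℂ) :=
  LinearMap.toContinuousLinearMap (c • (sreflC (tvec n ℂ) ∘ₗ sreflC q))

theorem scaledRefl_apply (c : ℂ) (q x : Fin n → ℂ) :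
    scaledRefl c q x = c • srefl (tvec n ℂ) (srefl q x) := rfl

theorem det_restrictScalars_smul {n : ℕ} (c : ℂ) (f : (Fin n → ℂ) →ₗ[ℂ] (Fin n → ℂ)) :
    LinearMap.det ((c • f).restrictScalars ℝ) = normSq c ^ n * normSq (LinearMap.det f) := by
  rw [LinearMap.det_restrictScalars, LinearMap.det_smul, map_mul, map_pow,
    Algebra.norm_complex_apply, Algebra.norm_complex_apply, Module.finrank_fin_fun]

theorem normSq_det_sreflC {q : Fin n → ℂ} (hq : lorB q q ≠ 0) :
    normSq (LinearMap.det (sreflC q)) = 1 := by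
  have h : sreflC q ∘ₗ sreflC q = LinearMap.id := LinearMap.ext (srefl_srefl hq)
  have h1 : LinearMap.det (sreflC q) * LinearMap.det (sreflC q) = 1 := by
    rw [← LinearMap.det_comp, h, LinearMap.det_id]
  rcases mul_self_eq_one_iff.1 h1 with h | h <;> simp [h]

theorem abs_det_scaledRefl (c : ℂ) {q : Fin n → ℂ} (hq : lorB q q ≠ 0) :
    |((scaledRefl c q).restrictScalars ℝ).det| = normSq c ^ n := by
  have h : ((scaledRefl c q).restrictScalars ℝ).det =
      LinearMap.det ((c • (sreflC (tvec n ℂ) ∘ₗ sreflC q)).restrictScalars ℝ) := rfl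
  rw [h, det_restrictScalars_smul, LinearMap.det_comp, map_mul,
    normSq_det_sreflC lorB_tvec_tvec_ne_zero, normSq_det_sreflC hq, mul_one, mul_one, abs_of_nonneg
    (pow_nonneg (Complex.normSq_nonneg _) _)]

theorem hasFDerivAt_lorC (u : Fin n → ℂ) :
    ∃ L : (Fin n → ℂ) →L[ℂ] ℂ, HasFDerivAt lorC L u ∧ ∀ v, L v = 2 * lorB u v := by
  have hl : ∀ i, HasFDerivAt (fun z : Fin n → ℂ => z i)
      (ContinuousLinearMap.proj (R := ℂ) (φ := fun _ : Fin n => ℂ) i) u := fun i =>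
    (ContinuousLinearMap.proj (R := ℂ) (φ := fun _ : Fin n => ℂ) i).hasFDerivAt
  refine ⟨_, (((hl 0).pow 2).const_mul 2).sub (HasFDerivAt.fun_sum fun i _ => (hl i).pow 2), ?_⟩
  intro v
  simp [lorB, Finset.mul_sum, mul_sub, mul_assoc]

theorem hasFDerivAt_cinv {u : Fin n → ℂ} (hu : lorC u ≠ 0) :
    HasFDerivAt cinv (scaledRefl (-(lorC u)⁻¹) u) u := by
  obtain ⟨L, hL, hLv⟩ := hasFDerivAt_lorC u
  have h1 : HasFDerivAt (fun v => srefl (tvec n ℂ) v)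
      (LinearMap.toContinuousLinearMap (sreflC (tvec n ℂ))) u :=
    (LinearMap.toContinuousLinearMap (sreflC (tvec n ℂ))).hasFDerivAt
  have h2 := ((hasDerivAt_inv hu).comp_hasFDerivAt u hL).smul h1
  refine h2.congr_fderiv ?_
  ext1 v
  simp only [scaledRefl_apply, add_apply, smul_apply,
    ContinuousLinearMap.smulRight_apply, hLv, Function.comp]
  have e : srefl u v = (2 * lorB v u / lorC u) • u - v := by rw [srefl, lorC_eq_lorB]
  have e2 : srefl (tvec n ℂ) (srefl u v) = (2 * lorB v u / lorC u) • srefl (tvec n ℂ) u -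
      srefl (tvec n ℂ) v := by
    rw [e]
    have := (sreflC (tvec n ℂ)).map_sub ((2 * lorB v u / lorC u) • u) v
    rw [map_smul] at this
    exact this
  rw [e2]
  funext i
  simp [sreflC, lorB_comm v u]
  field_simp
  ring

theorem hasFDerivAt_cay {z : Fin n → ℂ} (hz : z ∈ balD n) :
    HasFDerivAt cay (scaledRefl (2 * I * (lorC (tvec n ℂ - z))⁻¹) (tvec n ℂ - z)) z := by
  have h1 : HasFDerivAt (fun z : Fin n → ℂ => tvec n ℂ - z)
      (-ContinuousLinearMap.id ℂ (Fin n → ℂ)) z := (hasFDerivAt_id z).const_sub _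
  have h2 := (((hasFDerivAt_cinv (lorC_tvec_sub_ne_zero hz)).comp z h1).const_smul
    (2 : ℂ)).sub_const (tvec n ℂ) |>.const_smul I
  refine h2.congr_fderiv ?_
  ext1 v
  have e : ∀ q : Fin n → ℂ, srefl q (-v) = - srefl q v := fun q => (sreflC q).map_neg v
  have e' : srefl (tvec n ℂ) (-(srefl (tvec n ℂ - z) v)) =
    -srefl (tvec n ℂ) (srefl (tvec n ℂ - z) v) := (sreflC _).map_neg _
  simp only [smul_apply, ContinuousLinearMap.comp_apply,
    neg_apply, ContinuousLinearMap.id_apply, scaledRefl_apply, e, e', smul_smul,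
    smul_neg, neg_smul, neg_neg]
  congr 1
  ring

theorem abs_det_cay {z : Fin n → ℂ} (hz : z ∈ balD n) :
    |((scaledRefl (2 * I * (lorC (tvec n ℂ - z))⁻¹) (tvec n ℂ - z)).restrictScalars ℝ).det| =
      4 ^ n * normSq (lorC (tvec n ℂ - z)) ^ (-(n : ℝ)) := by
  rw [abs_det_scaledRefl _ (by rw [← lorC_eq_lorB]; exact lorC_tvec_sub_ne_zero hz)]
  rw [map_mul, map_mul, map_inv₀, mul_pow, inv_pow, Complex.normSq_I, Real.rpow_neg
    (Complex.normSq_nonneg _), Real.rpow_natCast]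
  norm_num

end cayley

section reproducing

variable {n : ℕ} [NeZero n]

theorem measurePreserving_smul_of_norm_one {n : ℕ} {c : ℂ} (hc : normSq c = 1) :
    MeasurePreserving (fun z : Fin n → ℂ => c • z) volume volume := by
  set f : (Fin n → ℂ) →ₗ[ℝ] (Fin n → ℂ) :=
    (c • (LinearMap.id : (Fin n → ℂ) →ₗ[ℂ] (Fin n → ℂ))).restrictScalars ℝ with hf
  have hdet : LinearMap.det f = 1 := by
    rw [hf, det_restrictScalars_smul, hc, LinearMap.det_id]; simp
  have h := Measure.map_linearMap_addHaar_eq_smul_addHaar (volume : Measure (Fin n → ℂ))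
    (f := f) (by rw [hdet]; exact one_ne_zero)
  rw [hdet] at h
  refine ⟨(continuous_const_smul c).measurable, ?_⟩
  have h2 : (f : (Fin n → ℂ) → (Fin n → ℂ)) = fun z => c • z := rfl
  rw [← h2, h]
  simp

theorem circle_mean_balD {φ : (Fin n → ℂ) → ℂ} (hφ : DifferentiableOn ℂ φ (balD n))
    {z : Fin n → ℂ} (hz : z ∈ balD n) :
    ∫ θ in Ioc 0 (2 * Real.pi), φ (circleMap 0 1 θ • z) = 2 * Real.pi * φ 0 := by
  have hd : DifferentiableOn ℂ (fun c : ℂ => φ (c • z)) {c | c • z ∈ balD n} :=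
    hφ.comp ((differentiable_id.smul_const z).differentiableOn) fun c hc => hc
  have hc : Metric.closedBall (0 : ℂ) |1| ⊆ {c | c • z ∈ balD n} := by
    intro c hc
    refine smul_mem_balD ?_ hz
    have : ‖c‖ ≤ 1 := by simpa using hc
    rw [Complex.normSq_eq_norm_sq]
    exact pow_le_one₀ (norm_nonneg _) this
  have h := (hd.mono (Metric.closure_ball_subset_closedBall.trans hc)).diffContOnCl.circleAverage
  rw [Real.circleAverage, intervalIntegral.integral_of_le Real.two_pi_pos.le, zero_smul] at h
  rw [← h, Complex.real_smul]
  push_cast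
  have : (Real.pi : ℂ) ≠ 0 := by exact_mod_cast Real.pi_ne_zero
  field_simp

theorem mean_value_balD {φ : (Fin n → ℂ) → ℂ} (hφ : DifferentiableOn ℂ φ (balD n)) (κ : ℝ)
    (hi : IntegrableOn (fun z => ((hD z ^ κ : ℝ) : ℂ) * φ z) (balD n)) :
    ∫ z in balD n, ((hD z ^ κ : ℝ) : ℂ) * φ z =
      (∫ z in balD n, ((hD z ^ κ : ℝ) : ℂ)) * φ 0 := by
  classical
  have hDm : MeasurableSet (balD n) := isOpen_balD.measurableSet
  set ψ : (Fin n → ℂ) → ℂ := (balD n).indicator fun z => ((hD z ^ κ : ℝ) : ℂ) * φ z with hψ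
  have hcont : ContinuousOn (fun z => ((hD z ^ κ : ℝ) : ℂ) * φ z) (balD n) := by
    refine ContinuousOn.mul ?_ hφ.continuousOn
    refine Complex.continuous_ofReal.comp_continuousOn ?_
    exact continuous_hD.continuousOn.rpow_const fun z hz => Or.inl hz.1.ne'
  have hψm : Measurable ψ := by
    have := hcont.measurable_piecewise (g := (0 : (Fin n → ℂ) → ℂ)) continuousOn_const hDm
    rwa [Set.piecewise_eq_indicator] at this
  have hψi : Integrable ψ := (integrable_indicator_iff hDm).2 hi
  have hnorm : ∀ θ : ℝ, normSq (circleMap 0 1 θ) = 1 := fun θ => by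
    rw [Complex.normSq_eq_norm_sq]; simp
  have hmp : ∀ θ : ℝ, MeasurePreserving (fun z : Fin n → ℂ => circleMap 0 1 θ • z) volume volume :=
    fun θ => measurePreserving_smul_of_norm_one (hnorm θ)
  have hemb : ∀ θ : ℝ, MeasurableEmbedding (fun z : Fin n → ℂ => circleMap 0 1 θ • z) := fun θ =>
    (Homeomorph.smulOfNeZero (circleMap 0 1 θ)
      (circleMap_ne_center one_ne_zero)).measurableEmbedding
  set J : ℝ × (Fin n → ℂ) → ℂ := fun p => ψ (circleMap 0 1 p.1 • p.2) with hJ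
  have hJm : Measurable J := hψm.comp (by
    refine Continuous.measurable ?_
    exact ((continuous_circleMap 0 1).comp continuous_fst).smul continuous_snd)
  have hJi : Integrable J ((volume.restrict (Ioc 0 (2 * Real.pi))).prod volume) := by
    rw [integrable_prod_iff hJm.aestronglyMeasurable]
    refine ⟨Filter.Eventually.of_forall fun θ => (hmp θ).integrable_comp_of_integrable hψi, ?_⟩
    have : (fun θ : ℝ => ∫ z, ‖J (θ, z)‖) = fun _ => ∫ z, ‖ψ z‖ := by
      funext θ
      exact (hmp θ).integral_comp (hemb θ) fun z => ‖ψ z‖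
    rw [this]
    exact integrable_const _
  have h1 := integral_integral_swap (f := fun θ z => J (θ, z)) hJi
  have h2 : ∀ θ, ∫ z, J (θ, z) = ∫ z, ψ z := fun θ => (hmp θ).integral_comp (hemb θ) ψ
  have h3 : ∀ z, ∫ θ in Ioc 0 (2 * Real.pi), J (θ, z) =
      (balD n).indicator (fun z => ((hD z ^ κ : ℝ) : ℂ)) z * (2 * Real.pi * φ 0) := by
    intro z
    by_cases hz : z ∈ balD n
    · have : ∀ θ, J (θ, z) = ((hD z ^ κ : ℝ) : ℂ) * φ (circleMap 0 1 θ • z) := by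
        intro θ
        simp only [hJ, hψ]
        rw [indicator_of_mem (smul_mem_balD (hnorm θ).le hz),
          hD_smul_of_normSq_eq_one (hnorm θ)]
      simp only [this]
      rw [integral_const_mul, circle_mean_balD hφ hz, indicator_of_mem hz]
    · have : ∀ θ, J (θ, z) = 0 := by
        intro θ
        simp only [hJ, hψ]
        refine indicator_of_notMem (fun hcon => hz ?_) _
        have h := smul_mem_balD (c := (circleMap 0 1 θ)⁻¹) (by rw [map_inv₀, hnorm]; simp) hcon
        rwa [smul_smul, inv_mul_cancel₀ (circleMap_ne_center one_ne_zero), one_smul] at h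
      simp only [this]
      rw [indicator_of_notMem hz]; simp
  simp only [h2, h3] at h1
  rw [integral_mul_const, integral_indicator hDm, setIntegral_const, integral_indicator hDm]
    at h1
  have hpi : (Real.pi : ℂ) ≠ 0 := by exact_mod_cast Real.pi_ne_zero
  have hvol : (volume : Measure ℝ).real (Ioc 0 (2 * Real.pi)) = 2 * Real.pi := by
    simp [Measure.real, Real.pi_pos.le]
  rw [hvol, Complex.real_smul] at h1
  push_cast at h1
  refine mul_left_cancel₀ (mul_ne_zero two_ne_zero hpi) (h1.trans ?_)
  ring

/-- The constant in the reproducing formula. -/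
def reproConst (n : ℕ) [NeZero n] (β : ℝ) : ℂ :=
  ((4 ^ (-(2 * (β + n / 2)) + n : ℝ) : ℝ) : ℂ) *
    (∫ z in balD n, ((hD z ^ (β - (n : ℝ) / 2) : ℝ) : ℂ)) * (4 : ℂ) ^ ((β + n / 2 : ℝ) : ℂ)

theorem bker_ne_zero (s : ℝ) {z w : Fin n → ℂ} (hz : z ∈ tube n) (hw : w ∈ tube n) :
    bker s z w ≠ 0 := by
  rw [bker, Complex.cpow_ne_zero_iff]; exact Or.inl (del_ne_zero hz hw)

theorem reproducing_basept {β : ℝ} {F : (Fin n → ℂ) → ℂ} (hF : DifferentiableOn ℂ F (tube n))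
    (hi : Integrable (fun w => F w * (starRingEnd ℂ) (bker (β + n / 2) w (basept n))) (dV n β)) :
    ∫ w, F w * (starRingEnd ℂ) (bker (β + n / 2) w (basept n)) ∂(dV n β) =
      reproConst n β * F (basept n) := by
  set s : ℝ := β + n / 2 with hs
  set κ : ℝ := β - (n : ℝ) / 2 with hκ
  have hDm : MeasurableSet (balD n) := isOpen_balD.measurableSet
  set φ : (Fin n → ℂ) → ℂ := fun z => F (cay z) / bker s (cay z) (basept n) with hφ
  have hcay : DifferentiableOn ℂ cay (balD n) := fun z hz =>
    (hasFDerivAt_cay hz).differentiableAt.differentiableWithinAt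
  have hmaps : MapsTo cay (balD n) (tube n) := fun z hz => cay_mem hz
  have hφd : DifferentiableOn ℂ φ (balD n) :=
    by
    have h := DifferentiableOn.comp (g := fun w => F w * (bker s w (basept n))⁻¹)
      (hF.mul ((differentiableOn_bker s basept_mem).fun_inv
        fun z hz => bker_ne_zero s hz basept_mem)) hcay hmaps
    exact h
  set g : (Fin n → ℂ) → ℂ := fun w => ((lor (imP w) ^ κ : ℝ) : ℂ) *
    (F w * (starRingEnd ℂ) (bker s w (basept n))) with hg
  have hder : ∀ z ∈ balD n, HasFDerivWithinAt cay
      ((scaledRefl (2 * I * (lorC (tvec n ℂ - z))⁻¹) (tvec n ℂ - z)).restrictScalars ℝ)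
      (balD n) z := fun z hz => ((hasFDerivAt_cay hz).restrictScalars ℝ).hasFDerivWithinAt
  have hkey : ∀ z ∈ balD n,
      |((scaledRefl (2 * I * (lorC (tvec n ℂ - z))⁻¹) (tvec n ℂ - z)).restrictScalars ℝ).det| •
        g (cay z) = ((4 ^ (-(2 * s) + n : ℝ) : ℝ) : ℂ) * (((hD z ^ κ : ℝ) : ℂ) * φ z) := by
    intro z hz
    have hb := bker_ne_zero s (cay_mem hz) basept_mem
    have h1 : F (cay z) * (starRingEnd ℂ) (bker s (cay z) (basept n)) =
        ((‖bker s (cay z) (basept n)‖ ^ 2 : ℝ) : ℂ) * φ z := by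
      simp only [hφ]
      rw [← Complex.normSq_eq_norm_sq, Complex.normSq_eq_conj_mul_self]
      field_simp
    have hu := lorC_tvec_sub_ne_zero hz
    have hN : 0 < ‖lorC (tvec n ℂ - z)‖ := norm_pos_iff.2 hu
    rw [abs_det_cay hz, Complex.real_smul]
    simp only [hg]
    rw [h1, lor_imP_cay hz, norm_bker, del_cay_basept hz, norm_div, Complex.normSq_eq_norm_sq]
    simp only [← mul_assoc, ← Complex.ofReal_mul]
    congr 2
    set N := ‖lorC (tvec n ℂ - z)‖
    rw [show ‖(4 : ℂ)‖ = 4 by simp, Real.div_rpow hz.1.le (by positivity),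
      Real.div_rpow (by norm_num) hN.le, ← Real.rpow_natCast N 2, ← Real.rpow_mul hN.le,
      ← Real.rpow_mul hN.le, div_pow, ← Real.rpow_natCast (4 ^ _), ← Real.rpow_natCast (N ^ _),
      ← Real.rpow_mul hN.le, ← Real.rpow_mul (by norm_num), ← Real.rpow_natCast 4 n,
      div_eq_mul_inv, div_eq_mul_inv, ← Real.rpow_neg hN.le, ← Real.rpow_neg hN.le]
    have h4 : (4 : ℝ) ^ (-(2 * s) + n : ℝ) = 4 ^ (n : ℝ) * 4 ^ (-s * (2 : ℕ)) := by
      rw [← Real.rpow_add (by norm_num)]; congr 1; push_cast; ring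
    have hNN : N ^ ((2 : ℕ) * -(n : ℝ)) * N ^ (-((2 : ℕ) * κ)) * N ^ (-(-s * (2 : ℕ))) = 1 := by
      rw [← Real.rpow_add hN, ← Real.rpow_add hN]
      have : ((2 : ℕ) * -(n : ℝ)) + (-((2 : ℕ) * κ)) + (-(-s * (2 : ℕ))) = 0 := by
        rw [hs, hκ]; push_cast; ring
      rw [this, Real.rpow_zero]
    rw [h4]
    calc _ = 4 ^ (n : ℝ) * 4 ^ (-s * (2 : ℕ)) * hD z ^ κ *
        (N ^ ((2 : ℕ) * -(n : ℝ)) * N ^ (-((2 : ℕ) * κ)) * N ^ (-(-s * (2 : ℕ)))) := by ring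
      _ = _ := by rw [hNN, mul_one]
  have hi2 : IntegrableOn (fun z => ((hD z ^ κ : ℝ) : ℂ) * φ z) (balD n) := by
    rw [integrable_dV_iff, ← image_cay, integrableOn_image_iff_integrableOn_abs_det_fderiv_smul
      volume hDm hder injOn_cay] at hi
    have h := (integrableOn_congr_fun hkey hDm).1 hi
    have h4 : ((4 ^ (-(2 * s) + n : ℝ) : ℝ) : ℂ) ≠ 0 := by
      exact_mod_cast (Real.rpow_pos_of_pos (by norm_num) _).ne'
    exact (integrable_const_mul_iff (isUnit_iff_ne_zero.2 h4) _).1 h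
  have hφ0 : φ 0 = (4 : ℂ) ^ ((s : ℝ) : ℂ) * F (basept n) := by
    simp only [hφ]
    rw [cay_zero, bker, del_basept_basept, Complex.cpow_neg, div_inv_eq_mul, mul_comm]
  rw [integral_dV]
  conv_lhs => rw [← image_cay]
  rw [integral_image_eq_integral_abs_det_fderiv_smul volume hDm hder injOn_cay,
    setIntegral_congr_fun hDm hkey, integral_const_mul, mean_value_balD hφd κ hi2, hφ0, reproConst]
  ring

theorem bker_tubeEquiv (s : ℝ) {z₀ : Fin n → ℂ} (hz₀ : z₀ ∈ tube n) {z w : Fin n → ℂ}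
    (hz : z ∈ tube n) (hw : w ∈ tube n) :
    bker s (tubeEquiv z₀ hz₀ z) (tubeEquiv z₀ hz₀ w) =
      ((lor (imP z₀) ^ (-s) : ℝ) : ℂ) * bker s z w := by
  have hp : 0 < lor (imP z₀) := hz₀.1
  have hl : (lor (imP z₀) : ℂ) ≠ 0 := by exact_mod_cast hp.ne'
  rw [bker, del_tubeEquiv, bker, Complex.cpow_def_of_ne_zero
    (mul_ne_zero hl (del_ne_zero hz hw)), Complex.log_ofReal_mul hp (del_ne_zero hz hw), add_mul,
    Complex.exp_add, ← Complex.cpow_def_of_ne_zero (del_ne_zero hz hw), Complex.ofReal_cpow hp.le,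
    Complex.ofReal_neg, Complex.cpow_def_of_ne_zero hl, Complex.ofReal_log hp.le]

theorem integral_dV_comp_tubeEquiv {z₀ : Fin n → ℂ} (hz₀ : z₀ ∈ tube n) (ν : ℝ)
    (g : (Fin n → ℂ) → ℂ) :
    ∫ w, g (tubeEquiv z₀ hz₀ w) ∂(dV n ν) =
      ((lor (imP z₀) ^ (-(ν + (n : ℝ) / 2)) : ℝ) : ℂ) * ∫ w, g w ∂(dV n ν) := by
  rw [← (tubeEquiv z₀ hz₀).measurableEmbedding.integral_map, map_tubeEquiv_dV,
    integral_smul_measure, ENNReal.toReal_ofReal (Real.rpow_nonneg (lor_imP_pos hz₀).le _),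
    Complex.real_smul]

theorem integrable_dV_comp_tubeEquiv {z₀ : Fin n → ℂ} (hz₀ : z₀ ∈ tube n) {ν : ℝ}
    {g : (Fin n → ℂ) → ℂ} (hg : Integrable g (dV n ν)) :
    Integrable (fun w => g (tubeEquiv z₀ hz₀ w)) (dV n ν) := by
  have h := (tubeEquiv z₀ hz₀).measurableEmbedding.integrable_map_iff (μ := dV n ν) (g := g)
  rw [map_tubeEquiv_dV] at h
  exact h.1 (hg.smul_measure ENNReal.ofReal_ne_top)

theorem differentiable_tubeEquiv {z₀ : Fin n → ℂ} (hz₀ : z₀ ∈ tube n) :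
    Differentiable ℂ (tubeEquiv z₀ hz₀) := by
  have h : (tubeEquiv z₀ hz₀ : (Fin n → ℂ) → (Fin n → ℂ)) = fun w =>
      (√(lor (imP z₀)) : ℂ) • LinearMap.toContinuousLinearMap (sreflC (toC (midvec (imP z₀)))) w +
        toC (reP z₀) := by
    funext w
    rw [tubeEquiv_apply]
    rfl
  rw [h]
  exact (((LinearMap.toContinuousLinearMap
    (sreflC (toC (midvec (imP z₀))))).differentiable).fun_const_smul _).add_const _

/-- The reproducing formula for weighted Bergman kernels on the tube. -/
theorem reproducing {β : ℝ} {F : (Fin n → ℂ) → ℂ} (hF : DifferentiableOn ℂ F (tube n))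
    {z₀ : Fin n → ℂ} (hz₀ : z₀ ∈ tube n)
    (hi : Integrable (fun w => F w * bker (β + n / 2) z₀ w) (dV n β)) :
    ∫ w, F w * bker (β + n / 2) z₀ w ∂(dV n β) = reproConst n β * F z₀ := by
  set s : ℝ := β + n / 2 with hs
  have hp : 0 < lor (imP z₀) := hz₀.1
  have hc : ((lor (imP z₀) ^ (-s) : ℝ) : ℂ) ≠ 0 := by
    exact_mod_cast (Real.rpow_pos_of_pos hp _).ne'
  have hF' : DifferentiableOn ℂ (fun w => F (tubeEquiv z₀ hz₀ w)) (tube n) := by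
    refine hF.comp ?_ fun w hw => (tubeEquiv_mem_iff hz₀ w).2 hw
    exact (differentiable_tubeEquiv hz₀).differentiableOn
  have hkey : ∀ᵐ w ∂(dV n β), F (tubeEquiv z₀ hz₀ w) * bker s z₀ (tubeEquiv z₀ hz₀ w) =
      ((lor (imP z₀) ^ (-s) : ℝ) : ℂ) * (F (tubeEquiv z₀ hz₀ w) *
        (starRingEnd ℂ) (bker s w (basept n))) := by
    filter_upwards [ae_dV_mem_tube β] with w hw
    have h1 := bker_tubeEquiv s hz₀ basept_mem hw
    rw [tubeEquiv_basept] at h1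
    rw [h1, conj_bker s hw basept_mem]; ring
  have hi0 : Integrable (fun w => F (tubeEquiv z₀ hz₀ w) * bker s z₀ (tubeEquiv z₀ hz₀ w))
      (dV n β) := integrable_dV_comp_tubeEquiv (g := fun w => F w * bker s z₀ w) hz₀ hi
  have hi1 := hi0.congr hkey
  have hi2 : Integrable (fun w => F (tubeEquiv z₀ hz₀ w) *
        (starRingEnd ℂ) (bker s w (basept n))) (dV n β) :=
by
    exact (integrable_const_mul_iff (isUnit_iff_ne_zero.2 hc) _).1 hi1
  have h3 := reproducing_basept hF' hi2
  have h4 := integral_dV_comp_tubeEquiv hz₀ β fun w => F w * bker s z₀ w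
  rw [integral_congr_ae hkey, integral_const_mul, h3, tubeEquiv_basept] at h4
  exact (mul_left_cancel₀ hc h4).symm



end reproducing

section splitting

theorem lintegral_fin_cons {E : Type*} [MeasureSpace E] [SigmaFinite (volume : Measure E)] {k : ℕ}
    {f : (Fin (k + 1) → E) → ℝ≥0∞} (hf : Measurable f) :
    ∫⁻ y, f y = ∫⁻ y' : Fin k → E, ∫⁻ t : E, f (Fin.cons t y') := by
  have h := (volume_preserving_piFinSuccAbove (fun _ : Fin (k + 1) => E) 0).symm
  have hm : Measurable fun p : E × (Fin k → E) =>
      f ((MeasurableEquiv.piFinSuccAbove (fun _ : Fin (k + 1) => E) 0).symm p) :=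
    hf.comp (MeasurableEquiv.measurable _)
  rw [← h.lintegral_comp hf]
  refine (lintegral_prod_symm' _ hm).trans ?_
  refine lintegral_congr fun y' => lintegral_congr fun t => ?_
  rw [MeasurableEquiv.piFinSuccAbove_symm_apply]
  congr 1
  exact Fin.insertNth_zero (α := fun _ => E) t y'

theorem lintegral_re_im {n : ℕ} {f : (Fin n → ℂ) → ℝ≥0∞} (hf : Measurable f) :
    ∫⁻ z, f z = ∫⁻ y : Fin n → ℝ, ∫⁻ x : Fin n → ℝ, f (toC x + I • toC y) := by
  have h1 := volume_preserving_pi (ι := Fin n)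
    (fun _ => Complex.volume_preserving_equiv_real_prod.symm)
  have h2 := (volume_measurePreserving_arrowProdEquivProdArrow ℝ ℝ (Fin n)).symm
  have h := h1.comp h2
  have hm := hf.comp h.measurable
  rw [← h.lintegral_comp hf]
  refine (lintegral_prod_symm' _ hm).trans ?_
  refine lintegral_congr fun y => lintegral_congr fun x => ?_
  simp only [Function.comp]
  congr 1
  funext i
  refine (Complex.re_add_im _).symm.trans ?_
  simp only [toC, Pi.add_apply, Pi.smul_apply, smul_eq_mul, mul_comm I]
  rfl

/-- The elementary one-dimensional integrability criterion for `t ^ a (1 + t) ^ (-b)`. -/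
theorem integrableOn_rpow_mul_one_add_rpow {a b : ℝ} (ha : -1 < a) (hb : 0 ≤ b) (hab : a - b < -1) :
    IntegrableOn (fun t : ℝ => t ^ a * (1 + t) ^ (-b)) (Ioi 0) := by
  have hmeas : Measurable fun t : ℝ => t ^ a * (1 + t) ^ (-b) :=
    (measurable_id.pow_const a).mul ((measurable_const.add measurable_id).pow_const (-b))
  have h1 : IntegrableOn (fun t : ℝ => t ^ a * (1 + t) ^ (-b)) (Ioc 0 1) := by
    have h := (intervalIntegral.intervalIntegrable_rpow' (a := 0) (b := 1) ha).1
    refine Integrable.mono' h hmeas.aestronglyMeasurable ?_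
    filter_upwards [ae_restrict_mem measurableSet_Ioc] with t ht
    have h2 : 0 ≤ t ^ a := Real.rpow_nonneg ht.1.le _
    have h3 : (1 + t) ^ (-b) ≤ 1 :=
      Real.rpow_le_one_of_one_le_of_nonpos (by linarith [ht.1]) (by linarith)
    rw [Real.norm_of_nonneg (mul_nonneg h2 (Real.rpow_nonneg (by linarith [ht.1]) _))]
    exact mul_le_of_le_one_right h2 h3
  have h2 : IntegrableOn (fun t : ℝ => t ^ a * (1 + t) ^ (-b)) (Ioi 1) := by
    have h := integrableOn_Ioi_rpow_of_lt hab zero_lt_one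
    refine Integrable.mono' h hmeas.aestronglyMeasurable ?_
    filter_upwards [ae_restrict_mem measurableSet_Ioi] with t ht
    have ht' : (1 : ℝ) < t := ht
    have h0 : 0 < t := by linarith
    have h2 : 0 ≤ t ^ a := Real.rpow_nonneg h0.le _
    have h3 : (1 + t) ^ (-b) ≤ t ^ (-b) :=
      Real.rpow_le_rpow_of_nonpos h0 (by linarith) (by linarith)
    rw [Real.norm_of_nonneg (mul_nonneg h2 (Real.rpow_nonneg (by linarith) _)), sub_eq_add_neg,
      Real.rpow_add h0]
    exact mul_le_mul_of_nonneg_left h3 h2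
  rw [← Ioc_union_Ioi_eq_Ioi zero_le_one]
  exact h1.union h2

/-- The Euclidean norm of a vector in `ℝᵏ`. -/
def euc {k : ℕ} (y : Fin k → ℝ) : ℝ := √(∑ i, y i ^ 2)

theorem euc_nonneg {k : ℕ} (y : Fin k → ℝ) : 0 ≤ euc y := Real.sqrt_nonneg _

theorem euc_sq {k : ℕ} (y : Fin k → ℝ) : euc y ^ 2 = ∑ i, y i ^ 2 :=
  Real.sq_sqrt (Finset.sum_nonneg fun _ _ => sq_nonneg _)

theorem norm_le_euc {k : ℕ} (y : Fin k → ℝ) : ‖y‖ ≤ euc y := by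
  refine (pi_norm_le_iff_of_nonneg (euc_nonneg y)).2 fun i => ?_
  rw [Real.norm_eq_abs]
  refine abs_le_of_sq_le_sq ?_ (euc_nonneg y)
  rw [euc_sq]
  exact Finset.single_le_sum (f := fun i => y i ^ 2) (fun i _ => sq_nonneg _) (Finset.mem_univ i)

theorem lor_cons {k : ℕ} [NeZero (k + 1)] (t : ℝ) (y : Fin k → ℝ) :
    lor (Fin.cons t y : Fin (k + 1) → ℝ) = t ^ 2 - euc y ^ 2 := by
  have h0 : (Fin.cons t y : Fin (k + 1) → ℝ) 0 = t :=
    Fin.cons_zero (α := fun _ => ℝ) t y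
  rw [lor, h0, Fin.sum_univ_succ, euc_sq]
  simp
  ring

theorem mem_cone_cons {k : ℕ} [NeZero (k + 1)] {t : ℝ} {y : Fin k → ℝ}
    (h : (Fin.cons t y : Fin (k + 1) → ℝ) ∈ cone (k + 1)) : euc y < t := by
  have h0 : (Fin.cons t y : Fin (k + 1) → ℝ) 0 = t :=
    Fin.cons_zero (α := fun _ => ℝ) t y
  obtain ⟨h1, h2⟩ := h
  rw [lor_cons] at h1
  rw [h0] at h2
  exact lt_of_pow_lt_pow_left₀ 2 h2.le (by linarith)

end splitting

section horizontal

variable {n : ℕ} [NeZero n]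

theorem imP_toC_add {n : ℕ} (y x : Fin n → ℝ) : imP (toC y + I • toC x) = x :=
  imP_toC_add_I_smul y x

theorem reP_toC_add {n : ℕ} (y x : Fin n → ℝ) : reP (toC y + I • toC x) = y := by
  funext i; simp [reP, toC]

theorem continuous_toC {n : ℕ} : Continuous (toC : (Fin n → ℝ) → (Fin n → ℂ)) := by
  unfold toC; fun_prop

theorem mul_le_norm_lorC_cons_sq {k : ℕ} [NeZero (k + 1)] (t : ℝ) (x : Fin k → ℝ) :
    (1 + (|t| - euc x) ^ 2) * (1 + euc x ^ 2) ≤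
      ‖lorC (toC (tvec (k + 1) ℝ) + I • toC (Fin.cons t x : Fin (k + 1) → ℝ))‖ ^ 2 := by
  rw [norm_lorC_sq, imP_toC_add, reP_toC_add, lor_tvec, lorB_tvec_left, lor_cons]
  have h0 : (Fin.cons t x : Fin (k + 1) → ℝ) 0 = t := Fin.cons_zero (α := fun _ => ℝ) t x
  rw [h0, ← sq_abs t]
  have h1 := abs_nonneg t
  have h2 := euc_nonneg x
  have h3 : 0 ≤ (|t| - euc x) ^ 2 * (|t| * (|t| + 2 * euc x)) := by positivity
  nlinarith [mul_nonneg h1 h2, sq_nonneg |t|]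

theorem lintegral_norm_lorC_lt_top (hn : 2 ≤ n) {s : ℝ} (hs : (n : ℝ) - 1 < s) :
    ∫⁻ x : Fin n → ℝ, ENNReal.ofReal (‖lorC (toC (tvec n ℝ) + I • toC x)‖ ^ (-s)) < ⊤ := by
  obtain ⟨k, rfl⟩ : ∃ k, n = k + 1 := ⟨n - 1, by omega⟩
  have hk : (1 : ℝ) ≤ k := by exact_mod_cast (by omega : 1 ≤ k)
  push_cast at hs
  have hs0 : 0 < s := by linarith
  have hA : Integrable (fun t : ℝ => (1 + ‖t‖ ^ 2) ^ (-s / 2)) :=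
    integrable_rpow_neg_one_add_norm_sq (by simp; linarith)
  have hB : Integrable (fun x : Fin k → ℝ => (1 + ‖x‖ ^ 2) ^ (-s / 2)) :=
    integrable_rpow_neg_one_add_norm_sq (by simp; linarith)
  simp only [Real.norm_eq_abs, sq_abs] at hA
  set A : ℝ≥0∞ := ∫⁻ t : ℝ, ENNReal.ofReal ((1 + t ^ 2) ^ (-s / 2)) with hAdef
  have hAm : Measurable fun t : ℝ => ENNReal.ofReal ((1 + t ^ 2) ^ (-s / 2)) := by fun_prop
  have hAt : A < ⊤ := hA.lintegral_lt_top
  have hpt : ∀ (x : Fin k → ℝ) (t : ℝ),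
      ENNReal.ofReal (‖lorC (toC (tvec (k + 1) ℝ) + I • toC (Fin.cons t x))‖ ^ (-s)) ≤
      ENNReal.ofReal ((1 + ‖x‖ ^ 2) ^ (-s / 2)) *
        (ENNReal.ofReal ((1 + (t - euc x) ^ 2) ^ (-s / 2)) +
          ENNReal.ofReal ((1 + (t + euc x) ^ 2) ^ (-s / 2))) := by
    intro x t
    have h1 := mul_le_norm_lorC_cons_sq t x
    have h2 : (0 : ℝ) < 1 + (|t| - euc x) ^ 2 := by positivity
    have h3 : (0 : ℝ) < 1 + euc x ^ 2 := by positivity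
    have h4 : ‖lorC (toC (tvec (k + 1) ℝ) + I • toC (Fin.cons t x : Fin (k + 1) → ℝ))‖ ^ (-s) ≤
        (1 + (|t| - euc x) ^ 2) ^ (-s / 2) * (1 + euc x ^ 2) ^ (-s / 2) := by
      rw [← Real.mul_rpow h2.le h3.le]
      refine le_trans (le_of_eq ?_) (Real.rpow_le_rpow_of_nonpos (mul_pos h2 h3) h1 (by linarith))
      rw [← Real.rpow_natCast, ← Real.rpow_mul (norm_nonneg _)]
      congr 1; push_cast; ring
    have h5 : (1 + euc x ^ 2) ^ (-s / 2) ≤ (1 + ‖x‖ ^ 2) ^ (-s / 2) := by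
      refine Real.rpow_le_rpow_of_nonpos (by positivity) ?_ (by linarith)
      have := pow_le_pow_left₀ (norm_nonneg _) (norm_le_euc x) 2
      linarith
    have h6 : (1 + (|t| - euc x) ^ 2) ^ (-s / 2) ≤
        (1 + (t - euc x) ^ 2) ^ (-s / 2) + (1 + (t + euc x) ^ 2) ^ (-s / 2) := by
      have p1 : 0 ≤ (1 + (t - euc x) ^ 2) ^ (-s / 2) := by positivity
      have p2 : 0 ≤ (1 + (t + euc x) ^ 2) ^ (-s / 2) := by positivity
      rcases abs_cases t with ⟨h, -⟩ | ⟨h, -⟩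
      · rw [h]; linarith
      · rw [h, show (-t - euc x) ^ 2 = (t + euc x) ^ 2 by ring]; linarith
    rw [← ENNReal.ofReal_add (by positivity) (by positivity), ← ENNReal.ofReal_mul (by positivity)]
    refine ENNReal.ofReal_le_ofReal (h4.trans ?_)
    rw [mul_comm]
    exact mul_le_mul h5 h6 (by positivity) (by positivity)
  rw [lintegral_fin_cons (by
    refine ENNReal.measurable_ofReal.comp (Measurable.pow_const (Continuous.measurable ?_) _)
    exact (continuous_lorC.comp (continuous_const.add (continuous_toC.const_smul I))).norm)]
  have hin : ∀ x : Fin k → ℝ, ∫⁻ t : ℝ,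
      ENNReal.ofReal (‖lorC (toC (tvec (k + 1) ℝ) + I • toC (Fin.cons t x))‖ ^ (-s)) ≤
        ENNReal.ofReal ((1 + ‖x‖ ^ 2) ^ (-s / 2)) * (A + A) := by
    intro x
    refine (lintegral_mono (hpt x)).trans (le_of_eq ?_)
    have m1 : Measurable fun t : ℝ => ENNReal.ofReal ((1 + (t - euc x) ^ 2) ^ (-s / 2)) := by
      fun_prop
    have m2 : Measurable fun t : ℝ => ENNReal.ofReal ((1 + (t + euc x) ^ 2) ^ (-s / 2)) := by
      fun_prop
    have m3 : Measurable fun t : ℝ => ENNReal.ofReal ((1 + (t - euc x) ^ 2) ^ (-s / 2)) +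
      ENNReal.ofReal ((1 + (t + euc x) ^ 2) ^ (-s / 2)) := m1.add m2
    rw [lintegral_const_mul _ m3, lintegral_add_left m1,
      lintegral_sub_right_eq_self (μ := volume) (fun t => ENNReal.ofReal ((1 + t ^ 2) ^ (-s / 2))),
      lintegral_add_right_eq_self (μ := volume) (fun t => ENNReal.ofReal ((1 + t ^ 2) ^ (-s / 2)))]
  refine (lintegral_mono hin).trans_lt ?_
  rw [lintegral_mul_const' _ _ (by simp [hAt.ne])]
  exact ENNReal.mul_lt_top hB.lintegral_lt_top (by simp [hAt])

/-- `srefl q` on `ℝⁿ` as a linear map. -/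
def sreflR (q : Fin n → ℝ) : (Fin n → ℝ) →ₗ[ℝ] (Fin n → ℝ) where
  toFun := srefl q
  map_add' x y := by
    simp only [srefl, lorB_add_left, mul_add, add_div, add_smul]; abel
  map_smul' c x := by
    simp only [srefl, lorB_smul_left, smul_sub, smul_smul, RingHom.id_apply]
    congr 2; ring

theorem lintegral_norm_lorC_eq (s : ℝ) {y : Fin n → ℝ} (hy : y ∈ cone n) :
    ∫⁻ x : Fin n → ℝ, ENNReal.ofReal (‖lorC (toC y + I • toC x)‖ ^ (-s)) =
      ENNReal.ofReal (lor y ^ ((n : ℝ) / 2 - s)) *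
      ∫⁻ x : Fin n → ℝ, ENNReal.ofReal (‖lorC (toC (tvec n ℝ) + I • toC x)‖ ^ (-s)) := by
  have hp : 0 < lor y := hy.1
  have hr : 0 < √(lor y) := Real.sqrt_pos.2 hp
  set q := midvec y with hq
  have hqq : lorB q q ≠ 0 := lorB_midvec_ne hy
  have hqC : lorB (toC q) (toC q) ≠ 0 := by rw [lorB_toC]; exact_mod_cast hqq
  have hmp : MeasurePreserving (srefl q) (volume : Measure (Fin n → ℝ)) volume :=
    measurePreserving_of_involutive volume (sreflR q) (srefl_srefl hqq)
  have hmeas : ∀ v : Fin n → ℝ, Measurable fun x : Fin n → ℝ =>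
      ENNReal.ofReal (‖lorC (toC v + I • toC x)‖ ^ (-s)) := fun v => by
    refine ENNReal.measurable_ofReal.comp (Measurable.pow_const (Continuous.measurable ?_) _)
    exact (continuous_lorC.comp (continuous_const.add (continuous_toC.const_smul I))).norm
  have hkey : ∀ x : Fin n → ℝ, ‖lorC (toC y + I • toC (√(lor y) • srefl q x))‖ ^ (-s) =
      lor y ^ (-s) * ‖lorC (toC (tvec n ℝ) + I • toC x)‖ ^ (-s) := by
    intro x
    have h1 : toC y + I • toC (√(lor y) • srefl q x) =
        (√(lor y) : ℂ) • srefl (toC q) (toC (tvec n ℝ) + I • toC x) := by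
      rw [srefl_add_smul, srefl_toC, srefl_toC]
      funext i
      have h := (congrFun (srefl_midvec_tvec hy) i).symm
      simp only [Pi.smul_apply, smul_eq_mul] at h
      simp only [← hq] at h
      have h' : (toC y i) = (√(lor y) : ℂ) * toC (srefl q (tvec n ℝ)) i := by
        simp only [toC]; exact_mod_cast h
      rw [Pi.add_apply, h']
      simp only [toC, Pi.add_apply, Pi.smul_apply, smul_eq_mul, Complex.ofReal_mul]
      ring
    rw [h1, lorC_smul, lorC_srefl hqC, ← Complex.ofReal_pow, Real.sq_sqrt hp.le, norm_mul,
      Complex.norm_real, Real.norm_of_nonneg hp.le, Real.mul_rpow hp.le (norm_nonneg _)]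
  have h2 := Measure.map_addHaar_smul (volume : Measure (Fin n → ℝ)) hr.ne'
  have h3 : ∫⁻ x : Fin n → ℝ, ENNReal.ofReal (‖lorC (toC y + I • toC (√(lor y) • x))‖ ^ (-s)) =
      ENNReal.ofReal (lor y ^ (-s)) *
      ∫⁻ x : Fin n → ℝ, ENNReal.ofReal (‖lorC (toC (tvec n ℝ) + I • toC x)‖ ^ (-s)) := by
    rw [← hmp.lintegral_comp (f := fun x : Fin n → ℝ =>
        ENNReal.ofReal (‖lorC (toC y + I • toC (√(lor y) • x))‖ ^ (-s)))
        ((hmeas y).comp (measurable_const_smul (√(lor y)))),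
      ← lintegral_const_mul _ (hmeas _)]
    refine lintegral_congr fun x => ?_
    rw [hkey, ENNReal.ofReal_mul (Real.rpow_nonneg hp.le _)]
  rw [← lintegral_map (f := fun x => ENNReal.ofReal (‖lorC (toC y + I • toC x)‖ ^ (-s)))
    (hmeas y) (measurable_const_smul (√(lor y))), h2, lintegral_smul_measure, smul_eq_mul] at h3
  have hfr : Module.finrank ℝ (Fin n → ℝ) = n := by simp
  have h4 : |(√(lor y) ^ Module.finrank ℝ (Fin n → ℝ))⁻¹| = lor y ^ (-((n : ℝ) / 2)) := by
    rw [hfr, abs_of_pos (by positivity), Real.sqrt_eq_rpow, ← Real.rpow_natCast,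
      ← Real.rpow_mul hp.le, Real.rpow_neg hp.le]
    congr 2; ring
  rw [h4] at h3
  have h5 : ENNReal.ofReal (lor y ^ ((n : ℝ) / 2)) * ENNReal.ofReal (lor y ^ (-((n : ℝ) / 2))) =
      1 := by
    rw [← ENNReal.ofReal_mul (by positivity), ← Real.rpow_add hp, add_neg_cancel, Real.rpow_zero,
      ENNReal.ofReal_one]
  rw [sub_eq_add_neg, Real.rpow_add hp, ENNReal.ofReal_mul (by positivity), mul_assoc, ← h3,
    ← mul_assoc, h5, one_mul]

end horizontal

section vertical

variable {n : ℕ} [NeZero n]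

theorem rpow_mul_one_add_rpow_le {κ μ u r : ℝ} (hr : 0 < r) (hu : r ≤ u) (hκ : -1 < κ)
    (hμ : 1 < μ - κ) :
    u ^ κ * (1 + u) ^ (-μ) ≤ r ^ min κ 0 * (1 + r) ^ (-(μ - κ + min κ 0)) := by
  have hu0 : 0 < u := hr.trans_le hu
  have hmin : -1 < min κ 0 := lt_min hκ (by norm_num)
  have h1 : u ^ (κ - min κ 0) ≤ (1 + u) ^ (κ - min κ 0) :=
    Real.rpow_le_rpow hu0.le (by linarith) (by linarith [min_le_left κ 0])
  have h2 : u ^ min κ 0 ≤ r ^ min κ 0 :=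
    Real.rpow_le_rpow_of_nonpos hr hu (min_le_right κ 0)
  have h3 : (1 + u) ^ (-(μ - κ + min κ 0)) ≤ (1 + r) ^ (-(μ - κ + min κ 0)) :=
    Real.rpow_le_rpow_of_nonpos (by linarith) (by linarith) (by linarith)
  have h4 : u ^ κ = u ^ (κ - min κ 0) * u ^ min κ 0 := by
    rw [← Real.rpow_add hu0]; congr 1; ring
  calc u ^ κ * (1 + u) ^ (-μ) ≤ ((1 + u) ^ (κ - min κ 0) * u ^ min κ 0) * (1 + u) ^ (-μ) := by
        rw [h4]; gcongr
    _ = u ^ min κ 0 * (1 + u) ^ (-(μ - κ + min κ 0)) := by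
        rw [mul_comm ((1 + u) ^ _), mul_assoc, ← Real.rpow_add (by linarith)]
        congr 2; ring
    _ ≤ _ := by gcongr

theorem lintegral_cone_lt_top (hn : 2 ≤ n) {κ μ : ℝ} (hκ : -1 < κ) (hμ : (n : ℝ) - 1 < μ - κ) :
    ∫⁻ y in cone n, ENNReal.ofReal (lor (y + tvec n ℝ) ^ (-μ) * lor y ^ κ) < ⊤ := by
  obtain ⟨k, rfl⟩ : ∃ k, n = k + 1 := ⟨n - 1, by omega⟩
  have hk' : 1 ≤ k := by omega
  have hk : (1 : ℝ) ≤ k := by exact_mod_cast hk'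
  have : NeZero k := ⟨by omega⟩
  push_cast at hμ
  have hmin : -1 < min κ 0 := lt_min hκ (by norm_num)
  have hmeas : Measurable fun y : Fin (k + 1) → ℝ =>
      ENNReal.ofReal (lor (y + tvec (k + 1) ℝ) ^ (-μ) * lor y ^ κ) := by
    refine ENNReal.measurable_ofReal.comp (Measurable.mul ?_ ?_)
    · exact (continuous_lor.comp (continuous_id.add continuous_const)).measurable.pow_const _
    · exact continuous_lor.measurable.pow_const _
  set A : ℝ≥0∞ := ∫⁻ a in Ioi (0 : ℝ), ENNReal.ofReal (a ^ κ * (1 + a) ^ (-μ)) with hA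
  have hAt : A < ⊤ := (integrableOn_rpow_mul_one_add_rpow (a := κ) (b := μ) hκ (by linarith)
    (by linarith)).lintegral_lt_top
  set g : ℝ → ℝ := fun r => r ^ min κ 0 * (1 + r) ^ (-(μ - κ + min κ 0)) with hg
  have hgi : Integrable fun x : Fin k → ℝ => g ‖x‖ := by
    rw [integrable_fun_norm_addHaar]
    have h := integrableOn_rpow_mul_one_add_rpow (a := k - 1 + min κ 0)
      (b := μ - κ + min κ 0) (by linarith) (by linarith) (by linarith)
    refine (integrableOn_congr_fun (fun t ht => ?_) measurableSet_Ioi).1 h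
    have ht' : (0 : ℝ) < t := ht
    have : Module.finrank ℝ (Fin k → ℝ) = k := by simp
    simp only [hg, this, smul_eq_mul]
    rw [Real.rpow_add ht', ← mul_assoc, ← Real.rpow_natCast t (k - 1), Nat.cast_sub hk',
      Nat.cast_one]
  rw [← lintegral_indicator isOpen_cone.measurableSet,
    lintegral_fin_cons (hmeas.indicator isOpen_cone.measurableSet)]
  have hin : ∀ᵐ x : Fin k → ℝ, ∫⁻ t : ℝ, (cone (k + 1)).indicator (fun y : Fin (k + 1) → ℝ =>
      ENNReal.ofReal (lor (y + tvec (k + 1) ℝ) ^ (-μ) * lor y ^ κ)) (Fin.cons t x) ≤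
        ENNReal.ofReal (g ‖x‖) * A := by
    filter_upwards [Measure.ae_ne volume (0 : Fin k → ℝ)] with x hx
    have hpt : ∀ t : ℝ, (cone (k + 1)).indicator (fun y : Fin (k + 1) → ℝ =>
        ENNReal.ofReal (lor (y + tvec (k + 1) ℝ) ^ (-μ) * lor y ^ κ)) (Fin.cons t x) ≤
        ENNReal.ofReal (g ‖x‖) * (Ioi (0 : ℝ)).indicator
          (fun a => ENNReal.ofReal (a ^ κ * (1 + a) ^ (-μ))) (t - euc x) := by
      intro t
      by_cases ht : (Fin.cons t x : Fin (k + 1) → ℝ) ∈ cone (k + 1)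
      · have hlt := mem_cone_cons ht
        have ha : 0 < t - euc x := by linarith
        rw [indicator_of_mem ht, indicator_of_mem (show t - euc x ∈ Ioi (0 : ℝ) from ha)]
        have hr : 0 < ‖x‖ := norm_pos_iff.2 hx
        have hu : ‖x‖ ≤ t + euc x := by linarith [norm_le_euc x, euc_nonneg x]
        have h1 := rpow_mul_one_add_rpow_le hr hu hκ (by linarith : 1 < μ - κ)
        have h0 : (Fin.cons t x : Fin (k + 1) → ℝ) 0 = t := Fin.cons_zero (α := fun _ => ℝ) t x
        have h2 : lor ((Fin.cons t x : Fin (k + 1) → ℝ) + tvec (k + 1) ℝ) =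
            (1 + (t - euc x)) * (1 + (t + euc x)) := by
          rw [lor_add, lor_cons, lorB_tvec_right, h0, lor_tvec]; ring
        have h3 : lor (Fin.cons t x : Fin (k + 1) → ℝ) = (t - euc x) * (t + euc x) := by
          rw [lor_cons]; ring
        have hu0 : 0 ≤ t + euc x := hr.le.trans hu
        rw [h2, h3, Real.mul_rpow (by linarith) (by linarith), Real.mul_rpow ha.le hu0,
          ← ENNReal.ofReal_mul (by positivity)]
        refine ENNReal.ofReal_le_ofReal ?_
        calc _ = ((t + euc x) ^ κ * (1 + (t + euc x)) ^ (-μ)) *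
            ((t - euc x) ^ κ * (1 + (t - euc x)) ^ (-μ)) := by ring
          _ ≤ _ := mul_le_mul_of_nonneg_right h1 (by positivity)
      · rw [indicator_of_notMem ht]; exact zero_le
    refine (lintegral_mono hpt).trans (le_of_eq ?_)
    have m : Measurable ((Ioi (0 : ℝ)).indicator
          (fun a => ENNReal.ofReal (a ^ κ * (1 + a) ^ (-μ)))) := by
      refine Measurable.indicator ?_ measurableSet_Ioi
      fun_prop
    rw [lintegral_const_mul' _ _ ENNReal.ofReal_ne_top, lintegral_sub_right_eq_self (μ := volume)
      ((Ioi (0 : ℝ)).indicator (fun a => ENNReal.ofReal (a ^ κ * (1 + a) ^ (-μ)))),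
      lintegral_indicator measurableSet_Ioi]
  refine (lintegral_mono_ae hin).trans_lt ?_
  rw [lintegral_mul_const' _ _ hAt.ne]
  exact ENNReal.mul_lt_top hgi.lintegral_lt_top hAt

end vertical

section schur

variable {n : ℕ} [NeZero n]

theorem norm_del_basept (x y : Fin n → ℝ) :
    ‖del (toC x + I • toC y) (basept n)‖ = ‖lorC (toC (y + tvec n ℝ) + I • toC x)‖ := by
  rw [← Complex.norm_conj (lorC _), conj_lorC, del]
  congr 2
  funext i
  have h : (basept n) i = I * toC (tvec n ℝ) i := by
    rw [basept, toC_tvec]; rfl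
  simp only [h, toC, Pi.add_apply, Pi.smul_apply, smul_eq_mul, map_add, map_mul, Complex.conj_I,
    Complex.conj_ofReal, Complex.ofReal_add]
  field_simp
  linear_combination (x i : ℂ) * Complex.I_sq

theorem measurable_norm_del_rpow (s : ℝ) (z : Fin n → ℂ) :
    Measurable fun w => ENNReal.ofReal (‖del w z‖ ^ s) := by
  refine ENNReal.measurable_ofReal.comp (Measurable.pow_const (Continuous.measurable ?_) _)
  exact (continuous_del.comp (continuous_id.prodMk continuous_const)).norm

/-- The value of the kernel integral at the base point. -/
def schurConst (n : ℕ) [NeZero n] (ν σ : ℝ) : ℝ≥0∞ :=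
  ∫⁻ w, ENNReal.ofReal (‖del w (basept n)‖ ^ (-σ)) ∂(dV n ν)

theorem schurConst_lt_top (hn : 2 ≤ n) {ν σ : ℝ} (hν : (n : ℝ) / 2 - 1 < ν)
    (hσ : ν + n - 1 < σ) : schurConst n ν σ < ⊤ := by
  have hn' : (2 : ℝ) ≤ n := by exact_mod_cast hn
  rw [schurConst, lintegral_dV, ← lintegral_indicator isOpen_tube.measurableSet,
    lintegral_re_im (f := (tube n).indicator fun z =>
      ENNReal.ofReal (lor (imP z) ^ (ν - (n : ℝ) / 2)) *
        ENNReal.ofReal (‖del z (basept n)‖ ^ (-σ))) (((measurable_ofReal_lor_rpow _).mul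
      (measurable_norm_del_rpow _ _)).indicator isOpen_tube.measurableSet)]
  set J := ∫⁻ x : Fin n → ℝ, ENNReal.ofReal (‖lorC (toC (tvec n ℝ) + I • toC x)‖ ^ (-σ)) with hJ
  have hJt : J < ⊤ := lintegral_norm_lorC_lt_top hn (by linarith)
  have hin : ∀ y : Fin n → ℝ, ∫⁻ x : Fin n → ℝ, (tube n).indicator (fun z =>
      ENNReal.ofReal (lor (imP z) ^ (ν - (n : ℝ) / 2)) *
        ENNReal.ofReal (‖del z (basept n)‖ ^ (-σ))) (toC x + I • toC y) =
      (cone n).indicator (fun y => ENNReal.ofReal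
        (lor (y + tvec n ℝ) ^ (-(σ - n / 2)) * lor y ^ (ν - (n : ℝ) / 2))) y * J := by
    intro y
    by_cases hy : y ∈ cone n
    · have hmem : ∀ x : Fin n → ℝ, toC x + I • toC y ∈ tube n := fun x => by
        show imP _ ∈ cone n
        rwa [imP_toC_add_I_smul]
      rw [indicator_of_mem hy]
      simp only [indicator_of_mem (hmem _), imP_toC_add_I_smul, norm_del_basept]
      rw [lintegral_const_mul' _ _ ENNReal.ofReal_ne_top,
        lintegral_norm_lorC_eq σ (add_mem_cone hy tvec_mem_cone), ← hJ, ← mul_assoc,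
        ENNReal.ofReal_mul' (Real.rpow_nonneg hy.1.le _), neg_sub, mul_comm (ENNReal.ofReal _)]
    · have hmem : ∀ x : Fin n → ℝ, toC x + I • toC y ∉ tube n := fun x h => hy (by
        have h' : imP (toC x + I • toC y) ∈ cone n := h
        rwa [imP_toC_add_I_smul] at h')
      rw [indicator_of_notMem hy]
      simp only [indicator_of_notMem (hmem _)]
      simp
  simp only [hin]
  rw [lintegral_mul_const' _ _ hJt.ne, lintegral_indicator isOpen_cone.measurableSet]
  exact ENNReal.mul_lt_top (lintegral_cone_lt_top hn (by linarith) (by linarith)) hJt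

theorem lintegral_norm_del_rpow {z : Fin n → ℂ} (hz : z ∈ tube n) (ν σ : ℝ) :
    ∫⁻ w, ENNReal.ofReal (‖del w z‖ ^ (-σ)) ∂(dV n ν) =
      ENNReal.ofReal (lor (imP z) ^ (ν + n / 2 - σ)) * schurConst n ν σ := by
  have hp := lor_imP_pos hz
  have hm := measurable_norm_del_rpow (-σ) z
  have h1 : ∀ w, ENNReal.ofReal (‖del (tubeEquiv z hz w) z‖ ^ (-σ)) =
      ENNReal.ofReal (lor (imP z) ^ (-σ)) * ENNReal.ofReal (‖del w (basept n)‖ ^ (-σ)) := by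
    intro w
    have h := del_tubeEquiv hz w (basept n)
    rw [tubeEquiv_basept] at h
    rw [h, norm_mul, Complex.norm_real, Real.norm_of_nonneg hp.le,
      Real.mul_rpow hp.le (norm_nonneg _), ENNReal.ofReal_mul (Real.rpow_nonneg hp.le _)]
  have h2 := lintegral_map (μ := dV n ν) hm (tubeEquiv z hz).continuous.measurable
  rw [map_tubeEquiv_dV, lintegral_smul_measure, smul_eq_mul, lintegral_congr h1,
    lintegral_const_mul' _ _ ENNReal.ofReal_ne_top] at h2
  have h5 : ENNReal.ofReal (lor (imP z) ^ (ν + (n : ℝ) / 2)) *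
      ENNReal.ofReal (lor (imP z) ^ (-(ν + (n : ℝ) / 2))) = 1 := by
    rw [← ENNReal.ofReal_mul (by positivity), ← Real.rpow_add hp, add_neg_cancel, Real.rpow_zero,
      ENNReal.ofReal_one]
  rw [sub_eq_add_neg, Real.rpow_add hp, ENNReal.ofReal_mul (by positivity), mul_assoc, schurConst,
    ← h2, ← mul_assoc, h5, one_mul]

theorem integrable_bker (hn : 2 ≤ n) {ν σ : ℝ} (hν : (n : ℝ) / 2 - 1 < ν) (hσ : ν + n - 1 < σ)
    {z : Fin n → ℂ} (hz : z ∈ tube n) : Integrable (fun w => bker σ w z) (dV n ν) := by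
  refine ⟨(measurable_bker_left σ z).aestronglyMeasurable, ?_⟩
  rw [hasFiniteIntegral_iff_norm]
  simp only [norm_bker]
  rw [lintegral_norm_del_rpow hz]
  exact ENNReal.mul_lt_top ENNReal.ofReal_lt_top (schurConst_lt_top hn hν hσ)

theorem integral_norm_bker (hn : 2 ≤ n) {ν σ : ℝ} (hν : (n : ℝ) / 2 - 1 < ν)
    (hσ : ν + n - 1 < σ) {z : Fin n → ℂ} (hz : z ∈ tube n) :
    ∫ w, ‖bker σ w z‖ ∂(dV n ν) =
      lor (imP z) ^ (ν + n / 2 - σ) * (schurConst n ν σ).toReal := by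
  rw [integral_norm_eq_lintegral_enorm (integrable_bker hn hν hσ hz).1]
  simp only [← ofReal_norm, norm_bker]
  rw [lintegral_norm_del_rpow hz, ENNReal.toReal_mul,
    ENNReal.toReal_ofReal (Real.rpow_nonneg (lor_imP_pos hz).le _)]

end schur

section pairing

variable {n : ℕ} [NeZero n]

theorem memA_one_iff {ν : ℝ} {F : (Fin n → ℂ) → ℂ} :
    memA n 1 ν F ↔ DifferentiableOn ℂ F (tube n) ∧ Integrable F (dV n ν) := by
  refine and_congr_right fun hF => ?_
  have hm : AEStronglyMeasurable F (dV n ν) := hF.continuousOn.aestronglyMeasurable_dV ν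
  simp only [lpInt, Real.rpow_one]
  rw [← hasFiniteIntegral_iff_norm]
  exact ⟨fun h => ⟨hm, h⟩, fun h => h.2⟩

theorem lpNorm_one_toReal {ν : ℝ} {F : (Fin n → ℂ) → ℂ}
    (hF : AEStronglyMeasurable F (dV n ν)) :
    (lpNorm n 1 ν F).toReal = ∫ z, ‖F z‖ ∂(dV n ν) := by
  simp only [_root_.lpNorm, lpInt, Real.rpow_one, div_one, ENNReal.rpow_one]
  rw [integral_norm_eq_lintegral_enorm hF]
  simp only [← ofReal_norm]

theorem norm_pairing_le {H : (Fin n → ℂ) → ℂ} {m : ℕ} {M : ℝ}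
    (hM : ∀ z ∈ tube n, lor (imP z) ^ m * ‖H z‖ ≤ M) (F : (Fin n → ℂ) → ℂ) {z : Fin n → ℂ}
    (hz : z ∈ tube n) :
    ‖F z * (starRingEnd ℂ) (H z) * ((lor (imP z) : ℂ)) ^ m‖ ≤ M * ‖F z‖ := by
  have hp := lor_imP_pos hz
  rw [norm_mul, norm_mul, Complex.norm_conj, norm_pow, Complex.norm_real,
    Real.norm_of_nonneg hp.le]
  calc ‖F z‖ * ‖H z‖ * lor (imP z) ^ m = (lor (imP z) ^ m * ‖H z‖) * ‖F z‖ := by ring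
    _ ≤ M * ‖F z‖ := mul_le_mul_of_nonneg_right (hM z hz) (norm_nonneg _)

theorem integrable_pairing {H : (Fin n → ℂ) → ℂ} {m : ℕ} {M : ℝ}
    (hH : DifferentiableOn ℂ H (tube n))
    (hM : ∀ z ∈ tube n, lor (imP z) ^ m * ‖H z‖ ≤ M) {ν : ℝ} {F : (Fin n → ℂ) → ℂ}
    (hF : Integrable F (dV n ν)) :
    Integrable (fun z => F z * (starRingEnd ℂ) (H z) * ((lor (imP z) : ℂ)) ^ m) (dV n ν) := by
  refine Integrable.mono' (hF.norm.const_mul M) ?_ ?_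
  · refine (hF.1.mul ?_).mul ?_
    · exact Complex.continuous_conj.comp_aestronglyMeasurable
        (hH.continuousOn.aestronglyMeasurable_dV ν)
    · refine Continuous.aestronglyMeasurable ?_
      exact (Complex.continuous_ofReal.comp (continuous_lor.comp continuous_imP)).pow m
  · filter_upwards [ae_dV_mem_tube ν] with z hz
    exact norm_pairing_le hM F hz

theorem norm_integral_pairing_le {H : (Fin n → ℂ) → ℂ} {m : ℕ} {M : ℝ}
    (hM : ∀ z ∈ tube n, lor (imP z) ^ m * ‖H z‖ ≤ M) {ν : ℝ} {F : (Fin n → ℂ) → ℂ}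
    (hF : Integrable F (dV n ν)) :
    ‖∫ z, F z * (starRingEnd ℂ) (H z) * ((lor (imP z) : ℂ)) ^ m ∂(dV n ν)‖ ≤
      M * (lpNorm n 1 ν F).toReal := by
  rw [lpNorm_one_toReal hF.1, ← integral_const_mul]
  refine norm_integral_le_of_norm_le (hF.norm.const_mul M) ?_
  filter_upwards [ae_dV_mem_tube ν] with z hz
  exact norm_pairing_le hM F hz

theorem dV_ne_zero (ν : ℝ) : dV n ν ≠ 0 := by
  intro h
  have h1 : ∀ᵐ z ∂(volume.restrict (tube n)),
      ENNReal.ofReal (lor (imP z) ^ (ν - (n : ℝ) / 2)) = 0 :=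
    (withDensity_eq_zero_iff (measurable_ofReal_lor_rpow _).aemeasurable).1 h
  have h2 : ∀ᵐ z ∂(volume.restrict (tube n)), False := by
    filter_upwards [h1, ae_restrict_mem isOpen_tube.measurableSet] with z hz hzt
    rw [ENNReal.ofReal_eq_zero] at hz
    exact absurd (Real.rpow_pos_of_pos (lor_imP_pos hzt) _) (not_lt.2 hz)
  rw [Filter.eventually_false_iff_eq_bot, ae_eq_bot, Measure.restrict_eq_zero] at h2
  exact (isOpen_tube.measure_pos volume ⟨_, basept_mem⟩).ne' h2

theorem reproConst_ne_zero (hn : 2 ≤ n) {β : ℝ} (hβ : (n : ℝ) / 2 - 1 < β) :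
    reproConst n β ≠ 0 := by
  intro hzero
  have hn' : (2 : ℝ) ≤ n := by exact_mod_cast hn
  set s : ℝ := β + n / 2 with hs
  have hsq : ∀ w, ‖bker s w (basept n)‖ ^ 2 = ‖bker (2 * s) w (basept n)‖ := by
    intro w
    rw [norm_bker, norm_bker, ← Real.rpow_natCast, ← Real.rpow_mul (norm_nonneg _)]
    congr 1; push_cast; ring
  have hi := (integrable_bker hn hβ (σ := 2 * s) (by rw [hs]; linarith) basept_mem).norm
  have heq : ∀ᵐ w ∂(dV n β), ((‖bker (2 * s) w (basept n)‖ : ℝ) : ℂ) =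
      bker s w (basept n) * bker s (basept n) w := by
    filter_upwards [ae_dV_mem_tube β] with w hw
    rw [← hsq, ← conj_bker s hw basept_mem, Complex.mul_conj, Complex.normSq_eq_norm_sq]
  have hr := reproducing (differentiableOn_bker s basept_mem) basept_mem (hi.ofReal.congr heq)
  rw [hzero, zero_mul, ← integral_congr_ae heq, integral_complex_ofReal, Complex.ofReal_eq_zero,
    integral_eq_zero_iff_of_nonneg (fun _ => norm_nonneg _) hi] at hr
  have h2 : ∀ᵐ z ∂(dV n β), False := by
    filter_upwards [hr, ae_dV_mem_tube β] with z hz hzt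
    exact bker_ne_zero (2 * s) hzt basept_mem (norm_eq_zero.1 hz)
  rw [Filter.eventually_false_iff_eq_bot, ae_eq_bot] at h2
  exact dV_ne_zero β h2

theorem memA_bker (hn : 2 ≤ n) {ν σ : ℝ} (hν : (n : ℝ) / 2 - 1 < ν) (hσ : ν + n - 1 < σ)
    {z : Fin n → ℂ} (hz : z ∈ tube n) : memA n 1 ν (fun w => bker σ w z) :=
  memA_one_iff.2 ⟨differentiableOn_bker σ hz, integrable_bker hn hν hσ hz⟩

theorem integral_pairing_bker (hn : 2 ≤ n) {ν : ℝ} {m : ℕ} (hν : (n : ℝ) / 2 - 1 < ν)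
    (hm : (n : ℝ) / 2 - 1 < (m : ℝ)) {H : (Fin n → ℂ) → ℂ} {M : ℝ}
    (hH : DifferentiableOn ℂ H (tube n))
    (hM : ∀ z ∈ tube n, lor (imP z) ^ m * ‖H z‖ ≤ M) {z : Fin n → ℂ} (hz : z ∈ tube n) :
    ∫ w, bker (ν + m + n / 2) w z * (starRingEnd ℂ) (H w) * ((lor (imP w) : ℂ)) ^ m ∂(dV n ν) =
      (starRingEnd ℂ) (reproConst n (ν + m) * H z) := by
  have hi := integrable_pairing hH hM
    (integrable_bker hn hν (σ := ν + m + n / 2) (by linarith) hz)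
  have heq : ∀ᵐ w ∂(dV n ν), bker (ν + m + n / 2) w z * (starRingEnd ℂ) (H w) *
      ((lor (imP w) : ℂ)) ^ m = ((lor (imP w) ^ (m : ℝ) : ℝ) : ℂ) *
        (starRingEnd ℂ) (H w * bker (ν + m + n / 2) z w) := by
    filter_upwards [ae_dV_mem_tube ν] with w hw
    rw [map_mul, conj_bker _ hz hw, Real.rpow_natCast]
    push_cast; ring
  have hi2 := (integrable_dV_add_iff ν m _).2 (hi.congr heq)
  have hi3 : Integrable (fun w => H w * bker (ν + m + n / 2) z w) (dV n (ν + m)) := by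
    have := Complex.conjCLE.integrable_comp_iff.1 hi2
    exact this
  rw [integral_congr_ae heq, ← integral_dV_add, integral_conj, reproducing hH hz hi3]

theorem eqOn_of_integral_pairing_eq (hn : 2 ≤ n) {ν : ℝ} {m : ℕ} (hν : (n : ℝ) / 2 - 1 < ν)
    (hm : (n : ℝ) / 2 - 1 < (m : ℝ)) {H₁ H₂ : (Fin n → ℂ) → ℂ} {M₁ M₂ : ℝ}
    (hH₁ : DifferentiableOn ℂ H₁ (tube n))
    (hM₁ : ∀ z ∈ tube n, lor (imP z) ^ m * ‖H₁ z‖ ≤ M₁)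
    (hH₂ : DifferentiableOn ℂ H₂ (tube n))
    (hM₂ : ∀ z ∈ tube n, lor (imP z) ^ m * ‖H₂ z‖ ≤ M₂)
    (h : ∀ F, memA n 1 ν F →
      ∫ z, F z * (starRingEnd ℂ) (H₁ z) * ((lor (imP z) : ℂ)) ^ m ∂(dV n ν) =
        ∫ z, F z * (starRingEnd ℂ) (H₂ z) * ((lor (imP z) : ℂ)) ^ m ∂(dV n ν)) :
    EqOn H₁ H₂ (tube n) := by
  intro z hz
  have hn' : (2 : ℝ) ≤ n := by exact_mod_cast hn
  have h1 := h _ (memA_bker hn hν (σ := ν + m + n / 2) (by linarith) hz)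
  rw [integral_pairing_bker hn hν hm hH₁ hM₁ hz, integral_pairing_bker hn hν hm hH₂ hM₂ hz] at h1
  exact mul_left_cancel₀ (reproConst_ne_zero hn (by linarith)) ((starRingEnd ℂ).injective h1)

end pairing

section duality

variable {α : Type*} {mα : MeasurableSpace α} {μ : Measure α}

theorem exists_weight_memLp_two [SigmaFinite μ] :
    ∃ w : α → ℝ, Measurable w ∧ (∀ x, 0 < w x) ∧ MemLp (fun x => (w x : ℂ)) 2 μ := by
  obtain ⟨g, hg0, hgm, hgi⟩ := exists_pos_lintegral_lt_of_sigmaFinite μ one_ne_zero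
  have hm : Measurable fun x => Real.sqrt (g x) := (measurable_coe_nnreal_real.comp hgm).sqrt
  refine ⟨fun x => Real.sqrt (g x), hm, fun x => Real.sqrt_pos.2 (hg0 x), ?_⟩
  refine (memLp_two_iff_integrable_sq_norm
    (Complex.measurable_ofReal.comp hm).aestronglyMeasurable).2 ?_
  refine ⟨?_, ?_⟩
  · exact ((Complex.measurable_ofReal.comp hm).norm.pow_const 2).aestronglyMeasurable
  · rw [hasFiniteIntegral_iff_ofReal (Filter.Eventually.of_forall fun _ => by positivity)]
    refine lt_of_eq_of_lt (lintegral_congr fun x => ?_) (hgi.trans ENNReal.one_lt_top)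
    rw [Function.comp_apply, Complex.norm_real, Real.norm_of_nonneg (Real.sqrt_nonneg _),
      Real.sq_sqrt (NNReal.coe_nonneg _), ENNReal.ofReal_coe_nnreal]

theorem exists_L2_density (φ : (α →₁[μ] ℂ) →L[ℂ] ℂ) {w : α → ℝ}
    (hw : MemLp (fun x => (w x : ℂ)) 2 μ) :
    ∃ h : α → ℂ, MemLp h 2 μ ∧ ∀ f : α → ℂ, MemLp f 2 μ →
      ∀ hi : Integrable (fun x => (w x : ℂ) * f x) μ,
        φ hi.toL1 = ∫ x, (starRingEnd ℂ) (h x) * f x ∂μ := by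
  set T : (α →₂[μ] ℂ) →L[ℂ] (α →₁[μ] ℂ) :=
    (ContinuousLinearMap.mul ℂ ℂ).holderL μ 2 2 1 hw.toLp with hT
  set h := (InnerProductSpace.toDual ℂ (α →₂[μ] ℂ)).symm (φ.comp T) with hh
  refine ⟨h, Lp.memLp h, fun f hf hi => ?_⟩
  have h1 : inner ℂ h hf.toLp = φ (T hf.toLp) := by
    rw [hh, InnerProductSpace.toDual_symm_apply]; rfl
  have h2 : T hf.toLp = hi.toL1 := by
    apply Lp.ext
    refine ((ContinuousLinearMap.mul ℂ ℂ).coeFn_holder (r := 1) hw.toLp hf.toLp).trans ?_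
    refine Filter.EventuallyEq.trans ?_ hi.coeFn_toL1.symm
    filter_upwards [hw.coeFn_toLp, hf.coeFn_toLp] with x h1 h2
    simp [h1, h2]
  rw [← h2, ← h1, L2.inner_def]
  refine integral_congr_ae ?_
  filter_upwards [hf.coeFn_toLp] with x hx
  rw [hx, RCLike.inner_apply, mul_comm]

theorem norm_density_le {φ : (α →₁[μ] ℂ) →L[ℂ] ℂ} {w : α → ℝ}
    (hw0 : ∀ x, 0 < w x) (hw : MemLp (fun x => (w x : ℂ)) 2 μ) {h : α → ℂ} (hh : MemLp h 2 μ)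
    (hφ : ∀ f : α → ℂ, MemLp f 2 μ → ∀ hi : Integrable (fun x => (w x : ℂ) * f x) μ,
        φ hi.toL1 = ∫ x, (starRingEnd ℂ) (h x) * f x ∂μ) :
    ∀ᵐ x ∂μ, ‖h x‖ ≤ ‖φ‖ * w x := by
  have hhw : Integrable (fun x => ‖h x‖ * w x) μ := by
    have := (hh.norm.integrable_mul (p := 2) (q := 2) hw.norm)
    refine this.congr (Filter.Eventually.of_forall fun x => ?_)
    simp [abs_of_pos (hw0 x)]
  have hww : Integrable (fun x => ‖φ‖ * (w x * w x)) μ := by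
    have := ((hw.norm.integrable_mul (p := 2) (q := 2) hw.norm)).const_mul ‖φ‖
    refine this.congr (Filter.Eventually.of_forall fun x => ?_)
    simp
  have key : (fun x => ‖h x‖ * w x) ≤ᵐ[μ] fun x => ‖φ‖ * (w x * w x) := by
    refine ae_le_of_forall_setIntegral_le hhw hww fun s hs _ => ?_
    set u : α → ℂ := fun x => h x / ‖h x‖ with hu
    have hum : AEStronglyMeasurable u μ :=
      (hh.1.aemeasurable.div (Complex.measurable_ofReal.comp_aemeasurable
        hh.1.norm.aemeasurable)).aestronglyMeasurable
    have hu1 : ∀ x, ‖u x‖ ≤ 1 := fun x => by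
      simp only [hu, norm_div, Complex.norm_real, norm_norm]; exact div_self_le_one _
    set f : α → ℂ := s.indicator fun x => u x * w x with hf
    have hfm : MemLp f 2 μ := by
      refine MemLp.indicator hs (hw.of_le (hum.mul hw.1) (Filter.Eventually.of_forall fun x => ?_))
      rw [norm_mul]
      exact mul_le_of_le_one_left (norm_nonneg _) (hu1 x)
    have hi : Integrable (fun x => (w x : ℂ) * f x) μ :=
      hw.integrable_mul (p := 2) (q := 2) hfm
    have h1 := hφ f hfm hi
    have h2 : ∫ x, (starRingEnd ℂ) (h x) * f x ∂μ = ((∫ x in s, ‖h x‖ * w x ∂μ : ℝ) : ℂ) := by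
      rw [← integral_indicator hs, ← integral_complex_ofReal]
      refine integral_congr_ae (Filter.Eventually.of_forall fun x => ?_)
      by_cases hx : x ∈ s
      · simp only [hf, hx, indicator_of_mem, hu]
        by_cases hc : h x = 0
        · simp [hc]
        · have : (‖h x‖ : ℂ) ≠ 0 := by simpa using hc
          have h3 := Complex.mul_conj (h x)
          rw [Complex.normSq_eq_norm_sq] at h3
          push_cast at h3 ⊢
          field_simp
          rw [mul_comm _ (h x), h3, mul_comm]
      · simp [hf, hx]
    have h4 : ‖hi.toL1‖ ≤ ∫ x in s, w x * w x ∂μ := by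
      rw [L1.norm_of_fun_eq_integral_norm, ← integral_indicator hs]
      refine integral_mono hi.norm ?_ fun x => ?_
      · refine Integrable.indicator ?_ hs
        have := (hw.norm.integrable_mul (p := 2) (q := 2) hw.norm)
        refine this.congr (Filter.Eventually.of_forall fun x => ?_)
        simp
      · by_cases hx : x ∈ s
        · simp only [hf, hx, indicator_of_mem, norm_mul, Complex.norm_real, Real.norm_eq_abs,
            abs_of_pos (hw0 x)]
          have := mul_le_mul_of_nonneg_right (hu1 x) (mul_self_nonneg (w x))
          linarith
        · simp [hf, hx]
    have h5 : ‖φ hi.toL1‖ = ∫ x in s, ‖h x‖ * w x ∂μ := by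
      rw [h1, h2, Complex.norm_real, Real.norm_of_nonneg]
      exact integral_nonneg fun x => mul_nonneg (norm_nonneg _) (hw0 x).le
    rw [← h5, integral_const_mul]
    exact (φ.le_opNorm _).trans (mul_le_mul_of_nonneg_left h4 (norm_nonneg _))
  filter_upwards [key] with x hx
  have hx' : ‖h x‖ * w x ≤ ‖φ‖ * w x * w x := by rw [mul_assoc]; exact hx
  exact le_of_mul_le_mul_right hx' (hw0 x)

/-- A bounded functional on `L¹` of a σ-finite measure is integration against a bounded
function. -/
theorem exists_bounded_density [SigmaFinite μ] (φ : (α →₁[μ] ℂ) →L[ℂ] ℂ) :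
    ∃ g : α → ℂ, AEStronglyMeasurable g μ ∧ (∀ᵐ x ∂μ, ‖g x‖ ≤ ‖φ‖) ∧
      ∀ (f : α → ℂ) (hf : Integrable f μ), φ hf.toL1 = ∫ x, f x * g x ∂μ := by
  obtain ⟨w, hwm, hw0, hw⟩ := exists_weight_memLp_two (μ := μ)
  obtain ⟨h, hh, hφ⟩ := exists_L2_density φ hw
  have hb := norm_density_le hw0 hw hh hφ
  have hwc : Measurable fun x => (w x : ℂ) := Complex.measurable_ofReal.comp hwm
  set g : α → ℂ := fun x => (starRingEnd ℂ) (h x) / w x with hg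
  have hgm : AEStronglyMeasurable g μ :=
    ((Complex.continuous_conj.measurable.comp_aemeasurable hh.1.aemeasurable).div
      hwc.aemeasurable).aestronglyMeasurable
  have hgb : ∀ᵐ x ∂μ, ‖g x‖ ≤ ‖φ‖ := by
    filter_upwards [hb] with x hx
    simp only [hg, norm_div, Complex.norm_conj, Complex.norm_real, Real.norm_eq_abs,
      abs_of_pos (hw0 x)]
    rwa [div_le_iff₀ (hw0 x)]
  refine ⟨g, hgm, hgb, ?_⟩
  have hmeas : ∀ (f : α → ℂ), StronglyMeasurable f → ∀ hf : Integrable f μ,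
      φ hf.toL1 = ∫ x, f x * g x ∂μ := by
    intro f hfs hf
    set s : ℕ → Set α := fun k => {x | ‖f x‖ ≤ k * (w x * w x)} with hs
    have hsm : ∀ k, MeasurableSet (s k) := fun k =>
      measurableSet_le hfs.measurable.norm ((hwm.mul hwm).const_mul _)
    have hfi : ∀ k, Integrable ((s k).indicator f) μ := fun k => hf.indicator (hsm k)
    have hk : ∀ k, φ (hfi k).toL1 = ∫ x, (s k).indicator f x * g x ∂μ := by
      intro k
      have hm2 : MemLp (fun x => (s k).indicator f x / w x) 2 μ := by
        refine (hw.const_mul (k : ℂ)).of_le ?_ (Filter.Eventually.of_forall fun x => ?_)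
        · exact ((hfs.measurable.indicator (hsm k)).div hwc).aestronglyMeasurable
        · rw [norm_div, norm_mul, Complex.norm_real, Real.norm_of_nonneg (hw0 x).le,
            Complex.norm_natCast, div_le_iff₀ (hw0 x)]
          by_cases hx : x ∈ s k
          · rw [indicator_of_mem hx, mul_assoc]; exact hx
          · rw [indicator_of_notMem hx, norm_zero]
            exact mul_nonneg (mul_nonneg k.cast_nonneg (hw0 x).le) (hw0 x).le
      have hne : ∀ x, (w x : ℂ) ≠ 0 := fun x => by exact_mod_cast (hw0 x).ne'
      have he : (fun x => (w x : ℂ) * ((s k).indicator f x / w x)) = (s k).indicator f := by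
        funext x; rw [mul_div_cancel₀ _ (hne x)]
      have hi : Integrable (fun x => (w x : ℂ) * ((s k).indicator f x / w x)) μ := by
        rw [he]; exact hfi k
      have h1 := hφ _ hm2 hi
      have h2 : hi.toL1 = (hfi k).toL1 :=
        (Integrable.toL1_eq_toL1_iff _ _ hi (hfi k)).2 (by rw [he])
      rw [← h2, h1]
      refine integral_congr_ae (Filter.Eventually.of_forall fun x => ?_)
      simp only [hg]; ring
    have hev : ∀ x, ∀ᶠ k : ℕ in Filter.atTop, (s k).indicator f x = f x := by
      intro x
      obtain ⟨N, hN⟩ := exists_nat_ge (‖f x‖ / (w x * w x))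
      filter_upwards [Filter.eventually_ge_atTop N] with k hkN
      refine indicator_of_mem ?_ f
      have hp := mul_pos (hw0 x) (hw0 x)
      rw [div_le_iff₀ hp] at hN
      exact hN.trans (mul_le_mul_of_nonneg_right (by exact_mod_cast hkN) hp.le)
    have hle : ∀ k x, ‖(s k).indicator f x‖ ≤ ‖f x‖ := fun k x => norm_indicator_le_norm_self f x
    have t1 : Filter.Tendsto (fun k => φ (hfi k).toL1) Filter.atTop (nhds (φ hf.toL1)) := by
      refine (φ.continuous.tendsto _).comp ?_
      rw [tendsto_iff_norm_sub_tendsto_zero]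
      have : ∀ k, ‖(hfi k).toL1 - hf.toL1‖ = ∫ x, ‖(s k).indicator f x - f x‖ ∂μ := by
        intro k
        rw [← Integrable.toL1_sub, L1.norm_of_fun_eq_integral_norm]; rfl
      simp only [this]
      have hz : ∫ x, (0 : ℝ) ∂μ = 0 := by simp
      rw [← hz]
      refine tendsto_integral_of_dominated_convergence (fun x => ‖f x‖ + ‖f x‖)
        (fun k => ((hfi k).sub hf).1.norm) (hf.norm.add hf.norm) ?_ ?_
      · refine fun k => Filter.Eventually.of_forall fun x => ?_
        rw [norm_norm]
        exact (norm_sub_le _ _).trans (add_le_add (hle k x) le_rfl)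
      · refine Filter.Eventually.of_forall fun x => tendsto_const_nhds.congr' ?_
        filter_upwards [hev x] with k hk
        rw [hk, sub_self, norm_zero]
    have t2 : Filter.Tendsto (fun k => φ (hfi k).toL1) Filter.atTop
        (nhds (∫ x, f x * g x ∂μ)) := by
      simp only [hk]
      refine tendsto_integral_of_dominated_convergence (fun x => ‖f x‖ * ‖φ‖)
        (fun k => (hfi k).1.mul hgm) (hf.norm.mul_const _) ?_ ?_
      · intro k
        filter_upwards [hgb] with x hx
        rw [norm_mul]
        exact mul_le_mul (hle k x) hx (norm_nonneg _) (norm_nonneg _)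
      · refine Filter.Eventually.of_forall fun x => tendsto_const_nhds.congr' ?_
        filter_upwards [hev x] with k hk
        rw [hk]
    exact tendsto_nhds_unique t1 t2
  intro f hf
  have hae := hf.1.ae_eq_mk
  have hf' : Integrable (hf.1.mk f) μ := hf.congr hae
  rw [(Integrable.toL1_eq_toL1_iff _ _ hf hf').2 hae, hmeas _ hf.1.stronglyMeasurable_mk hf']
  refine integral_congr_ae ?_
  filter_upwards [hae] with x hx
  rw [hx]

end duality

section representation

variable {n : ℕ} [NeZero n]

/-- Locally uniformly in `z`, the modulus of `del z w` is bounded below by that of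
`del z₀ w`. -/
theorem exists_ball_norm_del_le {z₀ : Fin n → ℂ} (hz₀ : z₀ ∈ tube n) :
    ∃ r : ℝ, 0 < r ∧ Metric.ball z₀ r ⊆ tube n ∧ ∃ c : ℝ, 0 < c ∧
      ∀ z ∈ Metric.ball z₀ r, ∀ w ∈ tube n, ‖del z₀ w‖ ≤ c * ‖del z w‖ := by
  obtain ⟨ε, hε, hmem⟩ := exists_sub_smul_tvec_mem_cone hz₀
  have hc : Continuous fun z : Fin n → ℂ => imP z - ε • tvec n ℝ :=
    continuous_imP.sub continuous_const
  have hev : ∀ᶠ z in nhds z₀, imP z - ε • tvec n ℝ ∈ cone n ∧ z ∈ tube n :=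
    (hc.continuousAt.eventually (isOpen_cone.mem_nhds hmem)).and (isOpen_tube.mem_nhds hz₀)
  obtain ⟨r, hr, hball⟩ := Metric.eventually_nhds_iff_ball.1 hev
  refine ⟨r, hr, fun z hz => (hball z hz).2,
    1 + 4 * (n + 2) * (r / ε) + (n + 2) * (r / ε) ^ 2, by positivity, fun z hz w hw => ?_⟩
  refine (norm_del_le hε (hball z hz).1 hw).trans ?_
  have h1 : ‖z₀ - z‖ ≤ r := by
    rw [← dist_eq_norm, dist_comm]; exact (Metric.mem_ball.1 hz).le
  gcongr

theorem exists_ball_norm_bker_le {z₀ : Fin n → ℂ} (hz₀ : z₀ ∈ tube n) {s : ℝ} (hs : 0 ≤ s) :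
    ∃ r : ℝ, 0 < r ∧ Metric.ball z₀ r ⊆ tube n ∧ ∃ c : ℝ, 0 < c ∧
      ∀ z ∈ Metric.ball z₀ r, ∀ w ∈ tube n, ‖bker s z w‖ ≤ c * ‖bker s z₀ w‖ := by
  obtain ⟨r, hr, hsub, c, hc, h⟩ := exists_ball_norm_del_le hz₀
  refine ⟨r, hr, hsub, c ^ s, by positivity, fun z hz w hw => ?_⟩
  have h0 := norm_del_pos hz₀ hw
  have h1 := norm_del_pos (hsub hz) hw
  rw [norm_bker, norm_bker, Real.rpow_neg h0.le, Real.rpow_neg h1.le, ← div_eq_mul_inv,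
    le_div_iff₀ (by positivity), inv_mul_le_iff₀ (by positivity), mul_comm,
    ← Real.mul_rpow hc.le h1.le]
  exact Real.rpow_le_rpow h0.le (h z hz w hw) hs

theorem differentiableOn_integral_bker {μ : Measure (Fin n → ℂ)} (hμ : ∀ᵐ w ∂μ, w ∈ tube n)
    {s : ℝ} (hs : 0 ≤ s) {f : (Fin n → ℂ) → ℂ} (hf : AEStronglyMeasurable f μ)
    (hi : ∀ z ∈ tube n, Integrable (fun w => f w * bker s z w) μ) :
    DifferentiableOn ℂ (fun z => ∫ w, f w * bker s z w ∂μ) (tube n) := by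
  intro z₀ hz₀
  obtain ⟨r, hr, hsub, c, hc, h⟩ := exists_ball_norm_bker_le hz₀ hs
  refine (hasFDerivAt_integral_of_ball (K := fun z w => f w * bker s z w)
    (b := fun w => c * ‖f w * bker s z₀ w‖) hr ?_ ?_ ?_
    ((hi z₀ hz₀).norm.const_mul c)).2.differentiableAt.differentiableWithinAt
  · filter_upwards [hμ] with w hw
    exact ((differentiableOn_bker s hw).mono hsub).const_mul _
  · exact fun z _ => hf.mul (measurable_bker_right s z).aestronglyMeasurable
  · filter_upwards [hμ] with w hw z hz
    rw [norm_mul, norm_mul]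
    have := mul_le_mul_of_nonneg_left (h z hz w hw) (norm_nonneg (f w))
    linarith

theorem exists_density_of_functional {ν Cγ : ℝ} {γ : ((Fin n → ℂ) → ℂ) → ℂ}
    (hγ : isBddFunc n 1 ν γ) (hC0 : 0 ≤ Cγ)
    (hC : ∀ F, memA n 1 ν F → ‖γ F‖ ≤ Cγ * (lpNorm n 1 ν F).toReal) :
    ∃ g : (Fin n → ℂ) → ℂ, AEStronglyMeasurable g (dV n ν) ∧ (∀ᵐ z ∂(dV n ν), ‖g z‖ ≤ Cγ) ∧
      ∀ F, memA n 1 ν F → γ F = ∫ z, F z * g z ∂(dV n ν) := by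
  have hadd : ∀ F G, memA n 1 ν F → memA n 1 ν G → memA n 1 ν (F + G) := by
    intro F G hF hG
    rw [memA_one_iff] at hF hG ⊢
    exact ⟨hF.1.add hG.1, hF.2.add hG.2⟩
  have hsmul : ∀ (c : ℂ) F, memA n 1 ν F → memA n 1 ν (fun z => c * F z) := by
    intro c F hF
    rw [memA_one_iff] at hF ⊢
    exact ⟨hF.1.const_mul c, hF.2.const_mul c⟩
  have hcongr : ∀ F G, memA n 1 ν F → memA n 1 ν G → F =ᵐ[dV n ν] G → γ F = γ G := by
    intro F G hF hG h
    have h1 := hC _ (hadd _ _ hF (hsmul (-1) G hG))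
    rw [hγ.1 _ _ hF (hsmul (-1) G hG), hγ.2.1 _ _ hG, lpNorm_one_toReal
      (memA_one_iff.1 (hadd _ _ hF (hsmul (-1) G hG))).2.1] at h1
    have h2 : ∫ z, ‖(F + fun z => -1 * G z) z‖ ∂(dV n ν) = 0 := by
      rw [← integral_zero (Fin n → ℂ) ℝ (μ := dV n ν)]
      refine integral_congr_ae ?_
      filter_upwards [h] with z hz
      simp [hz]
    rw [h2, mul_zero] at h1
    have h3 := norm_le_zero_iff.1 h1
    linear_combination h3
  set p : Submodule ℂ ((Fin n → ℂ) →₁[dV n ν] ℂ) :=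
    { carrier := {f | ∃ F, memA n 1 ν F ∧ f =ᵐ[dV n ν] F}
      add_mem' := by
        rintro f g ⟨F, hF, hf⟩ ⟨G, hG, hg⟩
        exact ⟨F + G, hadd _ _ hF hG, (Lp.coeFn_add f g).trans (hf.add hg)⟩
      zero_mem' := ⟨fun z => 0, by
        rw [memA_one_iff]; exact ⟨differentiableOn_const 0, integrable_zero _ _ _⟩,
        Lp.coeFn_zero _ _ _⟩
      smul_mem' := by
        rintro c f ⟨F, hF, hf⟩
        refine ⟨_, hsmul c F hF, (Lp.coeFn_smul c f).trans ?_⟩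
        filter_upwards [hf] with z hz
        simp [hz] } with hp
  have hrep : ∀ f : p, ∃ F, memA n 1 ν F ∧ (f : (Fin n → ℂ) →₁[dV n ν] ℂ) =ᵐ[dV n ν] F :=
    fun f => f.2
  choose R hRm hRe using hrep
  set ψ : p →ₗ[ℂ] ℂ :=
    { toFun := fun f => γ (R f)
      map_add' := by
        intro f g
        rw [← hγ.1 _ _ (hRm f) (hRm g)]
        refine hcongr _ _ (hRm _) (hadd _ _ (hRm f) (hRm g)) ?_
        exact (hRe _).symm.trans ((Lp.coeFn_add _ _).trans ((hRe f).add (hRe g)))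
      map_smul' := by
        intro c f
        rw [RingHom.id_apply, smul_eq_mul, ← hγ.2.1 _ _ (hRm f)]
        refine hcongr _ _ (hRm _) (hsmul c _ (hRm f)) ?_
        refine (hRe _).symm.trans ((Lp.coeFn_smul _ _).trans ?_)
        filter_upwards [hRe f] with z hz
        simp [hz] } with hψ
  have hψb : ∀ f : p, ‖ψ f‖ ≤ Cγ * ‖f‖ := by
    intro f
    refine (hC _ (hRm f)).trans_eq ?_
    rw [lpNorm_one_toReal (memA_one_iff.1 (hRm f)).2.1, Submodule.coe_norm,
      L1.norm_eq_integral_norm]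
    congr 1
    refine integral_congr_ae ?_
    filter_upwards [hRe f] with z hz
    rw [hz]
  obtain ⟨φ, hφ, hφn⟩ := exists_extension_norm_eq p (ψ.mkContinuous Cγ hψb)
  obtain ⟨g, hgm, hgb, hg⟩ := exists_bounded_density φ
  refine ⟨g, hgm, ?_, fun F hF => ?_⟩
  · filter_upwards [hgb] with z hz
    refine hz.trans ?_
    rw [hφn]
    exact ψ.mkContinuous_norm_le hC0 hψb
  · have hFi := (memA_one_iff.1 hF).2
    have hmem : hFi.toL1 ∈ p := ⟨F, hF, hFi.coeFn_toL1⟩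
    have h1 := hφ ⟨_, hmem⟩
    rw [← hg F hFi, h1]
    refine hcongr _ _ hF (hRm _) ?_
    exact hFi.coeFn_toL1.symm.trans (hRe ⟨_, hmem⟩)

theorem integrable_mul_bker_of_integrable {ν : ℝ} {m : ℕ} (hν : 0 ≤ ν + n / 2)
    {F : (Fin n → ℂ) → ℂ} (hF : Integrable F (dV n ν)) {w : Fin n → ℂ} (hw : w ∈ tube n) :
    Integrable (fun u => F u * bker (ν + m + n / 2) w u) (dV n (ν + m)) := by
  rw [integrable_dV_add_iff]
  refine Integrable.mono' (hF.norm.const_mul (lor (imP w) ^ (-(ν + n / 2)))) ?_ ?_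
  · refine (Complex.measurable_ofReal.comp (measurable_lor_rpow _)).aestronglyMeasurable.mul
      (hF.1.mul (measurable_bker_right _ w).aestronglyMeasurable)
  · filter_upwards [ae_dV_mem_tube ν] with u hu
    have hpu := lor_imP_pos hu
    have hpw := lor_imP_pos hw
    have hd := norm_del_pos hw hu
    rw [norm_mul, norm_mul, Complex.norm_real, Real.norm_of_nonneg (by positivity), norm_bker]
    have h1 : ‖del w u‖ ^ (-(ν + m + n / 2)) =
        ‖del w u‖ ^ (-(ν + n / 2)) * ‖del w u‖ ^ (-(m : ℝ)) := by
      rw [← Real.rpow_add hd]; ring_nf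
    have h2 : ‖del w u‖ ^ (-(ν + n / 2)) ≤ lor (imP w) ^ (-(ν + n / 2)) :=
      Real.rpow_le_rpow_of_nonpos hpw (lor_left_le_norm_del hw hu) (by linarith)
    have h3 : lor (imP u) ^ (m : ℝ) * ‖del w u‖ ^ (-(m : ℝ)) ≤ 1 := by
      rw [Real.rpow_neg hd.le, ← div_eq_mul_inv, div_le_one (by positivity)]
      exact Real.rpow_le_rpow hpu.le (lor_right_le_norm_del hw hu) (by positivity)
    rw [h1]
    calc lor (imP u) ^ (m : ℝ) * (‖F u‖ * (‖del w u‖ ^ (-(ν + n / 2)) * ‖del w u‖ ^ (-(m : ℝ))))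
        = (lor (imP u) ^ (m : ℝ) * ‖del w u‖ ^ (-(m : ℝ))) *
            (‖del w u‖ ^ (-(ν + n / 2)) * ‖F u‖) := by ring
      _ ≤ 1 * (lor (imP w) ^ (-(ν + n / 2)) * ‖F u‖) := by gcongr
      _ = _ := one_mul _

theorem exists_representative (hn : 2 ≤ n) {ν : ℝ} {m : ℕ} (hν : (n : ℝ) / 2 - 1 < ν)
    (hm : (n : ℝ) / 2 - 1 < (m : ℝ)) :
    ∃ C : ℝ, 0 ≤ C ∧ ∀ (g : (Fin n → ℂ) → ℂ) (Cγ : ℝ), AEStronglyMeasurable g (dV n ν) →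
      (∀ᵐ z ∂(dV n ν), ‖g z‖ ≤ Cγ) →
      ∃ H : (Fin n → ℂ) → ℂ, DifferentiableOn ℂ H (tube n) ∧
        (∀ z ∈ tube n, lor (imP z) ^ m * ‖H z‖ ≤ C * Cγ) ∧
        ∀ F, memA n 1 ν F → ∫ z, F z * g z ∂(dV n ν) =
          ∫ z, F z * (starRingEnd ℂ) (H z) * ((lor (imP z) : ℂ)) ^ m ∂(dV n ν) := by
  have hn' : (2 : ℝ) ≤ n := by exact_mod_cast hn
  set s : ℝ := ν + m + n / 2 with hs
  have hsσ : ν + n - 1 < s := by linarith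
  have hs0 : 0 ≤ s := by linarith
  set R := reproConst n (ν + m) with hR
  have hR0 : R ≠ 0 := reproConst_ne_zero hn (by linarith)
  set K : ℝ := (schurConst n ν s).toReal with hK
  have hK0 : 0 ≤ K := ENNReal.toReal_nonneg
  have hki : ∀ z ∈ tube n, Integrable (fun w => bker s w z) (dV n ν) := fun z hz =>
    integrable_bker hn hν hsσ hz
  have hkn : ∀ z ∈ tube n, ∫ w, ‖bker s w z‖ ∂(dV n ν) = lor (imP z) ^ (-(m : ℝ)) * K := by
    intro z hz
    rw [integral_norm_bker hn hν hsσ hz]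
    congr 2; rw [hs]; ring
  refine ⟨‖R‖⁻¹ * K, by positivity, fun g Cγ hgm hgb => ?_⟩
  have hgi : ∀ z ∈ tube n, Integrable (fun w => g w * bker s w z) (dV n ν) := fun z hz =>
    (hki z hz).bdd_mul hgm hgb
  have hcongr : ∀ z ∈ tube n, (fun w => (starRingEnd ℂ) (g w) * bker s z w) =ᵐ[dV n ν]
      fun w => (starRingEnd ℂ) (g w * bker s w z) := by
    intro z hz
    filter_upwards [ae_dV_mem_tube ν] with w hw
    rw [map_mul, conj_bker s hw hz]
  have hcm : AEStronglyMeasurable (fun w => (starRingEnd ℂ) (g w)) (dV n ν) :=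
    Complex.continuous_conj.comp_aestronglyMeasurable hgm
  set H : (Fin n → ℂ) → ℂ := fun z =>
    (starRingEnd ℂ) R⁻¹ * ∫ w, (starRingEnd ℂ) (g w) * bker s z w ∂(dV n ν) with hH
  have hHc : ∀ z ∈ tube n, (starRingEnd ℂ) (H z) = R⁻¹ * ∫ w, g w * bker s w z ∂(dV n ν) := by
    intro z hz
    simp only [hH]
    rw [map_mul, integral_congr_ae (hcongr z hz), integral_conj, Complex.conj_conj,
      Complex.conj_conj]
  refine ⟨H, ?_, ?_, ?_⟩
  · refine (differentiableOn_integral_bker (ae_dV_mem_tube ν) hs0 hcm fun z hz => ?_).const_mul _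
    have := (Complex.conjCLE.integrable_comp_iff).2 (hgi z hz)
    exact this.congr (hcongr z hz).symm
  · intro z hz
    have hp := lor_imP_pos hz
    have h1 : ‖H z‖ ≤ ‖R‖⁻¹ * (Cγ * (lor (imP z) ^ (-(m : ℝ)) * K)) := by
      rw [← Complex.norm_conj, hHc z hz, norm_mul, norm_inv, ← hkn z hz, ← integral_const_mul]
      gcongr
      refine norm_integral_le_of_norm_le ((hki z hz).norm.const_mul _) ?_
      filter_upwards [hgb] with w hw
      rw [norm_mul]
      gcongr
    rw [Real.rpow_neg hp.le, Real.rpow_natCast] at h1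
    have h2 : 0 < lor (imP z) ^ m := by positivity
    calc lor (imP z) ^ m * ‖H z‖
        ≤ lor (imP z) ^ m * (‖R‖⁻¹ * (Cγ * ((lor (imP z) ^ m)⁻¹ * K))) := by gcongr
      _ = ‖R‖⁻¹ * K * Cγ := by field_simp
  · intro F hF
    obtain ⟨hFd, hFi⟩ := memA_one_iff.1 hF
    have hlm : Measurable fun u : Fin n → ℂ => ((lor (imP u) ^ (m : ℝ) : ℝ) : ℂ) :=
      Complex.measurable_ofReal.comp (measurable_lor_rpow _)
    set Φ : (Fin n → ℂ) → (Fin n → ℂ) → ℂ := fun w u =>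
      g w * (((lor (imP u) ^ (m : ℝ) : ℝ) : ℂ) * (F u * bker s w u)) with hΦ
    have hrepr : ∀ w ∈ tube n, F w * g w = R⁻¹ * ∫ u, Φ w u ∂(dV n ν) := by
      intro w hw
      have h1 := reproducing hFd hw
        (integrable_mul_bker_of_integrable (m := m) (by linarith) hFi hw)
      rw [integral_dV_add] at h1
      simp only [hΦ]
      rw [integral_const_mul, h1]
      field_simp
      ring
    have hpair : Integrable (Function.uncurry Φ) ((dV n ν).prod (dV n ν)) := by
      have hmeas : AEStronglyMeasurable (Function.uncurry Φ) ((dV n ν).prod (dV n ν)) := by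
        refine (hgm.comp_fst).mul ((hlm.aestronglyMeasurable.comp_snd).mul
          ((hFi.1.comp_snd).mul ?_))
        exact (measurable_bker s).aestronglyMeasurable
      rw [integrable_prod_iff' hmeas]
      constructor
      · filter_upwards [ae_dV_mem_tube ν] with u hu
        have := (hgi u hu).mul_const (((lor (imP u) ^ (m : ℝ) : ℝ) : ℂ) * F u)
        refine this.congr (Filter.Eventually.of_forall fun w => ?_)
        simp only [Function.uncurry, hΦ]; ring
      · refine Integrable.mono' (hFi.norm.const_mul (Cγ * K)) ?_ ?_
        · exact hmeas.norm.prod_swap.integral_prod_right'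
        · filter_upwards [ae_dV_mem_tube ν] with u hu
          have hp := lor_imP_pos hu
          rw [Real.norm_of_nonneg (integral_nonneg fun _ => norm_nonneg _)]
          have h1 : ∫ w, ‖Function.uncurry Φ (w, u)‖ ∂(dV n ν) ≤
              ∫ w, (Cγ * (lor (imP u) ^ (m : ℝ) * ‖F u‖)) * ‖bker s w u‖ ∂(dV n ν) := by
            refine integral_mono_of_nonneg (Filter.Eventually.of_forall fun _ => norm_nonneg _)
              ((hki u hu).norm.const_mul _) ?_
            filter_upwards [hgb] with w hw
            simp only [Function.uncurry, hΦ, norm_mul, Complex.norm_real]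
            rw [Real.norm_of_nonneg (by positivity : 0 ≤ lor (imP u) ^ (m : ℝ))]
            calc ‖g w‖ * (lor (imP u) ^ (m : ℝ) * (‖F u‖ * ‖bker s w u‖))
                ≤ Cγ * (lor (imP u) ^ (m : ℝ) * (‖F u‖ * ‖bker s w u‖)) := by gcongr
              _ = _ := by ring
          refine h1.trans_eq ?_
          rw [integral_const_mul, hkn u hu, Real.rpow_neg hp.le]
          field_simp
    rw [integral_congr_ae (g := fun w => R⁻¹ * ∫ u, Φ w u ∂(dV n ν))
      ((ae_dV_mem_tube ν).mono hrepr), integral_const_mul, integral_integral_swap hpair,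
      ← integral_const_mul]
    refine integral_congr_ae ?_
    filter_upwards [ae_dV_mem_tube ν] with u hu
    rw [hHc u hu]
    have : ∫ w, Φ w u ∂(dV n ν) =
        (((lor (imP u) ^ (m : ℝ) : ℝ) : ℂ) * F u) * ∫ w, g w * bker s w u ∂(dV n ν) := by
      rw [← integral_const_mul]
      refine integral_congr_ae (Filter.Eventually.of_forall fun w => ?_)
      simp only [hΦ]; ring
    rw [this, Real.rpow_natCast]
    push_cast; ring

end representation

section singular

/-- A polynomially decaying weight. -/
def jwt {E : Type*} [NormedAddCommGroup E] (p : ℝ) (x : E) : ℝ≥0∞ :=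
  ENNReal.ofReal ((1 + ‖x‖) ^ (-p))

theorem measurable_jwt {E : Type*} [NormedAddCommGroup E] [MeasurableSpace E] [BorelSpace E]
    (p : ℝ) : Measurable (jwt p : E → ℝ≥0∞) := by
  unfold jwt
  exact (((measurable_norm.const_add 1).pow_const _)).ennreal_ofReal

theorem jwt_le_one {E : Type*} [NormedAddCommGroup E] {p : ℝ} (hp : 0 ≤ p) (x : E) :
    jwt p x ≤ 1 := by
  rw [jwt, ENNReal.ofReal_le_one]
  exact Real.rpow_le_one_of_one_le_of_nonpos (by linarith [norm_nonneg x]) (by linarith)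

theorem jwt_ne_top {E : Type*} [NormedAddCommGroup E] (p : ℝ) (x : E) : jwt p x ≠ ⊤ :=
  ENNReal.ofReal_ne_top

theorem lintegral_jwt_lt_top {ι : Type*} [Fintype ι] {p : ℝ}
    (hp : 2 * (Fintype.card ι : ℝ) < p) : ∫⁻ x : ι → ℂ, jwt p x < ⊤ := by
  refine finite_integral_one_add_norm ?_
  have : Module.finrank ℝ (ι → ℂ) = Fintype.card ι * 2 := by
    rw [Module.finrank_pi_fintype]; simp
  rw [this]; push_cast; linarith

theorem lintegral_jwt_complex_lt_top {p : ℝ} (hp : 2 < p) : ∫⁻ x : ℂ, jwt p x < ⊤ := by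
  refine finite_integral_one_add_norm ?_
  simpa using hp

theorem lintegral_ball_inv_norm_lt_top :
    ∫⁻ x : ℂ in Metric.ball 0 1, ‖x‖ₑ⁻¹ < ⊤ := by
  have h : Integrable (fun x : ℂ => (Iio (1 : ℝ)).indicator (fun y => y⁻¹) ‖x‖) := by
    rw [integrable_fun_norm_addHaar]
    have h1 : IntegrableOn (fun _ : ℝ => (1 : ℝ)) (Ioo 0 1) := by simp
    have h2 := (integrable_indicator_iff measurableSet_Ioo).2 h1
    refine h2.integrableOn.congr_fun (fun y hy => ?_) measurableSet_Ioi
    have hy0 : (0 : ℝ) < y := hy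
    by_cases h : y < 1
    · simp [h, hy0, hy0.ne']
    · simp [h]
  rw [← lintegral_indicator Metric.isOpen_ball.measurableSet]
  refine lt_of_le_of_lt (lintegral_mono_ae ?_) h.2
  filter_upwards [Measure.ae_ne volume (0 : ℂ)] with x hx
  by_cases h : ‖x‖ < 1
  · rw [indicator_of_mem (by simpa using h), indicator_of_mem (by simpa using h),
      enorm_inv (by simpa using hx), enorm_norm]
  · rw [indicator_of_notMem (by simpa using h)]
    exact zero_le

theorem lintegral_jwt_mul_inv_sub_le {p : ℝ} (hp : 2 < p) :
    ∃ A : ℝ≥0∞, A < ⊤ ∧ ∀ c : ℂ, ∫⁻ x : ℂ, jwt p x * ‖x - c‖ₑ⁻¹ ≤ A := by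
  refine ⟨(∫⁻ x : ℂ, jwt p x) + ∫⁻ x : ℂ in Metric.ball 0 1, ‖x‖ₑ⁻¹,
    ENNReal.add_lt_top.2 ⟨lintegral_jwt_complex_lt_top hp, lintegral_ball_inv_norm_lt_top⟩,
    fun c => ?_⟩
  rw [← lintegral_indicator Metric.isOpen_ball.measurableSet,
    ← lintegral_sub_right_eq_self (μ := volume)
      ((Metric.ball (0 : ℂ) 1).indicator fun x => ‖x‖ₑ⁻¹) c,
    ← lintegral_add_left (measurable_jwt p)]
  refine lintegral_mono fun x => ?_
  by_cases hx : x - c ∈ Metric.ball (0 : ℂ) 1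
  · rw [indicator_of_mem hx]
    exact (mul_le_of_le_one_left' (jwt_le_one (by linarith) x)).trans le_add_self
  · rw [indicator_of_notMem hx, add_zero]
    refine mul_le_of_le_one_right' ?_
    rw [ENNReal.inv_le_one, ← ofReal_norm, ENNReal.one_le_ofReal]
    simpa using hx

theorem lintegral_jwt_mul_inv_norm_lt_top {p : ℝ} (hp : 2 < p) :
    ∫⁻ x : ℂ, jwt p x * ‖x‖ₑ⁻¹ < ⊤ := by
  obtain ⟨A, hA, h⟩ := lintegral_jwt_mul_inv_sub_le hp
  simpa using (h 0).trans_lt hA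

theorem lorC_cons_cons {k : ℕ} [NeZero (k + 1 + 1)] (t x : ℂ) (r : Fin k → ℂ) :
    lorC (Fin.cons (t + x) (Fin.cons x r : Fin (k + 1) → ℂ) : Fin (k + 1 + 1) → ℂ) =
      t ^ 2 + 2 * t * x - ∑ i, r i ^ 2 := by
  have h0 : (Fin.cons (t + x) (Fin.cons x r : Fin (k + 1) → ℂ) : Fin (k + 1 + 1) → ℂ) 0 = t + x :=
    Fin.cons_zero (α := fun _ => ℂ) _ _
  rw [lorC, h0, Fin.sum_univ_succ, Fin.sum_univ_succ]
  simp
  ring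

theorem jwt_cons_cons_le {k : ℕ} {p : ℝ} (hp : 0 ≤ p) (t x : ℂ) (r : Fin k → ℂ) :
    jwt (3 * p) (Fin.cons (t + x) (Fin.cons x r : Fin (k + 1) → ℂ) : Fin (k + 1 + 1) → ℂ) ≤
      ENNReal.ofReal (2 ^ p) * (jwt p r * (jwt p t * jwt p x)) := by
  set ω : Fin (k + 1 + 1) → ℂ := Fin.cons (t + x) (Fin.cons x r : Fin (k + 1) → ℂ) with hω
  have h0 : ‖t + x‖ ≤ ‖ω‖ := by simpa [hω] using norm_le_pi_norm ω 0
  have h1 : ‖x‖ ≤ ‖ω‖ := by simpa [hω] using norm_le_pi_norm ω (Fin.succ 0)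
  have h2 : ‖r‖ ≤ ‖ω‖ := (pi_norm_le_iff_of_nonneg (norm_nonneg _)).2 fun i => by
    simpa [hω] using norm_le_pi_norm ω (Fin.succ (Fin.succ i))
  have h3 : ‖t‖ ≤ ‖t + x‖ + ‖x‖ := by simpa using norm_sub_le (t + x) x
  have hr := norm_nonneg r
  have hx := norm_nonneg x
  have ht := norm_nonneg t
  have hw := norm_nonneg ω
  simp only [jwt]
  rw [← ENNReal.ofReal_mul (by positivity), ← ENNReal.ofReal_mul (by positivity),
    ← ENNReal.ofReal_mul (by positivity)]
  refine ENNReal.ofReal_le_ofReal ?_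
  have e : (1 + ‖ω‖) ^ (-(3 * p)) =
      (1 + ‖ω‖) ^ (-p) * ((1 + ‖ω‖) ^ (-p) * (1 + ‖ω‖) ^ (-p)) := by
    rw [← Real.rpow_add (by positivity), ← Real.rpow_add (by positivity)]; ring_nf
  have a1 : (1 + ‖ω‖) ^ (-p) ≤ (1 + ‖r‖) ^ (-p) :=
    Real.rpow_le_rpow_of_nonpos (by positivity) (by linarith) (by linarith)
  have a2 : (1 + ‖ω‖) ^ (-p) ≤ (1 + ‖x‖) ^ (-p) :=
    Real.rpow_le_rpow_of_nonpos (by positivity) (by linarith) (by linarith)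
  have a3 : (1 + ‖ω‖) ^ (-p) ≤ 2 ^ p * (1 + ‖t‖) ^ (-p) := by
    have : (2 * (1 + ‖ω‖)) ^ (-p) ≤ (1 + ‖t‖) ^ (-p) :=
      Real.rpow_le_rpow_of_nonpos (by positivity) (by linarith) (by linarith)
    rw [Real.mul_rpow (by norm_num) (by positivity), Real.rpow_neg (by norm_num),
      inv_mul_le_iff₀ (by positivity)] at this
    exact this
  rw [e]
  calc _ ≤ (1 + ‖r‖) ^ (-p) * ((2 ^ p * (1 + ‖t‖) ^ (-p)) * (1 + ‖x‖) ^ (-p)) := by gcongr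
    _ = _ := by ring

theorem enorm_lorC_inv {t : ℂ} (ht : t ≠ 0) (x b : ℂ) :
    ‖t ^ 2 + 2 * t * x - b‖ₑ⁻¹ = ‖2 * t‖ₑ⁻¹ * ‖x - (b - t ^ 2) / (2 * t)‖ₑ⁻¹ := by
  have h : t ^ 2 + 2 * t * x - b = 2 * t * (x - (b - t ^ 2) / (2 * t)) := by
    field_simp; ring
  rw [h, enorm_mul, ENNReal.mul_inv (Or.inl (by simpa using ht)) (Or.inl enorm_ne_top)]

/-- The reciprocal of the Lorentz form is integrable on `ℂⁿ` against rapidly decaying weights. -/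
theorem lintegral_jwt_mul_inv_lorC_lt_top {n : ℕ} [NeZero n] (hn : 2 ≤ n) {p : ℝ}
    (hp : 2 * (n : ℝ) < p) :
    ∫⁻ ω : Fin n → ℂ, jwt (3 * p) ω * ‖lorC ω‖ₑ⁻¹ < ⊤ := by
  obtain ⟨k, rfl⟩ : ∃ k, n = k + 1 + 1 := ⟨n - 2, by omega⟩
  push_cast at hp
  have hk : (0 : ℝ) ≤ k := k.cast_nonneg
  obtain ⟨A, hA, hAle⟩ := lintegral_jwt_mul_inv_sub_le (p := p) (by linarith)
  have hm : Measurable fun ω : Fin (k + 1 + 1) → ℂ => jwt (3 * p) ω * ‖lorC ω‖ₑ⁻¹ :=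
    (measurable_jwt _).mul continuous_lorC.measurable.enorm.inv
  have hcm : Measurable fun q : (Fin (k + 1) → ℂ) × ℂ =>
      (Fin.cons q.2 q.1 : Fin (k + 1 + 1) → ℂ) := by
    refine measurable_pi_iff.2 fun i => ?_
    refine Fin.cases ?_ (fun j => ?_) i
    · simpa using measurable_snd
    · simp only [Fin.cons_succ]
      exact (measurable_pi_apply j).comp measurable_fst
  rw [lintegral_fin_cons hm]
  have hm1 : Measurable fun y : Fin (k + 1) → ℂ =>
      ∫⁻ t : ℂ, jwt (3 * p) (Fin.cons t y : Fin (k + 1 + 1) → ℂ) *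
        ‖lorC (Fin.cons t y : Fin (k + 1 + 1) → ℂ)‖ₑ⁻¹ :=
    (hm.comp hcm).lintegral_prod_right'
  rw [lintegral_fin_cons hm1]
  set B : ℝ≥0∞ := ∫⁻ t : ℂ, jwt p t * ‖t‖ₑ⁻¹ with hB
  have hBt : B < ⊤ := lintegral_jwt_mul_inv_norm_lt_top (by linarith)
  have hinner : ∀ r : Fin k → ℂ,
      (∫⁻ x : ℂ, ∫⁻ t : ℂ, jwt (3 * p)
        (Fin.cons t (Fin.cons x r : Fin (k + 1) → ℂ) : Fin (k + 1 + 1) → ℂ) *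
        ‖lorC (Fin.cons t (Fin.cons x r : Fin (k + 1) → ℂ) : Fin (k + 1 + 1) → ℂ)‖ₑ⁻¹) ≤
      ENNReal.ofReal (2 ^ p) * (jwt p r * (B * A)) := by
    intro r
    have step : ∀ x : ℂ, (∫⁻ t : ℂ, jwt (3 * p)
        (Fin.cons t (Fin.cons x r : Fin (k + 1) → ℂ) : Fin (k + 1 + 1) → ℂ) *
        ‖lorC (Fin.cons t (Fin.cons x r : Fin (k + 1) → ℂ) : Fin (k + 1 + 1) → ℂ)‖ₑ⁻¹) ≤
        ∫⁻ t : ℂ, ENNReal.ofReal (2 ^ p) * (jwt p r * (jwt p t * (jwt p x *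
          ‖t ^ 2 + 2 * t * x - ∑ i, r i ^ 2‖ₑ⁻¹))) := by
      intro x
      rw [← lintegral_add_right_eq_self (μ := volume) (fun t : ℂ => jwt (3 * p)
        (Fin.cons t (Fin.cons x r : Fin (k + 1) → ℂ) : Fin (k + 1 + 1) → ℂ) *
        ‖lorC (Fin.cons t (Fin.cons x r : Fin (k + 1) → ℂ) : Fin (k + 1 + 1) → ℂ)‖ₑ⁻¹) x]
      refine lintegral_mono fun t => ?_
      rw [lorC_cons_cons]
      refine (mul_le_mul_left (jwt_cons_cons_le (by linarith) t x r) _).trans_eq ?_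
      ring
    refine (lintegral_mono step).trans ?_
    have hm2 : Measurable fun q : ℂ × ℂ => ENNReal.ofReal (2 ^ p) * (jwt p r * (jwt p q.2 *
        (jwt p q.1 * ‖q.2 ^ 2 + 2 * q.2 * q.1 - ∑ i, r i ^ 2‖ₑ⁻¹))) := by
      refine Measurable.const_mul (Measurable.const_mul ?_ _) _
      refine ((measurable_jwt p).comp measurable_snd).mul
        (((measurable_jwt p).comp measurable_fst).mul ?_)
      exact (by fun_prop : Continuous fun q : ℂ × ℂ =>
        q.2 ^ 2 + 2 * q.2 * q.1 - ∑ i, r i ^ 2).measurable.enorm.inv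
    rw [lintegral_lintegral_swap hm2.aemeasurable]
    have hBA : ENNReal.ofReal (2 ^ p) * (jwt p r * (B * A)) =
        ∫⁻ t : ℂ, ENNReal.ofReal (2 ^ p) * (jwt p r * (jwt p t * ‖t‖ₑ⁻¹ * A)) := by
      rw [lintegral_const_mul' _ _ ENNReal.ofReal_ne_top,
        lintegral_const_mul' _ _ (jwt_ne_top p r), lintegral_mul_const' _ _ hA.ne]
    rw [hBA]
    refine lintegral_mono_ae ?_
    filter_upwards [Measure.ae_ne volume (0 : ℂ)] with t ht
    rw [lintegral_const_mul' _ _ ENNReal.ofReal_ne_top,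
      lintegral_const_mul' _ _ (jwt_ne_top p r), lintegral_const_mul' _ _ (jwt_ne_top p t)]
    have h2t : ‖2 * t‖ₑ⁻¹ ≤ ‖t‖ₑ⁻¹ := by
      refine ENNReal.inv_le_inv.2 ?_
      rw [← ofReal_norm, ← ofReal_norm, norm_mul]
      refine ENNReal.ofReal_le_ofReal ?_
      have := norm_nonneg t
      rw [Complex.norm_two]; linarith
    have hfin : ‖2 * t‖ₑ⁻¹ ≠ ⊤ := by simpa using ht
    have hle : ∫⁻ x : ℂ, jwt p x * ‖t ^ 2 + 2 * t * x - ∑ i, r i ^ 2‖ₑ⁻¹ ≤ ‖t‖ₑ⁻¹ * A := by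
      calc ∫⁻ x : ℂ, jwt p x * ‖t ^ 2 + 2 * t * x - ∑ i, r i ^ 2‖ₑ⁻¹
          = ∫⁻ x : ℂ, ‖2 * t‖ₑ⁻¹ *
              (jwt p x * ‖x - (∑ i, r i ^ 2 - t ^ 2) / (2 * t)‖ₑ⁻¹) := by
            refine lintegral_congr fun x => ?_
            rw [enorm_lorC_inv ht]; ring
        _ = ‖2 * t‖ₑ⁻¹ * ∫⁻ x : ℂ,
              jwt p x * ‖x - (∑ i, r i ^ 2 - t ^ 2) / (2 * t)‖ₑ⁻¹ :=
            lintegral_const_mul' _ _ hfin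
        _ ≤ ‖t‖ₑ⁻¹ * A := mul_le_mul' h2t (hAle _)
    rw [mul_assoc]
    gcongr
  refine (lintegral_mono hinner).trans_lt ?_
  rw [lintegral_const_mul' _ _ ENNReal.ofReal_ne_top,
    lintegral_mul_const' _ _ (ENNReal.mul_lt_top hBt hA).ne]
  refine ENNReal.mul_lt_top ENNReal.ofReal_lt_top (ENNReal.mul_lt_top
    (lintegral_jwt_lt_top ?_) (ENNReal.mul_lt_top hBt hA))
  rw [Fintype.card_fin]; linarith

end singular

section boxKernel

variable {n : ℕ} [NeZero n]

/-- The sign of the `i`-th square in the Lorentz form. -/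
def lsgn (i : Fin n) : ℂ := if i = 0 then 1 else -1

theorem lorB_single (q : Fin n → ℂ) (i : Fin n) : lorB q (Pi.single i 1) = lsgn i * q i := by
  rw [lorB, lsgn]
  rcases eq_or_ne i 0 with rfl | hi
  · simp [Pi.single_apply]; ring
  · simp [hi, Pi.single_apply, hi.symm]

theorem lsgn_mul_self (i : Fin n) : lsgn i * lsgn i = 1 := by
  unfold lsgn; split_ifs <;> simp

theorem lsgn_zero : lsgn (0 : Fin n) = 1 := if_pos rfl

theorem sum_lsgn : ∑ i : Fin n, lsgn i = 2 - n := by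
  rw [← Finset.add_sum_erase _ _ (Finset.mem_univ (0 : Fin n)), lsgn_zero,
    Finset.sum_congr rfl (g := fun _ => (-1 : ℂ))
      (fun i hi => by rw [lsgn, if_neg (Finset.ne_of_mem_erase hi)])]
  rw [Finset.sum_const, Finset.card_erase_of_mem (Finset.mem_univ _), Finset.card_univ,
    Fintype.card_fin, nsmul_eq_mul, Nat.cast_sub (NeZero.one_le)]
  push_cast; ring

theorem hasFDerivAt_del (z w : Fin n → ℂ) :
    ∃ L : (Fin n → ℂ) →L[ℂ] ℂ, HasFDerivAt (fun z => del z w) L z ∧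
      ∀ i, L (Pi.single i 1) = 2 / I * lsgn i * ((z i - (starRingEnd ℂ) (w i)) / I) := by
  obtain ⟨L, hL, hLv⟩ := hasFDerivAt_lorC (fun i => (z i - (starRingEnd ℂ) (w i)) / I)
  have h1 : HasFDerivAt (fun z : Fin n → ℂ => fun i => (z i - (starRingEnd ℂ) (w i)) / I)
      ((I⁻¹ : ℂ) • ContinuousLinearMap.id ℂ (Fin n → ℂ)) z := by
    have e : (fun z : Fin n → ℂ => fun i => (z i - (starRingEnd ℂ) (w i)) / I) =
        fun z => (I⁻¹ : ℂ) • (z - fun i => (starRingEnd ℂ) (w i)) := by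
      funext z i
      simp only [Pi.smul_apply, Pi.sub_apply, smul_eq_mul, div_eq_inv_mul]
    rw [e]
    exact ((hasFDerivAt_id (𝕜 := ℂ) z).sub_const fun i => (starRingEnd ℂ) (w i)).const_smul I⁻¹
  refine ⟨_, hL.comp z h1, fun i => ?_⟩
  rw [ContinuousLinearMap.comp_apply, hLv]
  simp only [_root_.smul_apply, ContinuousLinearMap.id_apply]
  rw [lorB_comm, lorB_smul_left, lorB_comm, lorB_single]
  ring

theorem bker_eq_bker_add_one_mul (s : ℝ) {z w : Fin n → ℂ} (hz : z ∈ tube n) (hw : w ∈ tube n) :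
    bker s z w = bker (s + 1) z w * del z w := by
  have h := del_ne_zero hz hw
  rw [bker, bker, show (-(s : ℂ)) = -((s + 1 : ℝ) : ℂ) + 1 by push_cast; ring,
    Complex.cpow_add _ _ h, Complex.cpow_one]

theorem hasFDerivAt_bker (s : ℝ) {z w : Fin n → ℂ} (hz : z ∈ tube n) (hw : w ∈ tube n) :
    ∃ L : (Fin n → ℂ) →L[ℂ] ℂ, HasFDerivAt (fun z => bker s z w) L z ∧
      ∀ i, L (Pi.single i 1) = -s * bker (s + 1) z w *
        (2 / I * lsgn i * ((z i - (starRingEnd ℂ) (w i)) / I)) := by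
  obtain ⟨L, hL, hLv⟩ := hasFDerivAt_del z w
  refine ⟨_, hL.cpow (hasFDerivAt_const (-(s : ℂ)) z) (del_mem_slitPlane hz hw), fun i => ?_⟩
  simp only [_root_.add_apply, _root_.smul_apply,
    _root_.zero_apply, hLv, smul_eq_mul]
  rw [bker]
  push_cast; ring_nf

theorem pd_bker_mul_bker_mul (σ τ : ℝ) {z u w : Fin n → ℂ} (hz : z ∈ tube n) (hu : u ∈ tube n)
    (hw : w ∈ tube n) (i : Fin n) {f : (Fin n → ℂ) → ℂ} (hf : DifferentiableAt ℂ f z) :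
    pd i (fun z => bker σ z u * bker τ z w * f z) z =
      -σ * bker (σ + 1) z u * (2 / I * lsgn i * ((z i - (starRingEnd ℂ) (u i)) / I)) *
          bker τ z w * f z
        + -τ * bker (τ + 1) z w * (2 / I * lsgn i * ((z i - (starRingEnd ℂ) (w i)) / I)) *
          bker σ z u * f z
        + bker σ z u * bker τ z w * pd i f z := by
  obtain ⟨L, hL, hLv⟩ := hasFDerivAt_bker σ hz hu
  obtain ⟨M, hM, hMv⟩ := hasFDerivAt_bker τ hz hw
  have h : HasFDerivAt (fun z => bker σ z u * bker τ z w * f z) _ z :=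
    (hL.mul hM).mul hf.hasFDerivAt
  rw [pd, h.fderiv]
  simp only [_root_.add_apply, _root_.smul_apply, hLv, hMv, smul_eq_mul, pd, Pi.mul_apply]
  ring

theorem pd_const_mul_coord_sub (a b : ℂ) (i : Fin n) (z : Fin n → ℂ) :
    DifferentiableAt ℂ (fun z : Fin n → ℂ => a * (2 / I * lsgn i * ((z i - b) / I))) z ∧
      pd i (fun z : Fin n → ℂ => a * (2 / I * lsgn i * ((z i - b) / I))) z =
        a * (-2 * lsgn i) := by
  have h : HasFDerivAt (fun z : Fin n → ℂ => a * (2 / I * lsgn i * ((z i - b) / I)))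
      ((a * (-2 * lsgn i)) • ContinuousLinearMap.proj (R := ℂ) (φ := fun _ : Fin n => ℂ) i) z := by
    have e : (fun z : Fin n → ℂ => a * (2 / I * lsgn i * ((z i - b) / I))) =
        fun z => (a * (-2 * lsgn i)) • (z i - b) := by
      funext z
      rw [smul_eq_mul]
      have : (I : ℂ) * I = -1 := I_mul_I
      field_simp
      rw [I_sq]; ring
    rw [e]
    have h1 : HasFDerivAt (fun z : Fin n → ℂ => z i)
        (ContinuousLinearMap.proj (R := ℂ) (φ := fun _ : Fin n => ℂ) i) z :=
      hasFDerivAt_apply (𝕜 := ℂ) i z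
    exact (h1.sub_const b).const_smul (a * (-2 * lsgn i))
  refine ⟨h.differentiableAt, ?_⟩
  rw [pd, h.fderiv]
  simp

theorem pd_add {F G : (Fin n → ℂ) → ℂ} {z : Fin n → ℂ} (hF : DifferentiableAt ℂ F z)
    (hG : DifferentiableAt ℂ G z) (i : Fin n) :
    pd i (fun z => F z + G z) z = pd i F z + pd i G z := by
  have h : HasFDerivAt (fun z => F z + G z) _ z := hF.hasFDerivAt.add hG.hasFDerivAt
  rw [pd, h.fderiv]
  rfl

theorem differentiableAt_bker_mul_bker_mul (σ τ : ℝ) {z u w : Fin n → ℂ} (hz : z ∈ tube n)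
    (hu : u ∈ tube n) (hw : w ∈ tube n) {f : (Fin n → ℂ) → ℂ} (hf : DifferentiableAt ℂ f z) :
    DifferentiableAt ℂ (fun z => bker σ z u * bker τ z w * f z) z :=
  (((differentiableOn_bker σ hu).differentiableAt (isOpen_tube.mem_nhds hz)).mul
    ((differentiableOn_bker τ hw).differentiableAt (isOpen_tube.mem_nhds hz))).mul hf

theorem pd_pd_bker_mul_bker (σ τ : ℝ) {z u w : Fin n → ℂ} (hz : z ∈ tube n)
    (hu : u ∈ tube n) (hw : w ∈ tube n) (i : Fin n) {p q : ℂ}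
    (hp : p = (z i - (starRingEnd ℂ) (u i)) / I) (hq : q = (z i - (starRingEnd ℂ) (w i)) / I) :
    pd i (pd i (fun z => bker σ z u * bker τ z w)) z =
      -4 * (σ * (σ + 1) * bker (σ + 2) z u * bker τ z w * p ^ 2
        + 2 * σ * τ * (bker (σ + 1) z u * bker (τ + 1) z w) * (p * q)
        + τ * (τ + 1) * bker σ z u * bker (τ + 2) z w * q ^ 2)
      + 2 * lsgn i * (σ * bker (σ + 1) z u * bker τ z w + τ * bker σ z u * bker (τ + 1) z w) := by
  have e : EqOn (pd i (fun z => bker σ z u * bker τ z w))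
      (fun z => bker (σ + 1) z u * bker τ z w *
            (-σ * (2 / I * lsgn i * ((z i - (starRingEnd ℂ) (u i)) / I)))
          + bker σ z u * bker (τ + 1) z w *
            (-τ * (2 / I * lsgn i * ((z i - (starRingEnd ℂ) (w i)) / I)))) (tube n) := by
    intro z hz
    have h := pd_bker_mul_bker_mul σ τ hz hu hw i (f := fun _ => 1) (differentiableAt_const _)
    simp only [mul_one] at h
    rw [h]
    simp only [pd, fderiv_fun_const, Pi.zero_apply, _root_.zero_apply]
    ring
  rw [pd_congr isOpen_tube e i hz]
  obtain ⟨hd₁, he₁⟩ := pd_const_mul_coord_sub (-σ) ((starRingEnd ℂ) (u i)) i z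
  obtain ⟨hd₂, he₂⟩ := pd_const_mul_coord_sub (-τ) ((starRingEnd ℂ) (w i)) i z
  rw [pd_add (differentiableAt_bker_mul_bker_mul _ _ hz hu hw hd₁)
      (differentiableAt_bker_mul_bker_mul _ _ hz hu hw hd₂),
    pd_bker_mul_bker_mul _ _ hz hu hw i hd₁, pd_bker_mul_bker_mul _ _ hz hu hw i hd₂, he₁, he₂,
    ← hp, ← hq, show σ + 1 + 1 = σ + 2 by ring, show τ + 1 + 1 = τ + 2 by ring]
  have hI : (2 / I : ℂ) = -2 * I := by
    rw [div_I]; ring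
  have hI2 : I ^ 2 = -1 := I_sq
  have hl : lsgn i ^ 2 = 1 := by rw [sq, lsgn_mul_self]
  rw [hI]
  push_cast
  ring_nf
  simp only [hI2, hl]
  ring

theorem boxOp_bker_mul_bker {σ τ : ℝ} (hστ : σ + τ = n / 2 - 1) {z u w : Fin n → ℂ}
    (hz : z ∈ tube n) (hu : u ∈ tube n) (hw : w ∈ tube n) :
    BoxOp (fun z => bker σ z u * bker τ z w) z =
      -4 * σ * τ * lorC (fun i => ((starRingEnd ℂ) (w i) - (starRingEnd ℂ) (u i)) / I) *
        (bker (σ + 1) z u * bker (τ + 1) z w) := by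
  set p : Fin n → ℂ := fun i => (z i - (starRingEnd ℂ) (u i)) / I with hp
  set q : Fin n → ℂ := fun i => (z i - (starRingEnd ℂ) (w i)) / I with hq
  have hδ : lorC (fun i => ((starRingEnd ℂ) (w i) - (starRingEnd ℂ) (u i)) / I) =
      del z u - 2 * lorB p q + del z w := by
    rw [del, del, ← hp, ← hq, ← lorC_sub]
    congr 1
    funext i
    simp only [hp, hq, Pi.sub_apply]
    ring
  have h1 : del z u = 2 * p 0 ^ 2 - ∑ i, p i ^ 2 := rfl
  have h2 : del z w = 2 * q 0 ^ 2 - ∑ i, q i ^ 2 := rfl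
  have h3 : lorB p q = 2 * (p 0 * q 0) - ∑ i, p i * q i := rfl
  have h4 : (∑ i : Fin n, lsgn i) = 2 - n := sum_lsgn
  have hsum : BoxOp (fun z => bker σ z u * bker τ z w) z =
      4 * (σ * (σ + 1) * bker (σ + 2) z u * bker τ z w * del z u
        + 2 * σ * τ * (bker (σ + 1) z u * bker (τ + 1) z w) * lorB p q
        + τ * (τ + 1) * bker σ z u * bker (τ + 2) z w * del z w)
      - 2 * n * (σ * bker (σ + 1) z u * bker τ z w + τ * bker σ z u * bker (τ + 1) z w) := by
    rw [BoxOp, pd_pd_bker_mul_bker σ τ hz hu hw 0 (p := p 0) (q := q 0) rfl rfl,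
      Finset.sum_congr rfl fun i _ =>
        pd_pd_bker_mul_bker σ τ hz hu hw i (p := p i) (q := q i) rfl rfl]
    rw [Finset.sum_add_distrib, ← Finset.mul_sum, ← Finset.sum_mul, ← Finset.mul_sum,
      Finset.sum_add_distrib, Finset.sum_add_distrib, ← Finset.mul_sum, ← Finset.mul_sum,
      ← Finset.mul_sum, h4, lsgn_zero, h1, h2, h3]
    ring
  rw [hsum, hδ, bker_eq_bker_add_one_mul σ hz hu, bker_eq_bker_add_one_mul τ hz hw]
  have e1 := bker_eq_bker_add_one_mul (σ + 1) hz hu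
  have e2 := bker_eq_bker_add_one_mul (τ + 1) hz hw
  rw [show σ + 1 + 1 = σ + 2 by ring] at e1
  rw [show τ + 1 + 1 = τ + 2 by ring] at e2
  have hn : (n : ℂ) = 2 * (σ + τ + 1) := by
    have : (n : ℝ) = 2 * (σ + τ + 1) := by linarith
    exact_mod_cast this
  rw [hn]
  generalize hX : bker (σ + 1) z u = X at *
  generalize hY : bker (τ + 1) z w = Y at *
  linear_combination (-4 * σ * (σ + 1) * Y * del z w) * e1 - 4 * τ * (τ + 1) * X * del z u * e2

end boxKernel

section growth

variable {n : ℕ} [NeZero n]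

theorem norm_basept_le : ‖basept n‖ ≤ 1 := by
  rw [pi_norm_le_iff_of_nonneg zero_le_one]
  intro i
  by_cases h : i = 0
  · subst h; simp [basept, tvec]
  · simp [basept, tvec, h]

theorem one_add_norm_sub_basept_le {w : Fin n → ℂ} (hw : w ∈ tube n) :
    1 + ‖w - basept n‖ ≤ 5 * ‖del w (basept n)‖ := by
  have h1 : 1 ≤ ‖del w (basept n)‖ := by
    have := lor_right_le_norm_del hw (basept_mem (n := n))
    rwa [imP_basept, lor_tvec] at this
  set p : Fin n → ℂ := fun i => (w i - (starRingEnd ℂ) (basept n i)) / I with hp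
  have h2 : ‖p‖ ≤ 2 * ‖del w (basept n)‖ := by
    refine norm_le_norm_lorC (p := p) ?_
    rw [hp, reP_kernel_arg, imP_basept, add_sub_cancel_right]
    exact hw
  have h3 : w - basept n = I • p - (2 : ℂ) • basept n := by
    funext i
    simp only [hp, Pi.sub_apply, Pi.smul_apply, smul_eq_mul, conj_basept]
    rw [mul_div_cancel₀ _ I_ne_zero]
    ring
  have h4 : ‖w - basept n‖ ≤ ‖p‖ + 2 := by
    rw [h3]
    refine (norm_sub_le _ _).trans ?_
    rw [norm_smul, norm_smul, norm_I, one_mul, Complex.norm_ofNat]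
    have := norm_basept_le (n := n)
    linarith
  linarith

/-- The conjugate form `Δ((w̄ - ē)/i)`, where `e` is the base point. -/
def dlt (w : Fin n → ℂ) : ℂ :=
  lorC (fun i => ((starRingEnd ℂ) (w i) - (starRingEnd ℂ) (basept n i)) / I)

theorem norm_dlt (w : Fin n → ℂ) : ‖dlt w‖ = ‖lorC (w - basept n)‖ := by
  have h : (fun i => ((starRingEnd ℂ) (w i) - (starRingEnd ℂ) (basept n i)) / I) =
      (I⁻¹ : ℂ) • fun i => (starRingEnd ℂ) ((w - basept n) i) := by
    funext i
    simp only [Pi.smul_apply, Pi.sub_apply, smul_eq_mul, map_sub]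
    ring
  rw [dlt, h, lorC_smul, ← conj_lorC, norm_mul, Complex.norm_conj]
  simp

theorem continuous_dlt : Continuous (dlt : (Fin n → ℂ) → ℂ) := by
  unfold dlt
  refine continuous_lorC.comp (continuous_pi fun i => ?_)
  have := Complex.continuous_conj
  fun_prop

theorem ae_lorC_ne_zero (hn : 2 ≤ n) : ∀ᵐ ω : Fin n → ℂ, lorC ω ≠ 0 := by
  have h := lintegral_jwt_mul_inv_lorC_lt_top hn (lt_add_one (2 * (n : ℝ)))
  have hm : Measurable fun ω : Fin n → ℂ => jwt (3 * (2 * (n : ℝ) + 1)) ω * ‖lorC ω‖ₑ⁻¹ :=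
    (measurable_jwt _).mul continuous_lorC.measurable.enorm.inv
  filter_upwards [ae_lt_top hm h.ne] with ω hω h0
  rw [h0, enorm_zero, ENNReal.inv_zero, ENNReal.mul_top] at hω
  · exact absurd hω (lt_irrefl _)
  · rw [jwt, ne_eq, ENNReal.ofReal_eq_zero, not_le]
    positivity

theorem ae_dlt_ne_zero (hn : 2 ≤ n) (ν : ℝ) : ∀ᵐ w ∂(dV n ν), dlt w ≠ 0 := by
  have h : ∀ᵐ w : Fin n → ℂ, dlt w ≠ 0 := by
    filter_upwards [(measurePreserving_sub_right volume
      (basept n)).quasiMeasurePreserving.ae (ae_lorC_ne_zero hn)] with w hw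
    rwa [← norm_ne_zero_iff, norm_dlt, norm_ne_zero_iff]
  exact (withDensity_absolutelyContinuous _ _).ae_le (ae_restrict_of_ae h)

theorem integrable_norm_del_rpow_mul_inv_dlt (hn : 2 ≤ n) {q : ℝ} (hq : 6 * (n : ℝ) < q) :
    Integrable (fun w => ‖del w (basept n)‖ ^ (-q) * ‖dlt w‖⁻¹) (dV n ((n : ℝ) / 2)) := by
  have hm : Measurable fun w : Fin n → ℂ => ‖del w (basept n)‖ ^ (-q) * ‖dlt w‖⁻¹ := by
    have h1 := (measurable_bker_left (n := n) q (basept n)).norm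
    simp only [norm_bker] at h1
    exact h1.mul continuous_dlt.norm.measurable.inv
  have hq0 : 0 < q := lt_of_le_of_lt (by positivity) hq
  refine ⟨hm.aestronglyMeasurable, ?_⟩
  rw [hasFiniteIntegral_iff_enorm, lintegral_dV]
  have hfin := lintegral_jwt_mul_inv_lorC_lt_top hn (p := q / 3) (by linarith)
  rw [show 3 * (q / 3) = q by ring] at hfin
  have htr : ∫⁻ w : Fin n → ℂ, jwt q (w - basept n) * ‖lorC (w - basept n)‖ₑ⁻¹ < ⊤ := by
    rwa [lintegral_sub_right_eq_self (fun w : Fin n → ℂ => jwt q w * ‖lorC w‖ₑ⁻¹)]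
  have hfin2 : ∫⁻ w : Fin n → ℂ, ENNReal.ofReal (5 ^ q) *
      (jwt q (w - basept n) * ‖lorC (w - basept n)‖ₑ⁻¹) < ⊤ := by
    rw [lintegral_const_mul' _ _ ENNReal.ofReal_ne_top]
    exact ENNReal.mul_lt_top ENNReal.ofReal_lt_top htr
  refine lt_of_le_of_lt ?_ hfin2
  refine (setLIntegral_mono' isOpen_tube.measurableSet fun w hw => ?_).trans
    (setLIntegral_le_lintegral (tube n) _)
  rw [sub_self, Real.rpow_zero, ENNReal.ofReal_one, one_mul, enorm_mul, ← mul_assoc]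
  have hd := norm_del_pos hw (basept_mem (n := n))
  refine mul_le_mul' ?_ ?_
  · rw [jwt, ← ENNReal.ofReal_mul (by positivity), Real.enorm_of_nonneg (by positivity)]
    refine ENNReal.ofReal_le_ofReal ?_
    have h := one_add_norm_sub_basept_le hw
    have h2 : (5 * ‖del w (basept n)‖) ^ (-q) ≤ (1 + ‖w - basept n‖) ^ (-q) :=
      Real.rpow_le_rpow_of_nonpos (by positivity) h (by linarith)
    rw [Real.mul_rpow (by norm_num) hd.le] at h2
    calc ‖del w (basept n)‖ ^ (-q)
        = 5 ^ q * (5 ^ (-q) * ‖del w (basept n)‖ ^ (-q)) := by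
          rw [← mul_assoc, ← Real.rpow_add (by norm_num), add_neg_cancel, Real.rpow_zero, one_mul]
      _ ≤ _ := by gcongr
  · have h : ‖lorC (w - basept n)‖ₑ = ‖‖dlt w‖‖ₑ := by rw [norm_dlt, enorm_norm]
    rw [h]
    rcases eq_or_ne ‖dlt w‖ 0 with h0 | h0
    · simp [h0]
    · rw [enorm_inv h0]

/-- Integrability and growth of a kernel transform of a function of controlled growth. -/
theorem integrable_mul_bker_of_growth {β σ k : ℝ} (ha : 0 ≤ β - n / 2 - k)
    (hσ : β - n / 2 - k ≤ σ) {f : (Fin n → ℂ) → ℂ} {φ : (Fin n → ℂ) → ℝ}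
    (hf : AEStronglyMeasurable f (dV n ((n : ℝ) / 2))) (hφ : Integrable φ (dV n ((n : ℝ) / 2)))
    (hb : ∀ w ∈ tube n, ‖f w‖ ≤ φ w * lor (imP w) ^ (-k)) {z : Fin n → ℂ} (hz : z ∈ tube n) :
    Integrable (fun w => f w * bker σ z w) (dV n β) ∧
      ‖∫ w, f w * bker σ z w ∂(dV n β)‖ ≤
        lor (imP z) ^ (β - n / 2 - k - σ) * ∫ w, φ w ∂(dV n ((n : ℝ) / 2)) := by
  have hβ : dV n β = dV n ((n : ℝ) / 2 + (β - n / 2)) := by congr 1; ring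
  have hle : ∀ᵐ w ∂(dV n ((n : ℝ) / 2)),
      ‖((lor (imP w) ^ (β - n / 2) : ℝ) : ℂ) * (f w * bker σ z w)‖ ≤
        lor (imP z) ^ (β - n / 2 - k - σ) * φ w := by
    filter_upwards [ae_dV_mem_tube _] with w hw
    have hx := lor_imP_pos hw
    have hy := lor_imP_pos hz
    have hd := norm_del_pos hz hw
    rw [norm_mul, norm_mul, Complex.norm_real, Real.norm_of_nonneg (by positivity), norm_bker]
    have hφ0 : 0 ≤ φ w := by
      have := (norm_nonneg _).trans (hb w hw)
      exact nonneg_of_mul_nonneg_left this (by positivity)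
    have h1 : lor (imP w) ^ (β - n / 2 - k) ≤ ‖del z w‖ ^ (β - n / 2 - k) :=
      Real.rpow_le_rpow hx.le (lor_right_le_norm_del hz hw) ha
    have h2 : ‖del z w‖ ^ (β - n / 2 - k - σ) ≤ lor (imP z) ^ (β - n / 2 - k - σ) :=
      Real.rpow_le_rpow_of_nonpos hy (lor_left_le_norm_del hz hw) (by linarith)
    calc lor (imP w) ^ (β - n / 2) * (‖f w‖ * ‖del z w‖ ^ (-σ))
        ≤ lor (imP w) ^ (β - n / 2) * (φ w * lor (imP w) ^ (-k) * ‖del z w‖ ^ (-σ)) := by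
          gcongr; exact hb w hw
      _ = lor (imP w) ^ (β - n / 2 - k) * ‖del z w‖ ^ (-σ) * φ w := by
          rw [show β - n / 2 - k = (β - n / 2) + (-k) by ring, Real.rpow_add hx]; ring
      _ ≤ ‖del z w‖ ^ (β - n / 2 - k) * ‖del z w‖ ^ (-σ) * φ w := by gcongr
      _ = ‖del z w‖ ^ (β - n / 2 - k - σ) * φ w := by
          rw [← Real.rpow_add hd, ← sub_eq_add_neg]
      _ ≤ _ := by gcongr
  constructor
  · rw [hβ, integrable_dV_add_iff]
    refine Integrable.mono' (hφ.const_mul _) ?_ hle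
    exact (Complex.measurable_ofReal.comp (measurable_lor_rpow _)).aestronglyMeasurable.mul
      (hf.mul (measurable_bker_right _ z).aestronglyMeasurable)
  · rw [hβ, integral_dV_add, ← integral_const_mul]
    exact norm_integral_le_of_norm_le (hφ.const_mul _) hle

theorem pd_const_mul (a : ℂ) (F : (Fin n → ℂ) → ℂ) (i : Fin n) :
    pd i (fun z => a * F z) = fun z => a * pd i F z := by
  funext z
  have h := fderiv_const_smul_field (𝕜 := ℂ) (f := F) a
  have e : (fun z => a * F z) = a • F := rfl
  rw [pd, e, h]
  rfl

theorem boxOp_const_mul (a : ℂ) (F : (Fin n → ℂ) → ℂ) (z : Fin n → ℂ) :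
    BoxOp (fun z => a * F z) z = a * BoxOp F z := by
  simp only [BoxOp, pd_const_mul]
  rw [← Finset.mul_sum]
  ring

theorem bker_mul_bker_neg (s : ℝ) {z w : Fin n → ℂ} (hz : z ∈ tube n) (hw : w ∈ tube n) :
    bker (-s) z w * bker s z w = 1 := by
  rw [bker, bker, ← Complex.cpow_add _ _ (del_ne_zero hz hw)]
  simp

end growth

section solver

variable {n : ℕ} [NeZero n]

/-- The wave equation `□ G = H` is solvable among holomorphic functions of polynomial growth. -/
theorem exists_boxOp_eq (hn : 2 ≤ n) {H : (Fin n → ℂ) → ℂ} (hH : DifferentiableOn ℂ H (tube n))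
    {C k₁ k₂ : ℝ} (hk₁ : 0 ≤ k₁) (hk₂ : 0 ≤ k₂)
    (hb : ∀ z ∈ tube n, ‖H z‖ ≤ C * ‖del z (basept n)‖ ^ k₁ * lor (imP z) ^ (-k₂)) :
    ∃ (G : (Fin n → ℂ) → ℂ) (C' k₁' k₂' : ℝ), 0 ≤ k₁' ∧ 0 ≤ k₂' ∧ DifferentiableOn ℂ G (tube n) ∧
      (∀ z ∈ tube n, ‖G z‖ ≤ C' * ‖del z (basept n)‖ ^ k₁' * lor (imP z) ^ (-k₂')) ∧
      EqOn (BoxOp G) H (tube n) := by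
  have hn' : (2 : ℝ) ≤ n := by exact_mod_cast hn
  have he := basept_mem (n := n)
  set β : ℝ := k₁ + k₂ + 7 * n + 1 with hβ
  set s : ℝ := β + n / 2 with hs
  set q : ℝ := β - 1 - k₁ with hq
  set R := reproConst n β with hR
  have hR0 : R ≠ 0 := reproConst_ne_zero hn (by linarith)
  have hβ0 : (β : ℂ) ≠ 0 := by
    have : β ≠ 0 := by linarith
    exact_mod_cast this
  have hs0 : (s : ℂ) - 1 ≠ 0 := by
    have : s - 1 ≠ 0 := by linarith
    exact_mod_cast this
  set c : ℂ := (R * (4 * β * (s - 1)))⁻¹ with hc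
  set Φ : (Fin n → ℂ) → ℂ := fun w => H w * bker (β - 1) w (basept n) with hΦ
  set f : (Fin n → ℂ) → ℂ := fun w => Φ w * (dlt w)⁻¹ with hf
  have hΦd : DifferentiableOn ℂ Φ (tube n) := hH.mul (differentiableOn_bker _ he)
  have hΦm : ∀ ν, AEStronglyMeasurable Φ (dV n ν) := fun ν =>
    hΦd.continuousOn.aestronglyMeasurable_dV ν
  have hfm : ∀ ν, AEStronglyMeasurable f (dV n ν) := fun ν =>
    (hΦm ν).mul continuous_dlt.measurable.inv.aestronglyMeasurable
  have hΦb : ∀ w ∈ tube n, ‖Φ w‖ ≤ C * ‖del w (basept n)‖ ^ (-q) * lor (imP w) ^ (-k₂) := by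
    intro w hw
    have hd := norm_del_pos hw he
    rw [hΦ, norm_mul, norm_bker]
    calc _ ≤ C * ‖del w (basept n)‖ ^ k₁ * lor (imP w) ^ (-k₂) *
          ‖del w (basept n)‖ ^ (-(β - 1)) := by gcongr; exact hb w hw
      _ = _ := by
        rw [show -q = k₁ + -(β - 1) by rw [hq]; ring, Real.rpow_add hd]; ring
  have hfb : ∀ w ∈ tube n, ‖f w‖ ≤
      C * (‖del w (basept n)‖ ^ (-q) * ‖dlt w‖⁻¹) * lor (imP w) ^ (-k₂) := by
    intro w hw
    rw [hf, norm_mul, norm_inv]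
    calc _ ≤ C * ‖del w (basept n)‖ ^ (-q) * lor (imP w) ^ (-k₂) * ‖dlt w‖⁻¹ := by
          gcongr; exact hΦb w hw
      _ = _ := by ring
  have hφ₁ : Integrable (fun w => C * ‖del w (basept n)‖ ^ (-q)) (dV n ((n : ℝ) / 2)) := by
    have := (integrable_bker (n := n) hn (ν := (n : ℝ) / 2) (σ := q) (by linarith)
      (by linarith) he).norm
    simp only [norm_bker] at this
    exact this.const_mul C
  have hφ₂ := (integrable_norm_del_rpow_mul_inv_dlt hn (q := q) (by linarith)).const_mul C
  have hΦi : ∀ z ∈ tube n, Integrable (fun w => Φ w * bker s z w) (dV n β) := fun z hz =>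
    (integrable_mul_bker_of_growth (β := β) (σ := s) (k := k₂) (by linarith) (by linarith)
      (hΦm _) hφ₁ hΦb hz).1
  have hfi := fun z (hz : z ∈ tube n) =>
    integrable_mul_bker_of_growth (β := β) (σ := s - 1) (k := k₂) (by linarith) (by linarith)
      (hfm _) hφ₂ hfb hz
  set A := ∫ w, C * (‖del w (basept n)‖ ^ (-q) * ‖dlt w‖⁻¹) ∂(dV n ((n : ℝ) / 2)) with hA
  set K : (Fin n → ℂ) → (Fin n → ℂ) → ℂ := fun z w =>
    (c * f w) * (bker (-β) z (basept n) * bker (s - 1) z w) with hK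
  have hG : ∀ z, ∫ w, K z w ∂(dV n β) =
      c * bker (-β) z (basept n) * ∫ w, f w * bker (s - 1) z w ∂(dV n β) := by
    intro z
    rw [← integral_const_mul]
    refine integral_congr_ae (Filter.Eventually.of_forall fun w => ?_)
    simp only [hK]; ring
  refine ⟨fun z => ∫ w, K z w ∂(dV n β), ‖c‖ * A, β, n + k₂ - 1, by linarith, by linarith,
    ?_, ?_, ?_⟩
  · simp only [hG]
    exact ((differentiableOn_bker _ he).const_mul c).mul
      (differentiableOn_integral_bker (ae_dV_mem_tube β) (by linarith) (hfm β)
        fun z hz => (hfi z hz).1)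
  · intro z hz
    beta_reduce
    rw [hG, norm_mul, norm_mul, norm_bker, neg_neg]
    calc _ ≤ ‖c‖ * ‖del z (basept n)‖ ^ β *
          (lor (imP z) ^ (β - n / 2 - k₂ - (s - 1)) * A) := by
          gcongr; exact (hfi z hz).2
      _ = _ := by
        rw [show β - n / 2 - k₂ - (s - 1) = -(n + k₂ - 1) by rw [hs]; ring]; ring
  · intro z₀ hz₀
    obtain ⟨r₁, hr₁, hsub, c₁, hc₁, hk⟩ := exists_ball_norm_bker_le hz₀ (s := s - 1) (by linarith)
    have hcont : ContinuousAt (fun z => ‖bker (-β) z (basept n)‖) z₀ :=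
      ((differentiableOn_bker (-β) he).continuousOn.continuousAt (isOpen_tube.mem_nhds hz₀)).norm
    obtain ⟨r₂, hr₂, hk₂⟩ := Metric.eventually_nhds_iff_ball.1
      (hcont.eventually (gt_mem_nhds (lt_add_one ‖bker (-β) z₀ (basept n)‖)))
    set B := ‖bker (-β) z₀ (basept n)‖ + 1 with hB
    have hb₁ : Metric.ball z₀ (min r₁ r₂) ⊆ Metric.ball z₀ r₁ :=
      Metric.ball_subset_ball (min_le_left _ _)
    have hb₂ : Metric.ball z₀ (min r₁ r₂) ⊆ Metric.ball z₀ r₂ :=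
      Metric.ball_subset_ball (min_le_right _ _)
    rw [boxOp_integral (K := K) (b := fun w => ‖c‖ * B * c₁ * ‖f w * bker (s - 1) z₀ w‖)
      (lt_min hr₁ hr₂)]
    · have hpt : ∀ᵐ w ∂(dV n β), BoxOp (fun z => K z w) z₀ =
          (c * (4 * β * (s - 1)) * bker (1 - β) z₀ (basept n)) * (Φ w * bker s z₀ w) := by
        filter_upwards [ae_dV_mem_tube β, ae_dlt_ne_zero hn β] with w hw hw0
        simp only [hK]
        rw [boxOp_const_mul, boxOp_bker_mul_bker (by rw [hs]; ring) hz₀ he hw]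
        rw [show -β + 1 = 1 - β by ring, sub_add_cancel, ← dlt, hf]
        field_simp
        push_cast
        ring
      rw [integral_congr_ae hpt, integral_const_mul, reproducing hΦd hz₀ (hΦi z₀ hz₀), ← hR, hΦ]
      have h1 := bker_mul_bker_neg (β - 1) hz₀ he
      rw [show -(β - 1) = 1 - β by ring] at h1
      rw [hc]
      field_simp
      linear_combination H z₀ * h1
    · filter_upwards [ae_dV_mem_tube β] with w hw
      exact (((differentiableOn_bker _ he).mul (differentiableOn_bker _ hw)).const_mul _).mono
        (hb₁.trans hsub)
    · intro z hz
      exact ((hfm β).const_mul c).mul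
        ((measurable_bker_right (s - 1) z).const_mul _).aestronglyMeasurable
    · filter_upwards [ae_dV_mem_tube β] with w hw z hz
      have h1 := hk z (hb₁ hz) w hw
      have h2 := (hk₂ z (hb₂ hz)).le
      simp only [hK]
      rw [norm_mul, norm_mul c, norm_mul (bker (-β) z (basept n)), norm_mul (f w)]
      calc ‖c‖ * ‖f w‖ * (‖bker (-β) z (basept n)‖ * ‖bker (s - 1) z w‖)
          ≤ ‖c‖ * ‖f w‖ * (B * (c₁ * ‖bker (s - 1) z₀ w‖)) := by gcongr
        _ = _ := by ring
    · exact (hfi z₀ hz₀).1.norm.const_mul _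

theorem exists_boxOp_iterate_eq (hn : 2 ≤ n) (m : ℕ) {H : (Fin n → ℂ) → ℂ}
    (hH : DifferentiableOn ℂ H (tube n)) {C k₁ k₂ : ℝ} (hk₁ : 0 ≤ k₁) (hk₂ : 0 ≤ k₂)
    (hb : ∀ z ∈ tube n, ‖H z‖ ≤ C * ‖del z (basept n)‖ ^ k₁ * lor (imP z) ^ (-k₂)) :
    ∃ G : (Fin n → ℂ) → ℂ, DifferentiableOn ℂ G (tube n) ∧ EqOn (BoxOp^[m] G) H (tube n) := by
  induction m generalizing H C k₁ k₂ with
  | zero => exact ⟨H, hH, fun z _ => rfl⟩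
  | succ m ih =>
    obtain ⟨G₀, C', k₁', k₂', hk₁', hk₂', hG₀, hb', he⟩ := exists_boxOp_eq hn hH hk₁ hk₂ hb
    obtain ⟨G, hG, hGe⟩ := ih hG₀ hk₁' hk₂' hb'
    refine ⟨G, hG, ?_⟩
    rw [Function.iterate_succ_apply']
    exact (boxOp_congr isOpen_tube hGe).trans he

end solver

section duality

variable {n : ℕ} [NeZero n]

theorem nonneg_of_norm_le_mul_lpNorm (hn : 2 ≤ n) {ν Cγ : ℝ} (hν : (n : ℝ) / 2 - 1 < ν)
    {γ : ((Fin n → ℂ) → ℂ) → ℂ}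
    (hC : ∀ F, memA n 1 ν F → ‖γ F‖ ≤ Cγ * (lpNorm n 1 ν F).toReal) : 0 ≤ Cγ := by
  have hmem := memA_bker hn hν (lt_add_one (ν + n - 1)) (basept_mem (n := n))
  have hi := (memA_one_iff.1 hmem).2
  have h := (norm_nonneg _).trans (hC _ hmem)
  rw [lpNorm_one_toReal hi.1] at h
  refine nonneg_of_mul_nonneg_left h (lt_of_le_of_ne (integral_nonneg fun _ => norm_nonneg _) ?_)
  intro h0
  have h1 := (integral_eq_zero_iff_of_nonneg (fun _ => norm_nonneg _) hi.norm).1 h0.symm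
  have h2 : ∀ᵐ z ∂(dV n ν), False := by
    filter_upwards [h1, ae_dV_mem_tube ν] with z hz hzt
    exact bker_ne_zero _ hzt basept_mem (norm_eq_zero.1 hz)
  rw [Filter.eventually_false_iff_eq_bot, ae_eq_bot] at h2
  exact dV_ne_zero ν h2

theorem integral_pairing_congr {ν : ℝ} {m : ℕ} {H₁ H₂ : (Fin n → ℂ) → ℂ}
    (h : EqOn H₁ H₂ (tube n)) (F : (Fin n → ℂ) → ℂ) :
    ∫ z, F z * (starRingEnd ℂ) (H₁ z) * ((lor (imP z) : ℂ)) ^ m ∂(dV n ν) =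
      ∫ z, F z * (starRingEnd ℂ) (H₂ z) * ((lor (imP z) : ℂ)) ^ m ∂(dV n ν) := by
  refine integral_congr_ae ?_
  filter_upwards [ae_dV_mem_tube ν] with z hz
  rw [h hz]

end duality

/-- Theorem (Békollé): `(A¹_ν)^* ≅ 𝔹^∞` under the pairing
`γ_G(F) = ∫ F conj(□^m G) Δ(Im z)^m dV_ν`. -/
theorem dual_A1_is_bloch (n : ℕ) [NeZero n] (hn : 3 ≤ n) (ν : ℝ) (m : ℕ)
    (hν : (n : ℝ) / 2 - 1 < ν) (hm : (n : ℝ) / 2 - 1 < (m : ℝ)) :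
    (∃ C : ℝ, ∀ (G : (Fin n → ℂ) → ℂ) (M : ℝ), DifferentiableOn ℂ G (tube n) →
      (∀ z ∈ tube n, lor (imP z) ^ m * ‖BoxOp^[m] G z‖ ≤ M) →
      ∀ F, memA n 1 ν F →
        Integrable
          (fun z => F z * (starRingEnd ℂ) (BoxOp^[m] G z) * ((lor (imP z) : ℂ)) ^ m)
          (dV n ν) ∧
        ‖∫ z, F z * (starRingEnd ℂ) (BoxOp^[m] G z) * ((lor (imP z) : ℂ)) ^ m ∂(dV n ν)‖ ≤
          C * M * (lpNorm n 1 ν F).toReal) ∧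
    (∃ C : ℝ, ∀ γ : ((Fin n → ℂ) → ℂ) → ℂ, isBddFunc n 1 ν γ →
      ∀ Cγ : ℝ, (∀ F, memA n 1 ν F → ‖γ F‖ ≤ Cγ * (lpNorm n 1 ν F).toReal) →
      ∃ G : (Fin n → ℂ) → ℂ, DifferentiableOn ℂ G (tube n) ∧
        (∀ z ∈ tube n, lor (imP z) ^ m * ‖BoxOp^[m] G z‖ ≤ C * Cγ) ∧
        ∀ F, memA n 1 ν F →
          γ F = ∫ z, F z * (starRingEnd ℂ) (BoxOp^[m] G z) * ((lor (imP z) : ℂ)) ^ m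
            ∂(dV n ν)) ∧
    (∀ (G₁ G₂ : (Fin n → ℂ) → ℂ) (M₁ M₂ : ℝ),
      DifferentiableOn ℂ G₁ (tube n) →
      (∀ z ∈ tube n, lor (imP z) ^ m * ‖BoxOp^[m] G₁ z‖ ≤ M₁) →
      DifferentiableOn ℂ G₂ (tube n) →
      (∀ z ∈ tube n, lor (imP z) ^ m * ‖BoxOp^[m] G₂ z‖ ≤ M₂) →
      ((∀ F, memA n 1 ν F →
          ∫ z, F z * (starRingEnd ℂ) (BoxOp^[m] G₁ z) * ((lor (imP z) : ℂ)) ^ m ∂(dV n ν) =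
            ∫ z, F z * (starRingEnd ℂ) (BoxOp^[m] G₂ z) * ((lor (imP z) : ℂ)) ^ m
              ∂(dV n ν)) ↔
        Set.EqOn (BoxOp^[m] G₁) (BoxOp^[m] G₂) (tube n))) := by
  have hn2 : 2 ≤ n := by omega
  refine ⟨⟨1, fun G M hG hM F hF => ?_⟩, ?_, fun G₁ G₂ M₁ M₂ hG₁ hM₁ hG₂ hM₂ => ⟨fun h => ?_,
    fun h F _ => integral_pairing_congr h F⟩⟩
  · have hi := (memA_one_iff.1 hF).2
    rw [one_mul]
    exact ⟨integrable_pairing (differentiableOn_boxOp_iterate isOpen_tube hG m) hM hi,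
      norm_integral_pairing_le hM hi⟩
  · obtain ⟨C, -, hC⟩ := exists_representative hn2 hν hm
    refine ⟨C, fun γ hγ Cγ hCγ => ?_⟩
    obtain ⟨g, hgm, hgb, hg⟩ := exists_density_of_functional hγ
      (nonneg_of_norm_le_mul_lpNorm hn2 hν hCγ) hCγ
    obtain ⟨H, hH, hHb, hHg⟩ := hC g Cγ hgm hgb
    obtain ⟨G, hG, hGH⟩ := exists_boxOp_iterate_eq hn2 m hH (C := C * Cγ) (k₁ := 0) (k₂ := m)
      le_rfl m.cast_nonneg fun z hz => by
        have hp := lor_imP_pos hz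
        rw [Real.rpow_zero, mul_one, Real.rpow_neg hp.le, Real.rpow_natCast,
          ← div_eq_mul_inv, le_div_iff₀ (by positivity), mul_comm]
        exact hHb z hz
    refine ⟨G, hG, fun z hz => ?_, fun F hF => ?_⟩
    · rw [hGH hz]; exact hHb z hz
    · rw [hg F hF, hHg F hF, integral_pairing_congr hGH]
  · exact eqOn_of_integral_pairing_eq hn2 hν hm
      (differentiableOn_boxOp_iterate isOpen_tube hG₁ m) hM₁
      (differentiableOn_boxOp_iterate isOpen_tube hG₂ m) hM₂ h
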